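/- Let d ≥ 2 and let Σ₁ : U₁ → ℝ^d, …, Σ_d : U_d → ℝ^d be smooth immersions on compact sets U_j ⊆ ℝ^{d-1} whose unit normals satisfy |det(ν_{Σ₁}(x₁), …, ν_{Σ_d}(x_d))| ≥ ν for some ν > 0 and all x_j ∈ U_j. Then there exist constants C and κ (depending on d, ν and the Σ_j) such that ( ∫_{B(0,R)} ∏_{j=1}^d |E_j g_j|^{2/(d-1)} )^{(d-1)/2} ≤ C (1 + log R)^κ ∏_{j=1}^d ‖g_j‖_{L^2(U_j)} for all R ≥ 1 and all g_j ∈ L^2(U_j). -/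

import Mathlib

open MeasureTheory Metric Complex
open scoped InnerProductSpace ENNReal

/-- The extension operator associated with a parametrised hypersurface
`Σ : U → ℝ^d`, `U ⊆ ℝ^{d-1}`:  `Eg(ξ) = ∫_U g(x) e^{i ξ·Σ(x)} dx`. -/
noncomputable def extOp {n : ℕ} (U : Set (EuclideanSpace ℝ (Fin n)))
    (S : EuclideanSpace ℝ (Fin n) → EuclideanSpace ℝ (Fin (n + 1)))
    (g : EuclideanSpace ℝ (Fin n) → ℂ) (ξ : EuclideanSpace ℝ (Fin (n + 1))) : ℂ :=
  ∫ x in U, Complex.exp (Complex.I * (⟪ξ, S x⟫_ℝ : ℂ)) * g x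

namespace MultilinearRestriction

/-- The density of the standard Cauchy distribution. -/
noncomputable def cauchy (s : ℝ) : ℝ := Real.pi⁻¹ * (1 + s ^ 2)⁻¹

lemma cauchy_pos (s : ℝ) : 0 < cauchy s := by
  unfold cauchy; positivity

lemma continuous_cauchy : Continuous cauchy := by
  unfold cauchy
  exact continuous_const.mul (Continuous.inv₀ (by fun_prop) fun s => by positivity)

lemma integrable_cauchy : Integrable cauchy :=
  integrable_inv_one_add_sq.const_mul _

lemma integral_cauchy : ∫ s, cauchy s = 1 := by
  unfold cauchy
  rw [integral_const_mul, integral_univ_inv_one_add_sq, inv_mul_cancel₀ Real.pi_ne_zero]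

lemma cauchy_add_le (s a : ℝ) : cauchy (s + a) ≤ 2 * (1 + a ^ 2) * cauchy s := by
  unfold cauchy
  have h : (1 + (s + a) ^ 2)⁻¹ ≤ 2 * (1 + a ^ 2) * (1 + s ^ 2)⁻¹ := by
    rw [← div_eq_mul_inv, inv_eq_one_div, div_le_div_iff₀ (by positivity) (by positivity)]
    nlinarith [sq_nonneg (s + 2 * a), sq_nonneg (a * (s + a)), sq_nonneg a]
  calc _ ≤ Real.pi⁻¹ * (2 * (1 + a ^ 2) * (1 + s ^ 2)⁻¹) := by gcongr
    _ = _ := by ring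

/-- The logarithmic derivative of `cauchy`. -/
noncomputable def cauchyLogDeriv (s : ℝ) : ℝ := -(2 * s) / (1 + s ^ 2)

lemma continuous_cauchyLogDeriv : Continuous cauchyLogDeriv := by
  unfold cauchyLogDeriv
  exact Continuous.div (by fun_prop) (by fun_prop) fun s => by positivity

lemma abs_cauchyLogDeriv_le (s : ℝ) : |cauchyLogDeriv s| ≤ 1 := by
  unfold cauchyLogDeriv
  rw [abs_div, abs_of_pos (show 0 < 1 + s ^ 2 by positivity), div_le_one (by positivity), abs_le]
  constructor <;> nlinarith [sq_nonneg (s - 1), sq_nonneg (s + 1)]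

lemma hasDerivAt_cauchy (s : ℝ) : HasDerivAt cauchy (cauchyLogDeriv s * cauchy s) s := by
  have h : HasDerivAt (fun s : ℝ => 1 + s ^ 2) (2 * s) s := by
    simpa using (hasDerivAt_pow 2 s).const_add 1
  have h2 := (h.inv (by positivity)).const_mul Real.pi⁻¹
  refine h2.congr_deriv ?_
  unfold cauchy cauchyLogDeriv
  have : (1 + s ^ 2) ≠ 0 := by positivity
  field_simp

lemma exists_hasDerivAt_cauchyLogDeriv (s : ℝ) :
    ∃ l, HasDerivAt cauchyLogDeriv l s ∧ |l| ≤ 2 := by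
  have h : HasDerivAt (fun s : ℝ => 1 + s ^ 2) (2 * s) s := by
    simpa using (hasDerivAt_pow 2 s).const_add 1
  have h1 : HasDerivAt (fun s : ℝ => -(2 * s)) (-2) s := by
    simpa using ((hasDerivAt_id s).const_mul 2).fun_neg
  refine ⟨_, h1.div h (by positivity), ?_⟩
  rw [abs_div, abs_of_pos (show 0 < (1 + s ^ 2) ^ 2 by positivity), div_le_iff₀ (by positivity),
    abs_le]
  constructor <;> nlinarith [sq_nonneg s, sq_nonneg (s ^ 2)]

section Kernel

variable {ι : Type*} [Fintype ι]

/-- The product Cauchy density on `ι → ℝ`. -/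
noncomputable def ker (y : ι → ℝ) : ℝ := ∏ i, cauchy (y i)

lemma ker_pos (y : ι → ℝ) : 0 < ker y := Finset.prod_pos fun _ _ => cauchy_pos _

lemma continuous_ker : Continuous (ker : (ι → ℝ) → ℝ) :=
  continuous_finsetProd _ fun i _ => continuous_cauchy.comp (continuous_apply i)

lemma ker_neg (y : ι → ℝ) : ker (-y) = ker y := by
  simp [ker, cauchy]

lemma integrable_ker : Integrable (ker : (ι → ℝ) → ℝ) :=
  Integrable.fintype_prod fun _ => integrable_cauchy

/-- The growth factor of `ker` under translations. -/
noncomputable def growth (a : ι → ℝ) : ℝ := ∏ i, (2 * (1 + a i ^ 2))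

lemma one_le_growth (a : ι → ℝ) : 1 ≤ growth a := by
  unfold growth
  refine Finset.one_le_prod fun i _ => ?_
  nlinarith [sq_nonneg (a i)]

lemma continuous_growth : Continuous (growth : (ι → ℝ) → ℝ) :=
  continuous_finsetProd _ fun _ _ => by fun_prop

lemma growth_neg (a : ι → ℝ) : growth (-a) = growth a := by simp [growth]

lemma growth_mono {a b : ι → ℝ} (h : ∀ i, |a i| ≤ |b i|) : growth a ≤ growth b := by
  unfold growth
  refine Finset.prod_le_prod (fun i _ => by positivity) fun i _ => ?_
  have := sq_le_sq.mpr (h i)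
  linarith

lemma ker_add_le (y a : ι → ℝ) : ker (y + a) ≤ growth a * ker y := by
  unfold ker growth
  rw [← Finset.prod_mul_distrib]
  exact Finset.prod_le_prod (fun i _ => (cauchy_pos _).le) fun i _ => cauchy_add_le _ _

lemma hasDerivAt_ker_line (w a : ι → ℝ) (t : ℝ) :
    HasDerivAt (fun t : ℝ => ker (w + t • a))
      ((∑ i, a i * cauchyLogDeriv ((w + t • a) i)) * ker (w + t • a)) t := by
  classical
  have h : ∀ i ∈ Finset.univ, HasDerivAt (fun t : ℝ => cauchy ((w + t • a) i))
      (a i * cauchyLogDeriv ((w + t • a) i) * cauchy ((w + t • a) i)) t := by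
    intro i _
    have h1 : HasDerivAt (fun t : ℝ => w i + t * a i) (a i) t := by
      simpa using ((hasDerivAt_id t).mul_const (a i)).const_add (w i)
    have h2 := HasDerivAt.comp t (hasDerivAt_cauchy (w i + t * a i)) h1
    refine h2.congr_deriv ?_
    simp only [Pi.add_apply, Pi.smul_apply, smul_eq_mul]; ring
  have h3 := HasDerivAt.fun_finsetProd h
  refine h3.congr_deriv ?_
  unfold ker
  rw [Finset.sum_mul]
  refine Finset.sum_congr rfl fun i _ => ?_
  rw [smul_eq_mul, ← Finset.prod_erase_mul Finset.univ _ (Finset.mem_univ i)]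
  ring

lemma abs_sum_logDeriv_le (w a : ι → ℝ) :
    |∑ i, a i * cauchyLogDeriv (w i)| ≤ ∑ i, |a i| := by
  refine (Finset.abs_sum_le_sum_abs _ _).trans (Finset.sum_le_sum fun i _ => ?_)
  rw [abs_mul]
  exact mul_le_of_le_one_right (abs_nonneg _) (abs_cauchyLogDeriv_le _)

/-- Second order Taylor estimate for the product Cauchy kernel. -/
lemma abs_ker_taylor_le (w a : ι → ℝ) :
    |ker (w + a) - ker w - (∑ i, a i * cauchyLogDeriv (w i)) * ker w|
      ≤ 3 * (∑ i, |a i|) ^ 2 * growth a * ker w := by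
  set A := ∑ i, |a i| with hA
  have hA0 : 0 ≤ A := Finset.sum_nonneg fun i _ => abs_nonneg _
  set L : ℝ → ℝ := fun t => ∑ i, a i * cauchyLogDeriv ((w + t • a) i) with hL
  set ψ : ℝ → ℝ := fun t => ker (w + t • a) with hψ
  have hψ' : ∀ t, HasDerivAt ψ (L t * ψ t) t := fun t => hasDerivAt_ker_line w a t
  have hψb : ∀ t ∈ Set.Icc (0 : ℝ) 1, ψ t ≤ growth a * ker w := by
    intro t ht
    refine (ker_add_le _ _).trans (mul_le_mul_of_nonneg_right (growth_mono fun i => ?_)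
      (ker_pos _).le)
    simp only [Pi.smul_apply, smul_eq_mul, abs_mul]
    rw [abs_of_nonneg ht.1]
    exact mul_le_of_le_one_left (abs_nonneg _) ht.2
  have hLb : ∀ t, |L t| ≤ A := fun t => abs_sum_logDeriv_le _ _
  have hL' : ∀ t, ∃ l, HasDerivAt L l t ∧ |l| ≤ 2 * A ^ 2 := by
    intro t
    choose l hl hl2 using fun i => exists_hasDerivAt_cauchyLogDeriv ((w + t • a) i)
    refine ⟨∑ i, a i * (l i * a i), ?_, ?_⟩
    · refine HasDerivAt.fun_sum fun i _ => ?_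
      have h1 : HasDerivAt (fun t : ℝ => w i + t * a i) (a i) t := by
        simpa using ((hasDerivAt_id t).mul_const (a i)).const_add (w i)
      exact (HasDerivAt.comp t (hl i) h1).const_mul (a i)
    · calc |∑ i, a i * (l i * a i)| ≤ ∑ i, |a i * (l i * a i)| := Finset.abs_sum_le_sum_abs _ _
        _ ≤ ∑ i, 2 * (|a i| * A) := by
            refine Finset.sum_le_sum fun i _ => ?_
            have h1 : |a i| ≤ A := Finset.single_le_sum (f := fun i => |a i|)
              (fun i _ => abs_nonneg _) (Finset.mem_univ i)
            rw [abs_mul, abs_mul]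
            calc |a i| * (|l i| * |a i|) ≤ |a i| * (2 * A) := by gcongr; exact hl2 i
              _ = _ := by ring
        _ = 2 * A ^ 2 := by rw [← Finset.mul_sum, ← Finset.sum_mul]; ring
  have hψpos : ∀ t, 0 < ψ t := fun t => ker_pos _
  have h1 : ∀ t ∈ Set.Icc (0 : ℝ) 1,
      ‖L t * ψ t - L 0 * ψ 0‖ ≤ 3 * A ^ 2 * growth a * ker w := by
    intro t ht
    choose l hl hl2 using hL'
    have hd : ∀ s ∈ Set.Icc (0 : ℝ) 1, HasDerivWithinAt (fun s => L s * ψ s)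
        (l s * ψ s + L s * (L s * ψ s)) (Set.Icc 0 1) s := fun s _ =>
      ((hl s).mul (hψ' s)).hasDerivWithinAt
    have hb : ∀ s ∈ Set.Ico (0 : ℝ) 1, ‖l s * ψ s + L s * (L s * ψ s)‖
        ≤ 3 * A ^ 2 * growth a * ker w := by
      intro s hs
      have e : l s * ψ s + L s * (L s * ψ s) = (l s + L s ^ 2) * ψ s := by ring
      rw [e, norm_mul, Real.norm_eq_abs, Real.norm_eq_abs, abs_of_pos (hψpos s)]
      have h3 : |l s + L s ^ 2| ≤ 3 * A ^ 2 := by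
        refine (abs_add_le _ _).trans ?_
        rw [abs_pow]
        have := pow_le_pow_left₀ (abs_nonneg _) (hLb s) 2
        linarith [hl2 s]
      calc _ ≤ 3 * A ^ 2 * (growth a * ker w) :=
            mul_le_mul h3 (hψb s ⟨hs.1, hs.2.le⟩) (hψpos s).le (by positivity)
        _ = _ := by ring
    have hC : 0 ≤ 3 * A ^ 2 * growth a * ker w := by
      have := one_le_growth a
      have := ker_pos w
      positivity
    have := norm_image_sub_le_of_norm_deriv_le_segment' hd hb t ht
    refine this.trans ?_
    rw [sub_zero]
    exact mul_le_of_le_one_right hC ht.2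
  have h2 : ∀ t ∈ Set.Icc (0 : ℝ) 1, HasDerivWithinAt (fun t => ψ t - t * (L 0 * ψ 0))
      (L t * ψ t - L 0 * ψ 0) (Set.Icc 0 1) t := fun t _ => by
    have := (hψ' t).fun_sub ((hasDerivAt_id t).mul_const (L 0 * ψ 0))
    simpa using this.hasDerivWithinAt
  have := norm_image_sub_le_of_norm_deriv_le_segment_01' h2
    (fun t ht => h1 t ⟨ht.1, ht.2.le⟩)
  simpa [hψ, hL, sub_right_comm] using this

end Kernel


/-- The standard Cauchy probability measure. -/
noncomputable def cauchyMeas : Measure ℝ := volume.withDensity fun s => ENNReal.ofReal (cauchy s)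

lemma lintegral_cauchy : ∫⁻ s, ENNReal.ofReal (cauchy s) = 1 := by
  rw [← ofReal_integral_eq_lintegral_ofReal integrable_cauchy
    (Filter.Eventually.of_forall fun s => (cauchy_pos s).le), integral_cauchy, ENNReal.ofReal_one]

instance : IsProbabilityMeasure cauchyMeas :=
  ⟨by rw [cauchyMeas, withDensity_apply _ MeasurableSet.univ, setLIntegral_univ, lintegral_cauchy]⟩

lemma cauchyMeas_Icc_ge {L : ℝ} (hL : 1 ≤ L) :
    ENNReal.ofReal (1 - 1 / L) ≤ cauchyMeas (Set.Icc (-L) L) := by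
  have hL0 : 0 < L := by linarith
  rw [cauchyMeas, withDensity_apply _ measurableSet_Icc,
    ← ofReal_integral_eq_lintegral_ofReal integrable_cauchy.integrableOn
      (Filter.Eventually.of_forall fun s => (cauchy_pos s).le)]
  refine ENNReal.ofReal_le_ofReal ?_
  rw [integral_Icc_eq_integral_Ioc, ← intervalIntegral.integral_of_le (by linarith)]
  unfold cauchy
  rw [intervalIntegral.integral_const_mul, integral_inv_one_add_sq, Real.arctan_neg]
  have h1 : Real.arctan L = Real.pi / 2 - Real.arctan L⁻¹ := by
    rw [Real.arctan_inv_of_pos hL0]; ring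
  have h2 : Real.arctan L⁻¹ ≤ L⁻¹ := by
    have h0 : 0 ≤ Real.arctan L⁻¹ := Real.arctan_nonneg.mpr (by positivity)
    simpa using Real.le_tan h0 (Real.arctan_lt_pi_div_two _)
  have h3 : 2 * Real.pi⁻¹ ≤ 1 := by
    rw [← div_eq_mul_inv, div_le_one Real.pi_pos]; exact Real.two_le_pi
  have h4 : 0 < Real.pi⁻¹ := by positivity
  have h5 : Real.pi⁻¹ * (Real.arctan L - -Real.arctan L)
      = 1 - 2 * Real.pi⁻¹ * Real.arctan L⁻¹ := by
    rw [h1]; field_simp; ring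
  rw [h5, one_div]
  have h6 : 0 ≤ Real.arctan L⁻¹ := Real.arctan_nonneg.mpr (by positivity)
  nlinarith

section Average

variable {ι : Type*} [Fintype ι]

/-- The product of standard Cauchy measures. -/
noncomputable def kerMeas (ι : Type*) [Fintype ι] : Measure (ι → ℝ) :=
  Measure.pi fun _ => cauchyMeas

instance : IsProbabilityMeasure (kerMeas ι) := by unfold kerMeas; infer_instance

lemma kerMeas_eq : kerMeas ι = volume.withDensity fun y => ENNReal.ofReal (ker y) := by
  refine Measure.pi_eq fun s hs => ?_
  rw [withDensity_apply _ (MeasurableSet.univ_pi hs), volume_pi, Measure.restrict_pi_pi,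
    ← ofReal_integral_eq_lintegral_ofReal
      (show Integrable ker _ from Integrable.fintype_prod fun _ => integrable_cauchy.integrableOn)
      (Filter.Eventually.of_forall fun s => (ker_pos s).le)]
  unfold ker
  rw [integral_fintype_prod_eq_prod (𝕜 := ℝ) (fun _ => cauchy),
    ENNReal.ofReal_prod_of_nonneg fun i _ => integral_nonneg fun s => (cauchy_pos s).le]
  refine Finset.prod_congr rfl fun i _ => ?_
  rw [cauchyMeas, withDensity_apply _ (hs i), ofReal_integral_eq_lintegral_ofReal
    integrable_cauchy.integrableOn (Filter.Eventually.of_forall fun s => (cauchy_pos s).le)]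

lemma lintegral_kerMeas {f : (ι → ℝ) → ℝ≥0∞} (hf : Measurable f) :
    ∫⁻ b, f b ∂(kerMeas ι) = ∫⁻ b, f b * ENNReal.ofReal (ker b) := by
  rw [kerMeas_eq, lintegral_withDensity_eq_lintegral_mul _
    (show Measurable fun y : ι → ℝ => ENNReal.ofReal (ker y) from
      ENNReal.measurable_ofReal.comp continuous_ker.measurable) hf]
  simp_rw [Pi.mul_apply, mul_comm]

/-- Averaging against the product Cauchy kernel at scale `S`. -/
noncomputable def avg (S : ℝ) (f : (ι → ℝ) → ℝ≥0∞) (y : ι → ℝ) : ℝ≥0∞ :=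
  ∫⁻ b, f (y - S • b) ∂(kerMeas ι)

lemma measurable_avg (S : ℝ) {f : (ι → ℝ) → ℝ≥0∞} (hf : Measurable f) : Measurable (avg S f) := by
  unfold avg
  exact Measurable.lintegral_prod_right' (f := fun p : (ι → ℝ) × (ι → ℝ) => f (p.1 - S • p.2))
    (hf.comp (by fun_prop))

lemma avg_comm (S T : ℝ) {f : (ι → ℝ) → ℝ≥0∞} (hf : Measurable f) :
    avg S (avg T f) = avg T (avg S f) := by
  ext y
  unfold avg
  rw [lintegral_lintegral_swap]
  · simp_rw [sub_right_comm y]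
  · exact (hf.comp (by fun_prop :
      Measurable fun p : (ι → ℝ) × (ι → ℝ) => y - S • p.1 - T • p.2)).aemeasurable

lemma avg_le_of_le {S : ℝ} {f : (ι → ℝ) → ℝ≥0∞} {c : ℝ≥0∞} (h : ∀ y, f y ≤ c) (y : ι → ℝ) :
    avg S f y ≤ c := by
  unfold avg
  calc _ ≤ ∫⁻ _, c ∂(kerMeas ι) := lintegral_mono fun b => h _
    _ = c := by simp

variable [DecidableEq ι]

/-- A Loomis-Whitney inequality for products of measures of equal mass. -/
lemma lintegral_prod_rpow_le_of_update {n : ℕ} (hn : 1 ≤ n) (hι : Fintype.card ι = n + 1)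
    (μ : ι → Measure ℝ) [∀ i, IsFiniteMeasure (μ i)] {m : ℝ≥0∞} (hm : ∀ i, μ i Set.univ = m)
    (hm0 : m ≠ 0) (f : ι → (ι → ℝ) → ℝ≥0∞) (hf : ∀ i, Measurable (f i))
    (hfi : ∀ i y t, f i (Function.update y i t) = f i y) :
    ∫⁻ y, ∏ i, f i y ^ (1 / n : ℝ) ∂(Measure.pi μ)
      ≤ ∏ i, (m⁻¹ * ∫⁻ y, f i y ∂(Measure.pi μ)) ^ (1 / n : ℝ) := by
  have hn0 : (n : ℝ) ≠ 0 := by positivity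
  have hmtop : ∀ i : ι, m ≠ ⊤ := fun i => hm i ▸ measure_ne_top _ _
  have hp : (0 : ℝ) ≤ 1 / n := by positivity
  have key : ∀ s : Finset ι, ∀ x, (∫⋯∫⁻_s, (fun y => ∏ i, f i y ^ (1 / n : ℝ)) ∂μ) x
      ≤ ∏ i, ((if i ∈ s then m⁻¹ else 1) * (∫⋯∫⁻_s, f i ∂μ) x) ^ (1 / n : ℝ) := by
    intro s
    induction s using Finset.induction_on with
    | empty => intro x; simp
    | insert i s his ih =>
      intro x
      set h : ι → (ι → ℝ) → ℝ≥0∞ := fun j => ∫⋯∫⁻_s, f j ∂μ with hh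
      have hhm : ∀ j, Measurable (h j) := fun j => (hf j).lmarginal μ
      have hi : ∀ t, h i (Function.update x i t) = h i x := by
        intro t
        rw [hh]
        simp only
        rw [lmarginal_update_of_notMem (hf i) his]
        congr 1
        ext y; exact hfi i y t
      rw [lmarginal_insert _ (by fun_prop) his]
      set c : ι → ℝ≥0∞ := fun j => if j ∈ s then m⁻¹ else 1 with hc
      have hum : ∀ j, Measurable fun t => c j * h j (Function.update x i t) := fun j =>
        ((hhm j).comp (measurable_update x)).const_mul _
      calc ∫⁻ t, (∫⋯∫⁻_s, (fun y => ∏ i, f i y ^ (1 / n : ℝ)) ∂μ) (Function.update x i t) ∂μ i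
          ≤ ∫⁻ t, ∏ j, (c j * h j (Function.update x i t)) ^ (1 / n : ℝ) ∂μ i :=
            lintegral_mono fun t => ih _
        _ = ∫⁻ t, (h i x) ^ (1 / n : ℝ) * ∏ j ∈ Finset.univ.erase i,
              (c j * h j (Function.update x i t)) ^ (1 / n : ℝ) ∂μ i := by
            refine lintegral_congr fun t => ?_
            rw [← Finset.mul_prod_erase Finset.univ _ (Finset.mem_univ i), hi t]
            simp [hc, his]
        _ = (h i x) ^ (1 / n : ℝ) * ∫⁻ t, ∏ j ∈ Finset.univ.erase i,
              (c j * h j (Function.update x i t)) ^ (1 / n : ℝ) ∂μ i :=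
            lintegral_const_mul _ (Finset.measurable_prod _ fun j _ => (hum j).pow_const _)
        _ ≤ (h i x) ^ (1 / n : ℝ) * ∏ j ∈ Finset.univ.erase i,
              (∫⁻ t, c j * h j (Function.update x i t) ∂μ i) ^ (1 / n : ℝ) := by
            gcongr
            refine ENNReal.lintegral_prod_norm_pow_le _ (fun j _ => (hum j).aemeasurable) ?_
              (fun _ _ => hp)
            rw [Finset.sum_const, Finset.card_erase_of_mem (Finset.mem_univ i), Finset.card_univ,
              hι, Nat.add_sub_cancel, nsmul_eq_mul]
            field_simp
        _ = _ := by
            rw [← Finset.mul_prod_erase Finset.univ _ (Finset.mem_univ i)]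
            congr 1
            · rw [lmarginal_insert _ (hf i) his]
              change _ = (_ * ∫⁻ t, h i (Function.update x i t) ∂μ i) ^ _
              simp_rw [hi, lintegral_const, hm]
              rw [if_pos (Finset.mem_insert_self _ _), mul_comm (h i x), ← mul_assoc,
                ENNReal.inv_mul_cancel hm0 (hmtop i), one_mul]
            · refine Finset.prod_congr rfl fun j hj => ?_
              have hji : j ≠ i := Finset.ne_of_mem_erase hj
              rw [lmarginal_insert _ (hf j) his, lintegral_const_mul _
                (show Measurable fun t => h j (Function.update x i t) from
                  (hhm j).comp (measurable_update x))]
              simp [hc, hji, hh]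
  have := key Finset.univ 0
  simpa using this

/-- One step of the induction on scales: if each `f i` is nearly constant in the `i`-th direction,
the integral of the product is controlled by that of the averaged functions. -/
lemma setLIntegral_prod_rpow_le_avg {n : ℕ} (hn : 1 ≤ n) (hι : Fintype.card ι = n + 1)
    {S L θ ρ : ℝ} (hS : 0 < S) (hL : 1 < L)
    (hθ : 0 ≤ θ) (f : ι → (ι → ℝ) → ℝ≥0∞) (hf : ∀ i, Measurable (f i))
    (hfi : ∀ i y t, f i (Function.update y i t) ≤
      ENNReal.ofReal (Real.exp (θ * |t - y i|)) * f i y) :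
    ∫⁻ y in closedBall 0 ρ, ∏ i, f i y ^ (1 / n : ℝ)
      ≤ ENNReal.ofReal ((1 - 1 / L)⁻¹ * Real.exp (2 * (θ * (S * L)))) ^ (2 * (n + 1)) *
        ∫⁻ y in closedBall 0 (ρ + S * L), ∏ i, avg S (f i) y ^ (1 / n : ℝ) := by
  have hp : (0 : ℝ) ≤ 1 / n := by positivity
  have hp1 : (1 / n : ℝ) ≤ 1 := by
    rw [div_le_one (by positivity)]; exact_mod_cast hn
  have hL' : 0 < 1 - 1 / L := by
    rw [sub_pos, div_lt_one (by linarith)]; exact hL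
  set m := cauchyMeas (Set.Icc (-L) L) with hm
  have hm1 : ENNReal.ofReal (1 - 1 / L) ≤ m := cauchyMeas_Icc_ge hL.le
  have hm0 : m ≠ 0 := fun h => by
    rw [h] at hm1
    simp only [nonpos_iff_eq_zero, ENNReal.ofReal_eq_zero] at hm1
    linarith
  have hmtop : m ≠ ⊤ := measure_ne_top _ _
  have hminv : m⁻¹ ≤ ENNReal.ofReal ((1 - 1 / L)⁻¹) := by
    rw [ENNReal.ofReal_inv_of_pos hL']; exact ENNReal.inv_le_inv.mpr hm1
  set box : Set (ι → ℝ) := Set.univ.pi fun _ => Set.Icc (-L) L with hbox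
  have hboxm : MeasurableSet box := MeasurableSet.univ_pi fun _ => measurableSet_Icc
  have hrestr : (kerMeas ι).restrict box
      = Measure.pi fun _ : ι => cauchyMeas.restrict (Set.Icc (-L) L) := Measure.restrict_pi_pi _ _
  have hkbox : kerMeas ι box = m ^ (n + 1) := by
    rw [kerMeas, hbox, Measure.pi_pi, Finset.prod_const, Finset.card_univ, hι]
  set E : ℝ≥0∞ := ENNReal.ofReal (Real.exp (θ * (S * L))) with hE
  set G : (ι → ℝ) → ℝ≥0∞ := fun y => ∏ i, f i y ^ (1 / n : ℝ) with hG
  have hGm : Measurable G := Finset.measurable_prod _ fun i _ => (hf i).pow_const _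
  have hEE : E * E = ENNReal.ofReal (Real.exp (2 * (θ * (S * L)))) := by
    rw [hE, ← ENNReal.ofReal_mul (Real.exp_pos _).le, ← Real.exp_add, two_mul]
  set K : ℝ≥0∞ := ENNReal.ofReal ((1 - 1 / L)⁻¹ * Real.exp (2 * (θ * (S * L)))) with hK
  have hmK : m⁻¹ * (E * E) ≤ K := by
    rw [hK, ENNReal.ofReal_mul (by positivity), ← hEE]; gcongr
  have hK1 : 1 ≤ K := by
    rw [hK, ENNReal.one_le_ofReal]
    have h1 : 1 ≤ (1 - 1 / L)⁻¹ := (one_le_inv₀ hL').mpr (by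
      have : 0 ≤ 1 / L := by positivity
      linarith)
    have h2 : 1 ≤ Real.exp (2 * (θ * (S * L))) := Real.one_le_exp (by positivity)
    nlinarith
  have hmK' : m⁻¹ ≤ K := by
    refine hminv.trans ?_
    rw [hK]
    refine ENNReal.ofReal_le_ofReal (le_mul_of_one_le_right (by positivity) ?_)
    exact Real.one_le_exp (by positivity)
  -- the local inequality
  have hloc : ∀ x, ∫⁻ b in box, G (x - S • b) ∂(kerMeas ι)
      ≤ K ^ (n + 1) * ∏ i, avg S (f i) x ^ (1 / n : ℝ) := by
    intro x
    set F : ι → (ι → ℝ) → ℝ≥0∞ := fun i b => f i (Function.update (x - S • b) i (x i)) with hF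
    have hFm : ∀ i, Measurable (F i) := fun i => by
      refine (hf i).comp (measurable_pi_iff.mpr fun j => ?_)
      by_cases h : j = i
      · subst h; simp
      · simp only [Function.update_of_ne h]; fun_prop
    have hFi : ∀ i y t, F i (Function.update y i t) = F i y := by
      intro i y t
      simp only [hF]
      congr 1
      ext j
      by_cases h : j = i
      · subst h; simp
      · simp [Function.update_of_ne h]
    have hd : ∀ b ∈ box, ∀ i, |S * b i| ≤ S * L := by
      intro b hb i
      have := hb i (Set.mem_univ i)
      rw [abs_mul, abs_of_pos hS]
      exact mul_le_mul_of_nonneg_left (abs_le.mpr this) hS.le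
    have h1 : ∀ b ∈ box, ∀ i, f i (x - S • b) ≤ E * F i b := by
      intro b hb i
      have := hfi i (Function.update (x - S • b) i (x i)) ((x - S • b) i)
      rw [Function.update_idem, Function.update_eq_self] at this
      refine this.trans ?_
      rw [hE, hF]
      gcongr
      have e : |(x - S • b) i - Function.update (x - S • b) i (x i) i| = |S * b i| := by
        rw [Function.update_self, ← abs_neg]; simp
      rw [e]; exact hd b hb i
    have h2 : ∀ b ∈ box, ∀ i, F i b ≤ E * f i (x - S • b) := by
      intro b hb i
      refine (hfi i (x - S • b) (x i)).trans ?_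
      rw [hE]
      gcongr
      have e : |x i - (x - S • b) i| = |S * b i| := by simp
      rw [e]; exact hd b hb i
    calc ∫⁻ b in box, G (x - S • b) ∂(kerMeas ι)
        ≤ ∫⁻ b in box, ∏ i, (E * F i b) ^ (1 / n : ℝ) ∂(kerMeas ι) := by
          refine setLIntegral_mono' hboxm fun b hb => ?_
          exact Finset.prod_le_prod' fun i _ => ENNReal.rpow_le_rpow (h1 b hb i) hp
      _ ≤ ∏ i, (m⁻¹ * ∫⁻ b in box, E * F i b ∂(kerMeas ι)) ^ (1 / n : ℝ) := by
          rw [hrestr]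
          refine lintegral_prod_rpow_le_of_update hn hι _ (fun i => ?_) hm0 _
            (fun i => (hFm i).const_mul _) fun i y t => ?_
          · rw [Measure.restrict_apply_univ]
          · rw [hFi]
      _ ≤ ∏ i, (K * avg S (f i) x) ^ (1 / n : ℝ) := by
          refine Finset.prod_le_prod' fun i _ => ENNReal.rpow_le_rpow ?_ hp
          calc m⁻¹ * ∫⁻ b in box, E * F i b ∂(kerMeas ι)
              ≤ m⁻¹ * ∫⁻ b in box, (E * E) * f i (x - S • b) ∂(kerMeas ι) := by
                refine mul_le_mul' le_rfl ?_
                refine setLIntegral_mono' hboxm fun b hb => ?_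
                rw [mul_assoc]
                gcongr
                exact h2 b hb i
            _ ≤ m⁻¹ * ∫⁻ b, (E * E) * f i (x - S • b) ∂(kerMeas ι) := by
                refine mul_le_mul' le_rfl ?_
                exact setLIntegral_le_lintegral _ _
            _ = m⁻¹ * (E * E) * avg S (f i) x := by
                rw [lintegral_const_mul _ (show Measurable fun b : ι → ℝ => f i (x - S • b) from
                  (hf i).comp (by fun_prop)), avg]
                simp only [mul_assoc]
            _ ≤ _ := by gcongr
      _ = ∏ i, K ^ (1 / n : ℝ) * avg S (f i) x ^ (1 / n : ℝ) :=
          Finset.prod_congr rfl fun i _ => ENNReal.mul_rpow_of_nonneg _ _ hp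
      _ ≤ ∏ i, K * avg S (f i) x ^ (1 / n : ℝ) := by
          refine Finset.prod_le_prod' fun i _ => ?_
          gcongr
          exact (ENNReal.rpow_le_rpow_of_exponent_le hK1 hp1).trans_eq (ENNReal.rpow_one _)
      _ = _ := by rw [Finset.prod_mul_distrib, Finset.prod_const, Finset.card_univ, hι]
  have hmeas2 : Measurable fun p : (ι → ℝ) × (ι → ℝ) => G (p.1 - S • p.2) :=
    hGm.comp (by fun_prop)
  have hlow : m ^ (n + 1) * ∫⁻ y in closedBall 0 ρ, G y
      ≤ ∫⁻ x in closedBall 0 (ρ + S * L), ∫⁻ b in box, G (x - S • b) ∂(kerMeas ι) := by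
    rw [lintegral_lintegral_swap hmeas2.aemeasurable, ← hkbox]
    calc kerMeas ι box * ∫⁻ y in closedBall 0 ρ, G y
        = ∫⁻ _ in box, (∫⁻ y in closedBall 0 ρ, G y) ∂(kerMeas ι) := by
          rw [setLIntegral_const, mul_comm]
      _ ≤ _ := by
          refine setLIntegral_mono' hboxm fun b hb => ?_
          rw [← lintegral_indicator measurableSet_closedBall,
            ← lintegral_indicator measurableSet_closedBall,
            ← lintegral_sub_right_eq_self _ (S • b)]
          refine lintegral_mono fun y => ?_
          by_cases h : y - S • b ∈ closedBall (0 : ι → ℝ) ρ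
          · have h' : y ∈ closedBall (0 : ι → ℝ) (ρ + S * L) := by
              rw [mem_closedBall_zero_iff] at h ⊢
              have hb' : ‖S • b‖ ≤ S * L := by
                rw [norm_smul, Real.norm_of_nonneg hS.le]
                gcongr
                refine (pi_norm_le_iff_of_nonneg (by linarith)).mpr fun i => ?_
                exact abs_le.mpr (hb i (Set.mem_univ i))
              calc ‖y‖ = ‖(y - S • b) + S • b‖ := by rw [sub_add_cancel]
                _ ≤ _ := (norm_add_le _ _).trans (add_le_add h hb')
            rw [Set.indicator_of_mem h, Set.indicator_of_mem h']
          · rw [Set.indicator_of_notMem h]; exact zero_le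
  have hcancel : (m⁻¹) ^ (n + 1) * m ^ (n + 1) = 1 := by
    rw [← mul_pow, ENNReal.inv_mul_cancel hm0 hmtop, one_pow]
  calc ∫⁻ y in closedBall 0 ρ, G y
      = (m⁻¹) ^ (n + 1) * (m ^ (n + 1) * ∫⁻ y in closedBall 0 ρ, G y) := by
        rw [← mul_assoc, hcancel, one_mul]
    _ ≤ K ^ (n + 1) * ∫⁻ x in closedBall 0 (ρ + S * L),
          K ^ (n + 1) * ∏ i, avg S (f i) x ^ (1 / n : ℝ) := by
        gcongr ?_ ^ _ * ?_
        exact hlow.trans (lintegral_mono fun x => hloc x)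
    _ = _ := by
        rw [lintegral_const_mul _ (Finset.measurable_prod _ fun i _ =>
          (measurable_avg S (hf i)).pow_const _), ← mul_assoc, ← pow_add, ← two_mul]

end Average


section Osc

open scoped FourierTransform SchwartzMap

variable {X : Type*} [MeasurableSpace X] {μ : Measure X}

/-- The oscillatory integral with phase `θ` and amplitude `g`. -/
noncomputable def osc (μ : Measure X) (θ : X → ℝ) (g : X → ℂ) : ℂ :=
  ∫ x, Complex.exp (Complex.I * (θ x : ℂ)) * g x ∂μ

lemma norm_exp_I_mul (t : ℝ) : ‖Complex.exp (Complex.I * (t : ℂ))‖ = 1 := by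
  rw [mul_comm]; exact Complex.norm_exp_ofReal_mul_I t

lemma norm_osc_le (θ : X → ℝ) (g : X → ℂ) : ‖osc μ θ g‖ ≤ ∫ x, ‖g x‖ ∂μ := by
  refine (norm_integral_le_integral_norm _).trans_eq ?_
  simp

lemma aestronglyMeasurable_exp_I {θ : X → ℝ} (hθ : AEMeasurable θ μ) :
    AEStronglyMeasurable (fun x => Complex.exp (Complex.I * (θ x : ℂ))) μ :=
  (Complex.measurable_exp.comp_aemeasurable
    ((Complex.measurable_ofReal.comp_aemeasurable hθ).const_mul _)).aestronglyMeasurable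

lemma integrable_osc {θ : X → ℝ} {g : X → ℂ} (hθ : AEMeasurable θ μ) (hg : Integrable g μ) :
    Integrable (fun x => Complex.exp (Complex.I * (θ x : ℂ)) * g x) μ :=
  hg.bdd_mul (c := 1) (aestronglyMeasurable_exp_I hθ)
    (Filter.Eventually.of_forall fun _ => (norm_exp_I_mul _).le)

lemma continuous_osc {P : Type*} [TopologicalSpace P] [FirstCountableTopology P]
    {θ : P → X → ℝ} {g : X → ℂ} (hθ : ∀ p, AEMeasurable (θ p) μ)
    (hc : ∀ x, Continuous fun p => θ p x) (hg : Integrable g μ) :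
    Continuous fun p => osc μ (θ p) g := by
  refine continuous_of_dominated (bound := fun x => ‖g x‖) (fun p => ?_) (fun p => ?_) hg.norm ?_
  · exact (integrable_osc (hθ p) hg).aestronglyMeasurable
  · exact Filter.Eventually.of_forall fun x => by rw [norm_mul, norm_exp_I_mul, one_mul]
  · exact Filter.Eventually.of_forall fun x => by
      have := hc x
      fun_prop

variable {E : Type*} [NormedAddCommGroup E] [InnerProductSpace ℝ E] [FiniteDimensional ℝ E]
  [MeasurableSpace E] [BorelSpace E]

lemma integral_fourier_mul_exp (ρ : 𝓢(E, ℂ)) (p : E) :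
    ∫ η, 𝓕 ρ η * Complex.exp (Complex.I * ((2 * Real.pi * ⟪η, p⟫_ℝ : ℝ) : ℂ)) = ρ p := by
  have h : 𝓕⁻ (𝓕 ρ) p = ρ p := by rw [FourierTransform.fourierInv_fourier_eq]
  rw [← h, SchwartzMap.fourierInv_coe, Real.fourierInv_eq']
  refine integral_congr_ae (Filter.Eventually.of_forall fun η => ?_)
  simp only [smul_eq_mul]
  rw [mul_comm, mul_comm Complex.I]

lemma integral_fourier_mul_osc [SFinite μ] (ρ : 𝓢(E, ℂ)) {φ : X → E} {θ : X → ℝ} {g : X → ℂ}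
    (hφ : AEMeasurable φ μ) (hθ : AEMeasurable θ μ) (hg : Integrable g μ) :
    ∫ η, 𝓕 ρ η * osc μ (fun x => θ x + 2 * Real.pi * ⟪η, φ x⟫_ℝ) g
      = osc μ θ (fun x => ρ (φ x) * g x) := by
  have hint : Integrable (fun p : E × X => 𝓕 ρ p.1 *
      (Complex.exp (Complex.I * ((θ p.2 + 2 * Real.pi * ⟪p.1, φ p.2⟫_ℝ : ℝ) : ℂ)) * g p.2))
      (volume.prod μ) := by
    have h1 : Integrable (fun p : E × X => 𝓕 ρ p.1 * g p.2) (volume.prod μ) :=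
      (𝓕 ρ).integrable.mul_prod hg
    have h2 : AEMeasurable (fun p : E × X => θ p.2 + 2 * Real.pi * ⟪p.1, φ p.2⟫_ℝ)
        (volume.prod μ) := by
      refine (hθ.comp_snd).add (AEMeasurable.const_mul ?_ _)
      exact AEMeasurable.inner measurable_fst.aemeasurable hφ.comp_snd
    refine (h1.bdd_mul (c := 1) (aestronglyMeasurable_exp_I h2)
      (Filter.Eventually.of_forall fun _ => (norm_exp_I_mul _).le)).congr
      (Filter.Eventually.of_forall fun p => ?_)
    simp only
    ring
  unfold osc
  simp_rw [← integral_const_mul]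
  rw [integral_integral_swap hint]
  refine integral_congr_ae (Filter.Eventually.of_forall fun x => ?_)
  simp only
  rw [← integral_fourier_mul_exp ρ (φ x), ← integral_mul_const, ← integral_const_mul]
  refine integral_congr_ae (Filter.Eventually.of_forall fun η => ?_)
  simp only
  rw [Complex.ofReal_add, mul_add, Complex.exp_add]
  ring

lemma integral_fourier_mul_exp_mul_inner (ρ : 𝓢(E, ℂ)) (p w : E) :
    ∫ η, 𝓕 ρ η * Complex.exp (Complex.I * ((2 * Real.pi * ⟪η, p⟫_ℝ : ℝ) : ℂ)) *
      ((2 * Real.pi * ⟪w, η⟫_ℝ : ℝ) : ℂ) = -Complex.I * fderiv ℝ ρ p w := by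
  have h := integral_fourier_mul_exp (LineDeriv.lineDerivOp w ρ) p
  rw [SchwartzMap.lineDerivOp_apply_eq_fderiv] at h
  rw [← h, ← integral_const_mul]
  refine integral_congr_ae (Filter.Eventually.of_forall fun η => ?_)
  simp only
  rw [SchwartzMap.fourier_lineDerivOp_eq]
  have ht : (fun η : E => ⟪η, w⟫_ℝ).HasTemperateGrowth := by fun_prop
  rw [_root_.smul_apply, SchwartzMap.smulLeftCLM_apply_apply ht]
  simp only [smul_eq_mul, Complex.real_smul, Complex.ofReal_mul, Complex.ofReal_ofNat]
  rw [real_inner_comm w η]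
  linear_combination (𝓕 ρ η * Complex.exp (Complex.I * (2 * Real.pi * ⟪η, p⟫_ℝ)) *
    (2 * Real.pi * ⟪w, η⟫_ℝ)) * Complex.I_mul_I

end Osc

section Bernstein

open scoped FourierTransform SchwartzMap

variable {ι : Type*} [Fintype ι]

/-- The weighted integral of `f` against the kernel centred at `y`. -/
noncomputable def wint (f : (ι → ℝ) → ℝ≥0∞) (y : ι → ℝ) : ℝ≥0∞ :=
  ∫⁻ z, f z * ENNReal.ofReal (ker (y - z))

lemma wint_mono {f g : (ι → ℝ) → ℝ≥0∞} (h : ∀ z, f z ≤ g z) (y : ι → ℝ) : wint f y ≤ wint g y :=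
  lintegral_mono fun z => mul_le_mul' (h z) le_rfl

lemma measurable_ker_sub (y : ι → ℝ) : Measurable fun z => ENNReal.ofReal (ker (y - z)) :=
  ENNReal.measurable_ofReal.comp (continuous_ker.comp (by fun_prop)).measurable

lemma wint_shift_le (f : (ι → ℝ) → ℝ≥0∞) (a y : ι → ℝ) :
    wint (fun z => f (z + a)) y ≤ ENNReal.ofReal (growth a) * wint f y := by
  unfold wint
  rw [← lintegral_const_mul' _ _ ENNReal.ofReal_ne_top,
    ← lintegral_sub_right_eq_self (fun z => f (z + a) * ENNReal.ofReal (ker (y - z))) a]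
  refine lintegral_mono fun z => ?_
  simp only [sub_add_cancel]
  rw [mul_left_comm, ← ENNReal.ofReal_mul (zero_le_one.trans (one_le_growth a)),
    show y - (z - a) = y - z + a by abel]
  exact mul_le_mul' le_rfl (ENNReal.ofReal_le_ofReal (ker_add_le _ _))

lemma growth_add_le (a b : ι → ℝ) : growth (a + b) ≤ growth a * growth b := by
  unfold growth
  rw [← Finset.prod_mul_distrib]
  refine Finset.prod_le_prod (fun i _ => by positivity) fun i _ => ?_
  rw [Pi.add_apply]
  nlinarith [sq_nonneg (a i - b i), sq_nonneg (a i * b i)]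

lemma ennreal_mul_le_sq_add_sq (b c : ℝ≥0∞) : b * c ≤ b ^ 2 + c ^ 2 := by
  rcases le_total b c with h | h
  · exact (mul_le_mul' h le_rfl).trans (by rw [← sq]; exact le_add_self)
  · exact (mul_le_mul' le_rfl h).trans (by rw [← sq]; exact le_self_add)

lemma wint_shift_mul_le {w : (ι → ℝ) → ℂ} (hw : Continuous w) (a y : ι → ℝ) :
    wint (fun z => ‖w (z + a)‖ₑ * ‖w z‖ₑ) y
      ≤ ENNReal.ofReal (2 * growth a) * wint (fun z => ‖w z‖ₑ ^ 2) y := by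
  have h1 : Measurable fun z => ‖w z‖ₑ ^ 2 * ENNReal.ofReal (ker (y - z)) :=
    (hw.measurable.enorm.pow_const _).mul (measurable_ker_sub y)
  calc wint (fun z => ‖w (z + a)‖ₑ * ‖w z‖ₑ) y
      ≤ wint (fun z => ‖w (z + a)‖ₑ ^ 2 + ‖w z‖ₑ ^ 2) y :=
        wint_mono (fun z => ennreal_mul_le_sq_add_sq _ _) y
    _ = wint (fun z => ‖w (z + a)‖ₑ ^ 2) y + wint (fun z => ‖w z‖ₑ ^ 2) y := by
        unfold wint; simp_rw [add_mul]; rw [lintegral_add_right _ h1]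
    _ ≤ ENNReal.ofReal (growth a) * wint (fun z => ‖w z‖ₑ ^ 2) y +
          ENNReal.ofReal (growth a) * wint (fun z => ‖w z‖ₑ ^ 2) y := by
        gcongr
        · exact wint_shift_le (fun z => ‖w z‖ₑ ^ 2) a y
        · exact le_mul_of_one_le_left zero_le (by simpa using one_le_growth a)
    _ = _ := by
        rw [← two_mul, ← mul_assoc, ENNReal.ofReal_mul two_pos.le]; simp

variable {X : Type*} [MeasurableSpace X] {μ : Measure X}

/-- The extension of `g` from the frequencies `τ`. -/
noncomputable def tauExt (μ : Measure X) (τ : X → ι → ℝ) (g : X → ℂ) (z : ι → ℝ) : ℂ :=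
  osc μ (fun x => ∑ k, z k * τ x k) g

lemma aemeasurable_phase {τ : X → ι → ℝ} (hτ : AEMeasurable τ μ) (z : ι → ℝ) :
    AEMeasurable (fun x => ∑ k, z k * τ x k) μ :=
  Finset.aemeasurable_fun_sum _ fun k _ => (aemeasurable_pi_iff.mp hτ k).const_mul _

lemma continuous_tauExt {τ : X → ι → ℝ} {g : X → ℂ} (hτ : AEMeasurable τ μ)
    (hg : Integrable g μ) : Continuous (tauExt μ τ g) :=
  continuous_osc (aemeasurable_phase hτ) (fun x => by fun_prop) hg

lemma hasDerivAt_tauExt_line {τ : X → ι → ℝ} {g : X → ℂ} (hτ : AEMeasurable τ μ)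
    (hg : Integrable g μ) {N : ℝ} (hN : ∀ᵐ x ∂μ, ∀ k, |τ x k| ≤ N) (z a : ι → ℝ) (s : ℝ) :
    HasDerivAt (fun s : ℝ => tauExt μ τ g (z + s • a))
      (∑ k, Complex.I * a k * tauExt μ τ (fun x => τ x k * g x) (z + s • a)) s := by
  have hgk : ∀ k, Integrable (fun x => (τ x k : ℂ) * g x) μ := fun k =>
    hg.bdd_mul (c := N) (Complex.measurable_ofReal.comp_aemeasurable
      (aemeasurable_pi_iff.mp hτ k)).aestronglyMeasurable
      (by filter_upwards [hN] with x hx using by simpa using hx k)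
  have hsum : (∑ k, Complex.I * a k * tauExt μ τ (fun x => τ x k * g x) (z + s • a))
      = ∫ x, (Complex.I * ((∑ k, a k * τ x k : ℝ) : ℂ)) *
          (Complex.exp (Complex.I * ((∑ k, (z + s • a) k * τ x k : ℝ) : ℂ)) * g x) ∂μ := by
    unfold tauExt osc
    simp_rw [← integral_const_mul]
    rw [← integral_finsetSum _ fun k _ =>
      (integrable_osc (aemeasurable_phase hτ _) (hgk k)).const_mul _]
    refine integral_congr_ae (Filter.Eventually.of_forall fun x => ?_)
    simp only [Complex.ofReal_sum, Complex.ofReal_mul, Finset.mul_sum, Finset.sum_mul]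
    refine Finset.sum_congr rfl fun k _ => by ring
  rw [hsum]
  refine (hasDerivAt_integral_of_dominated_loc_of_deriv_le (s := Set.univ)
    (F := fun s x => Complex.exp (Complex.I * ((∑ k, (z + s • a) k * τ x k : ℝ) : ℂ)) * g x)
    (F' := fun s x => (Complex.I * ((∑ k, a k * τ x k : ℝ) : ℂ)) *
          (Complex.exp (Complex.I * ((∑ k, (z + s • a) k * τ x k : ℝ) : ℂ)) * g x))
    (bound := fun x => (∑ k, |a k| * N) * ‖g x‖) Filter.univ_mem ?_ ?_ ?_ ?_ ?_ ?_).2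
  · exact Filter.Eventually.of_forall fun s =>
      (integrable_osc (aemeasurable_phase hτ _) hg).aestronglyMeasurable
  · exact integrable_osc (aemeasurable_phase hτ _) hg
  · exact ((Complex.measurable_ofReal.comp_aemeasurable
      (aemeasurable_phase hτ a)).const_mul _).aestronglyMeasurable.mul
      (integrable_osc (aemeasurable_phase hτ _) hg).aestronglyMeasurable
  · filter_upwards [hN] with x hx s _
    rw [norm_mul, norm_mul, norm_mul, norm_exp_I_mul, one_mul, Complex.norm_I, one_mul,
      Complex.norm_real, Real.norm_eq_abs]
    gcongr
    refine (Finset.abs_sum_le_sum_abs _ _).trans (Finset.sum_le_sum fun k _ => ?_)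
    rw [abs_mul]
    exact mul_le_mul_of_nonneg_left (hx k) (abs_nonneg _)
  · exact hg.norm.const_mul _
  · refine Filter.Eventually.of_forall fun x s _ => ?_
    have h1 : HasDerivAt (fun s : ℝ => ∑ k, (z + s • a) k * τ x k) (∑ k, a k * τ x k) s := by
      refine HasDerivAt.fun_sum fun k _ => ?_
      simp only [Pi.add_apply, Pi.smul_apply, smul_eq_mul]
      simpa using (((hasDerivAt_id s).mul_const (a k)).const_add (z k)).mul_const (τ x k)
    have h2 := ((h1.ofReal_comp.const_mul Complex.I).cexp).mul_const (g x)
    refine h2.congr_deriv ?_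
    ring

/-- The bump-truncated identity on `ℝ`. -/
lemma exists_schwartz_eq_id : ∃ β : 𝓢(ℝ, ℂ), ∀ t : ℝ, |t| ≤ 1 → β t = t := by
  let b : ContDiffBump (0 : ℝ) := ⟨1, 2, one_pos, one_lt_two⟩
  have hs : HasCompactSupport fun t : ℝ => ((b t * t : ℝ) : ℂ) :=
    (b.hasCompactSupport.mul_right (f' := fun t : ℝ => t)).comp_left
      (g := Complex.ofReal) Complex.ofReal_zero
  have hd : ContDiff ℝ (⊤ : ℕ∞) fun t : ℝ => ((b t * t : ℝ) : ℂ) :=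
    Complex.ofRealCLM.contDiff.comp (b.contDiff.mul contDiff_id)
  refine ⟨hs.toSchwartzMap hd, fun t ht => ?_⟩
  have : b t = 1 := b.one_of_mem_closedBall (by simpa using ht)
  simp [this]

variable [DecidableEq ι]

lemma enorm_tauExt_add_sub_le [SFinite μ] (β : 𝓢(ℝ, ℂ)) (hβ : ∀ t : ℝ, |t| ≤ 1 → β t = t)
    {τ : X → ι → ℝ} {g : X → ℂ} (hτ : AEMeasurable τ μ)
    (hg : Integrable g μ) {N : ℝ} (hN0 : 0 < N) (hN : ∀ᵐ x ∂μ, ∀ k, |τ x k| ≤ N) (z a : ι → ℝ) :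
    ‖tauExt μ τ g (z + a) - tauExt μ τ g z‖ₑ ≤ ∑ k, ENNReal.ofReal (|a k| * N) *
      ∫⁻ s in Set.Icc (0 : ℝ) 1, ∫⁻ t : ℝ, ‖𝓕 β t‖ₑ *
        ‖tauExt μ τ g (z + (s • a + Pi.single k (2 * Real.pi * t / N)))‖ₑ := by
  have hgk : ∀ k, Integrable (fun x => (τ x k : ℂ) * g x) μ := fun k =>
    hg.bdd_mul (c := N) (Complex.measurable_ofReal.comp_aemeasurable
      (aemeasurable_pi_iff.mp hτ k)).aestronglyMeasurable
      (by filter_upwards [hN] with x hx using by simpa using hx k)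
  have hcont : ∀ k, Continuous (tauExt μ τ (fun x => τ x k * g x)) := fun k =>
    continuous_tauExt hτ (hgk k)
  have hD : ∀ s, HasDerivAt (fun s : ℝ => tauExt μ τ g (z + s • a)) _ s :=
    hasDerivAt_tauExt_line hτ hg hN z a
  have hDc : Continuous fun s : ℝ =>
      ∑ k, Complex.I * a k * tauExt μ τ (fun x => τ x k * g x) (z + s • a) :=
    continuous_finsetSum _ fun k _ => continuous_const.mul ((hcont k).comp (by fun_prop))
  have hk : ∀ k w, tauExt μ τ (fun x => τ x k * g x) w
      = N * ∫ t : ℝ, 𝓕 β t * tauExt μ τ g (w + Pi.single k (2 * Real.pi * t / N)) := by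
    intro k w
    have h := integral_fourier_mul_osc β (φ := fun x => τ x k / N)
      (aemeasurable_pi_iff.mp hτ k |>.div_const N) (aemeasurable_phase hτ w) hg
    have e1 : ∀ t : ℝ, tauExt μ τ g (w + Pi.single k (2 * Real.pi * t / N)) =
        osc μ (fun x => ∑ k, w k * τ x k + 2 * Real.pi * ⟪t, τ x k / N⟫_ℝ) g := by
      intro t
      unfold tauExt
      congr 1
      ext x
      simp only [Pi.add_apply, add_mul, Finset.sum_add_distrib, Pi.single_apply, ite_mul, zero_mul,
        Finset.sum_ite_eq', Finset.mem_univ, if_true]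
      simp
      ring
    simp_rw [e1, h]
    unfold tauExt osc
    rw [← integral_const_mul]
    refine integral_congr_ae ?_
    filter_upwards [hN] with x hx
    rw [hβ _ (by rw [abs_div, abs_of_pos hN0, div_le_one hN0]; exact hx k)]
    have : (N : ℂ) ≠ 0 := by exact_mod_cast hN0.ne'
    push_cast
    field_simp
  have h1 : tauExt μ τ g (z + a) - tauExt μ τ g z = ∫ s in (0 : ℝ)..1,
      ∑ k, Complex.I * a k * tauExt μ τ (fun x => τ x k * g x) (z + s • a) := by
    rw [intervalIntegral.integral_eq_sub_of_hasDerivAt (fun s _ => hD s)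
      (hDc.intervalIntegrable _ _)]
    simp
  set Q : ι → ℝ → ℝ≥0∞ := fun k s => ∫⁻ t : ℝ, ‖𝓕 β t‖ₑ *
        ‖tauExt μ τ g (z + (s • a + Pi.single k (2 * Real.pi * t / N)))‖ₑ with hQ
  have hm : ∀ k, Measurable (Q k) := by
    intro k
    have hs : Continuous fun t : ℝ => (Pi.single k (2 * Real.pi * t / N) : ι → ℝ) :=
      (continuous_single k).comp (by fun_prop)
    have hc2 : Continuous fun p : ℝ × ℝ => z + (p.1 • a + Pi.single k (2 * Real.pi * p.2 / N)) :=
      continuous_const.add (Continuous.add (by fun_prop) (hs.comp continuous_snd))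
    have hf : Measurable fun p : ℝ × ℝ => ‖𝓕 β p.2‖ₑ *
        ‖tauExt μ τ g (z + (p.1 • a + Pi.single k (2 * Real.pi * p.2 / N)))‖ₑ :=
      ((𝓕 β).continuous.comp continuous_snd).measurable.enorm.mul
        ((continuous_tauExt hτ hg).comp hc2).measurable.enorm
    exact hf.lintegral_prod_right'
  have hpt : ∀ s k, ‖Complex.I * a k * tauExt μ τ (fun x => τ x k * g x) (z + s • a)‖ₑ
      ≤ ENNReal.ofReal (|a k| * N) * Q k s := by
    intro s k
    rw [hk, enorm_mul, enorm_mul, enorm_mul, ENNReal.ofReal_mul (abs_nonneg _)]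
    have e1 : ‖Complex.I‖ₑ * ‖(a k : ℂ)‖ₑ = ENNReal.ofReal |a k| := by
      rw [← enorm_mul, ← ofReal_norm, norm_mul]; simp
    have e2 : ‖(N : ℂ)‖ₑ = ENNReal.ofReal N := by
      rw [← ofReal_norm]; simp [abs_of_pos hN0]
    rw [e1, e2, mul_assoc]
    refine mul_le_mul' le_rfl (mul_le_mul' le_rfl ?_)
    refine (enorm_integral_le_lintegral_enorm _).trans_eq ?_
    rw [hQ]
    simp only [enorm_mul, add_assoc]
  calc ‖tauExt μ τ g (z + a) - tauExt μ τ g z‖ₑ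
      ≤ ∫⁻ s in Set.Icc (0 : ℝ) 1,
          ‖∑ k, Complex.I * a k * tauExt μ τ (fun x => τ x k * g x) (z + s • a)‖ₑ := by
        rw [h1, intervalIntegral.integral_of_le zero_le_one, ← integral_Icc_eq_integral_Ioc]
        exact enorm_integral_le_lintegral_enorm _
    _ ≤ ∫⁻ s in Set.Icc (0 : ℝ) 1, ∑ k, ENNReal.ofReal (|a k| * N) * Q k s :=
        lintegral_mono fun s =>
          (enorm_sum_le _ _).trans (Finset.sum_le_sum fun k _ => hpt s k)
    _ = _ := by
        rw [lintegral_finsetSum _ fun k _ => (hm k).const_mul _]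
        exact Finset.sum_congr rfl fun k _ => lintegral_const_mul _ (hm k)

end Bernstein

section Schwartz

open scoped FourierTransform SchwartzMap

variable {ι : Type*} [Fintype ι]

lemma growth_le_pow {a : ι → ℝ} {K r : ℝ} (hr : 0 ≤ r) (hK : 1 ≤ K) (ha : ∀ i, |a i| ≤ K * r) :
    growth a ≤ (2 * K ^ 2) ^ Fintype.card ι * (1 + r) ^ (2 * Fintype.card ι) := by
  unfold growth
  rw [pow_mul, ← mul_pow, ← Finset.card_univ, ← Finset.prod_const]
  refine Finset.prod_le_prod (fun i _ => by positivity) fun i _ => ?_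
  have h1 : a i ^ 2 ≤ (K * r) ^ 2 := by
    rw [← sq_abs]; exact pow_le_pow_left₀ (abs_nonneg _) (ha i) 2
  have h2 : 1 ≤ K ^ 2 := one_le_pow₀ hK
  nlinarith

lemma integrable_norm_mul_one_add_pow {E : Type*} [NormedAddCommGroup E] [NormedSpace ℝ E]
    [MeasurableSpace E] [BorelSpace E] [SecondCountableTopology E] {μ : Measure E}
    [μ.HasTemperateGrowth] (f : 𝓢(E, ℂ)) (k : ℕ) :
    Integrable (fun x => ‖f x‖ * (1 + ‖x‖) ^ k) μ := by
  have h0 := f.integrable_pow_mul μ 0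
  have h1 := f.integrable_pow_mul μ k
  refine ((h0.add h1).const_mul (2 ^ (k - 1))).mono' (Continuous.aestronglyMeasurable
    (by have := f.continuous; fun_prop)) (Filter.Eventually.of_forall fun x => ?_)
  rw [Real.norm_of_nonneg (by positivity)]
  have := add_pow_le zero_le_one (norm_nonneg x) k
  rw [one_pow] at this
  simp only [Pi.add_apply, pow_zero, one_mul]
  calc ‖f x‖ * (1 + ‖x‖) ^ k ≤ ‖f x‖ * (2 ^ (k - 1) * (1 + ‖x‖ ^ k)) := by gcongr
    _ = _ := by ring

variable [DecidableEq ι]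

lemma exists_wint_tauExt_sub_le (ι : Type*) [Fintype ι] (X : Type*) [MeasurableSpace X] :
    ∃ C > 0, ∀ (μ : Measure X) [SFinite μ]
      (τ : X → ι → ℝ) (g : X → ℂ) (N : ℝ), AEMeasurable τ μ → Integrable g μ → 1 ≤ N →
      (∀ᵐ x ∂μ, ∀ k, |τ x k| ≤ N) → ∀ a y : ι → ℝ,
      wint (fun z => ‖tauExt μ τ g (z + a) - tauExt μ τ g z‖ₑ * ‖tauExt μ τ g z‖ₑ) y
        ≤ ENNReal.ofReal (C * (N * (∑ k, |a k|) * growth a)) *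
          wint (fun z => ‖tauExt μ τ g z‖ₑ ^ 2) y := by
  classical
  obtain ⟨β, hβ⟩ := exists_schwartz_eq_id
  set G : ℝ → ℝ := fun t => growth (fun _ : ι => 2 * Real.pi * t) with hG
  have hG1 : ∀ t, 1 ≤ G t := fun t => one_le_growth _
  have hGc : Continuous G := continuous_growth.comp (by fun_prop)
  have hGi : Integrable fun t => ‖𝓕 β t‖ * G t := by
    refine ((integrable_norm_mul_one_add_pow (μ := volume) (𝓕 β) (2 * Fintype.card ι)).const_mul
      ((2 * (2 * Real.pi) ^ 2) ^ Fintype.card ι)).mono' (Continuous.aestronglyMeasurable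
      (by have := (𝓕 β).continuous; fun_prop)) (Filter.Eventually.of_forall fun t => ?_)
    rw [Real.norm_of_nonneg (mul_nonneg (norm_nonneg _) (zero_le_one.trans (hG1 t)))]
    have : G t ≤ _ := growth_le_pow (a := fun _ : ι => 2 * Real.pi * t) (r := |t|)
      (K := 2 * Real.pi) (abs_nonneg t)
      (by linarith [Real.pi_gt_three]) (fun i => by rw [abs_mul, abs_of_pos Real.two_pi_pos])
    calc _ ≤ ‖𝓕 β t‖ * ((2 * (2 * Real.pi) ^ 2) ^ Fintype.card ι *
          (1 + |t|) ^ (2 * Fintype.card ι)) := by gcongr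
      _ = _ := by rw [Real.norm_eq_abs]; ring
  set Cβ := ∫ t, ‖𝓕 β t‖ * G t with hCβ
  have hCβ0 : 0 ≤ Cβ := integral_nonneg fun t =>
    mul_nonneg (norm_nonneg _) (zero_le_one.trans (hG1 t))
  refine ⟨2 * Cβ + 1, by positivity, fun μ _ τ g N hτ hg hN1 hN a y => ?_⟩
  have hN0 : 0 < N := by linarith
  set w := tauExt μ τ g with hw
  have hwc : Continuous w := continuous_tauExt hτ hg
  set F := wint (fun z => ‖w z‖ₑ ^ 2) y with hF
  let b : ι → ℝ → ℝ → ι → ℝ := fun k s t => s • a + Pi.single k (2 * Real.pi * t / N)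
  have hbc : ∀ k, Continuous fun p : ℝ × ℝ => b k p.1 p.2 := fun k => by
    have hs : Continuous fun t : ℝ => (Pi.single k (2 * Real.pi * t / N) : ι → ℝ) :=
      (continuous_single k).comp (by fun_prop)
    exact Continuous.add (by fun_prop) (hs.comp continuous_snd)
  have hb : ∀ k, ∀ s ∈ Set.Icc (0 : ℝ) 1, ∀ t, growth (b k s t) ≤ growth a * G t := by
    intro k s hs t
    refine (growth_add_le _ _).trans ?_
    refine mul_le_mul (growth_mono fun i => ?_) (growth_mono fun i => ?_)
      (zero_le_one.trans (one_le_growth _)) (zero_le_one.trans (one_le_growth _))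
    · rw [Pi.smul_apply, smul_eq_mul, abs_mul, abs_of_nonneg hs.1]
      exact mul_le_of_le_one_left (abs_nonneg _) hs.2
    · by_cases h : i = k
      · subst h
        rw [Pi.single_eq_same, abs_div, abs_of_pos hN0]
        exact div_le_self (abs_nonneg _) hN1
      · rw [Pi.single_eq_of_ne h, abs_zero]; positivity
  let q : ι → (ι → ℝ) → ℝ → ℝ → ℝ≥0∞ := fun k z s t =>
    ‖𝓕 β t‖ₑ * (‖w (z + b k s t)‖ₑ * ‖w z‖ₑ * ENNReal.ofReal (ker (y - z)))
  have hqm : ∀ k, Measurable fun p : ((ι → ℝ) × ℝ) × ℝ => q k p.1.1 p.1.2 p.2 := by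
    intro k
    have h1 : Continuous fun p : ((ι → ℝ) × ℝ) × ℝ => w (p.1.1 + b k p.1.2 p.2) :=
      hwc.comp (Continuous.add (by fun_prop) ((hbc k).comp (by fun_prop :
        Continuous fun p : ((ι → ℝ) × ℝ) × ℝ => (p.1.2, p.2))))
    refine ((𝓕 β).continuous.comp continuous_snd).measurable.enorm.mul
      ((h1.measurable.enorm.mul (hwc.comp (by fun_prop)).measurable.enorm).mul ?_)
    exact (measurable_ker_sub y).comp (by fun_prop)
  have hq2 : ∀ k, Measurable fun p : (ι → ℝ) × ℝ => ∫⁻ t, q k p.1 p.2 t := fun k =>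
    (hqm k).lintegral_prod_right'
  have hqk : ∀ k, ∫⁻ z, ∫⁻ s in Set.Icc (0 : ℝ) 1, ∫⁻ t, q k z s t
      ≤ ENNReal.ofReal (2 * Cβ * growth a) * F := by
    intro k
    rw [lintegral_lintegral_swap (hq2 k).aemeasurable]
    have hin : ∀ s ∈ Set.Icc (0 : ℝ) 1, ∫⁻ z, ∫⁻ t, q k z s t
        ≤ ENNReal.ofReal (2 * Cβ * growth a) * F := by
      intro s hs
      have hms : Measurable fun p : (ι → ℝ) × ℝ => q k p.1 s p.2 :=
        (hqm k).comp (g := fun p : ((ι → ℝ) × ℝ) × ℝ => q k p.1.1 p.1.2 p.2)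
          (f := fun p : (ι → ℝ) × ℝ => ((p.1, s), p.2)) (by fun_prop)
      rw [lintegral_lintegral_swap hms.aemeasurable]
      calc ∫⁻ t, ∫⁻ z, q k z s t
          ≤ ∫⁻ t, ENNReal.ofReal (‖𝓕 β t‖ * G t) * (ENNReal.ofReal (2 * growth a) * F) := by
            refine lintegral_mono fun t => ?_
            simp only [q]
            rw [lintegral_const_mul' _ _ enorm_ne_top, ENNReal.ofReal_mul (norm_nonneg _),
              ofReal_norm, mul_assoc]
            refine mul_le_mul' le_rfl ((wint_shift_mul_le hwc (b k s t) y).trans ?_)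
            rw [← mul_assoc, ← ENNReal.ofReal_mul (zero_le_one.trans (hG1 t))]
            refine mul_le_mul' (ENNReal.ofReal_le_ofReal ?_) le_rfl
            linarith [hb k s hs t, mul_comm (growth a) (G t)]
        _ = _ := by
            rw [lintegral_mul_const _ (by
              have := (𝓕 β).continuous
              exact ENNReal.measurable_ofReal.comp (by fun_prop)),
              ← ofReal_integral_eq_lintegral_ofReal hGi (Filter.Eventually.of_forall fun t =>
                mul_nonneg (norm_nonneg _) (zero_le_one.trans (hG1 t))), ← mul_assoc,
              ← ENNReal.ofReal_mul hCβ0]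
            congr 2; ring
    calc _ ≤ ∫⁻ s in Set.Icc (0 : ℝ) 1, ENNReal.ofReal (2 * Cβ * growth a) * F :=
          setLIntegral_mono' measurableSet_Icc hin
      _ = _ := by simp
  have hga := zero_le_one.trans (one_le_growth a)
  calc wint (fun z => ‖w (z + a) - w z‖ₑ * ‖w z‖ₑ) y
      ≤ ∫⁻ z, ∑ k, ENNReal.ofReal (|a k| * N) * ∫⁻ s in Set.Icc (0 : ℝ) 1, ∫⁻ t, q k z s t := by
        refine lintegral_mono fun z => ?_
        simp only [q]
        have h1 : ‖w (z + a) - w z‖ₑ ≤ _ := enorm_tauExt_add_sub_le β hβ hτ hg hN0 hN z a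
        rw [mul_assoc]
        refine (mul_le_mul' h1 le_rfl).trans ?_
        rw [Finset.sum_mul]
        refine Finset.sum_le_sum fun k _ => ?_
        rw [mul_assoc, ← lintegral_mul_const' _ _
          (ENNReal.mul_ne_top enorm_ne_top ENNReal.ofReal_ne_top)]
        refine mul_le_mul' le_rfl (lintegral_mono fun s => ?_)
        rw [← lintegral_mul_const' _ _
          (ENNReal.mul_ne_top enorm_ne_top ENNReal.ofReal_ne_top)]
        refine (lintegral_mono fun t => ?_)
        exact le_of_eq (by ring)
    _ = ∑ k, ENNReal.ofReal (|a k| * N) * ∫⁻ z, ∫⁻ s in Set.Icc (0 : ℝ) 1, ∫⁻ t, q k z s t := by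
        rw [lintegral_finsetSum _ fun k _ => ((hq2 k).lintegral_prod_right').const_mul _]
        exact Finset.sum_congr rfl fun k _ =>
          lintegral_const_mul _ ((hq2 k).lintegral_prod_right')
    _ ≤ ∑ k, ENNReal.ofReal (|a k| * N) * (ENNReal.ofReal (2 * Cβ * growth a) * F) :=
        Finset.sum_le_sum fun k _ => mul_le_mul' le_rfl (hqk k)
    _ ≤ _ := by
        rw [← Finset.sum_mul, ← mul_assoc, ← ENNReal.ofReal_sum_of_nonneg fun k _ => by positivity,
          ← ENNReal.ofReal_mul (Finset.sum_nonneg fun k _ => by positivity), ← Finset.sum_mul]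
        refine mul_le_mul' (ENNReal.ofReal_le_ofReal ?_) le_rfl
        have : 0 ≤ N * (∑ k, |a k|) * growth a := by positivity
        linarith [show (∑ i, |a i|) * N * (2 * Cβ * growth a)
          = 2 * Cβ * (N * (∑ k, |a k|) * growth a) by ring]

end Schwartz

section FirstVariation

open scoped ComplexConjugate

variable {ι : Type*} [Fintype ι]

lemma integrable_mul_ker {f : (ι → ℝ) → ℂ} (hf : Continuous f) {B : ℝ} (hB : ∀ z, ‖f z‖ ≤ B)
    (y : ι → ℝ) : Integrable fun z => f z * (ker (y - z) : ℂ) :=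
  (integrable_ker.comp_sub_left y).ofReal.bdd_mul (c := B) hf.aestronglyMeasurable
    (Filter.Eventually.of_forall hB)

lemma integral_mul_integral_ker_eq_zero {Ω : Type*} [TopologicalSpace Ω] [MeasurableSpace Ω]
    [OpensMeasurableSpace Ω] [SecondCountableTopology Ω] {P : Measure Ω} [SFinite P]
    {m : Ω → ℂ} (hm : Integrable m P) {Φ : Ω → (ι → ℝ) → ℂ}
    (hΦ : Continuous fun p : Ω × (ι → ℝ) => Φ p.1 p.2) {B : ℝ} (hB : ∀ η z, ‖Φ η z‖ ≤ B)
    (h0 : ∀ z, ∫ η, m η * Φ η z ∂P = 0) (y : ι → ℝ) :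
    Integrable (fun η => m η * ∫ z, Φ η z * (ker (y - z) : ℂ)) P ∧
      ∫ η, (m η * ∫ z, Φ η z * (ker (y - z) : ℂ)) ∂P = 0 := by
  have hint : Integrable (fun p : Ω × (ι → ℝ) => m p.1 * (Φ p.1 p.2 * (ker (y - p.2) : ℂ)))
      (P.prod volume) := by
    have h1 : Integrable (fun p : Ω × (ι → ℝ) => m p.1 * (ker (y - p.2) : ℂ)) (P.prod volume) :=
      hm.mul_prod (integrable_ker.comp_sub_left y).ofReal
    refine (h1.bdd_mul (c := B) hΦ.aestronglyMeasurable
      (Filter.Eventually.of_forall fun p => hB _ _)).congr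
      (Filter.Eventually.of_forall fun p => ?_)
    simp only
    ring
  simp_rw [← integral_const_mul]
  refine ⟨hint.integral_prod_left, ?_⟩
  rw [integral_integral_swap hint]
  simp_rw [← mul_assoc, integral_mul_const, h0, zero_mul]
  simp

lemma norm_sum_integral_mul_le {Ω : Type*} [TopologicalSpace Ω] [MeasurableSpace Ω]
    [OpensMeasurableSpace Ω] [SecondCountableTopology Ω] {μ : Measure Ω} [SFinite μ]
    {m c : Ω → ℂ} {a : Ω → ι → ℝ} {P : Ω → ℝ} (hm : Integrable m μ) (ha : Continuous a)
    {v : (ι → ℝ) → ℂ} (hv : Continuous v) {B : ℝ} (hB : ∀ z, ‖v z‖ ≤ B)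
    (h1 : ∀ z, ∫ η, m η * v (z + a η) ∂μ = 0)
    (h2 : ∀ z, ∫ η, m η * conj (v (z - a η)) ∂μ = 0)
    (hP : ∀ η, 0 ≤ P η)
    (h3 : ∀ η y, wint (fun z => ‖v (z + a η) - c η * v z‖ₑ * ‖v z‖ₑ) y
      ≤ ENNReal.ofReal (P η) * wint (fun z => ‖v z‖ₑ ^ 2) y)
    (hmc : ∀ i, Integrable (fun η => m η * c η * (a η i : ℂ)) μ)
    (hW : Integrable (fun η => ‖m η‖ * ((∑ i, |a η i|) * P η +
      6 * (∑ i, |a η i|) ^ 2 * growth (a η) ^ 2)) μ) (y : ι → ℝ) :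
    ‖∑ i, (∫ η, m η * c η * (a η i : ℂ) ∂μ) *
        ((∫ z, ‖v z‖ ^ 2 * (cauchyLogDeriv ((y - z) i) * ker (y - z)) : ℝ) : ℂ)‖
      ≤ (∫ η, ‖m η‖ * ((∑ i, |a η i|) * P η +
          6 * (∑ i, |a η i|) ^ 2 * growth (a η) ^ 2) ∂μ) *
        ∫ z, ‖v z‖ ^ 2 * ker (y - z) := by
  have hB0 : 0 ≤ B := (norm_nonneg _).trans (hB 0)
  have hkc : ∀ x : ι → ℝ, Continuous fun z => ker (x - z) := fun x =>
    continuous_ker.comp (by fun_prop)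
  set Fr : ℝ := ∫ z, ‖v z‖ ^ 2 * ker (y - z) with hFr
  have hFi : Integrable fun z => ‖v z‖ ^ 2 * ker (y - z) :=
    (integrable_ker.comp_sub_left y).bdd_mul (c := B ^ 2) (by fun_prop)
      (Filter.Eventually.of_forall fun z => by
        rw [Real.norm_of_nonneg (by positivity)]
        exact pow_le_pow_left₀ (norm_nonneg _) (hB z) 2)
  have hFr0 : 0 ≤ Fr := integral_nonneg fun z => mul_nonneg (by positivity) (ker_pos _).le
  have hFe : wint (fun z => ‖v z‖ₑ ^ 2) y = ENNReal.ofReal Fr := by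
    rw [hFr, ofReal_integral_eq_lintegral_ofReal hFi
      (Filter.Eventually.of_forall fun z => mul_nonneg (by positivity) (ker_pos _).le)]
    refine lintegral_congr fun z => ?_
    rw [ENNReal.ofReal_mul (by positivity), ENNReal.ofReal_pow (norm_nonneg _), ofReal_norm]
  -- the two bilinear forms
  obtain ⟨hi1, hz1⟩ := integral_mul_integral_ker_eq_zero hm
    (Φ := fun η z => v (z + a η) * conj (v z)) (B := B * B) (by fun_prop)
    (fun η z => by
      rw [norm_mul, RCLike.norm_conj]
      exact mul_le_mul (hB _) (hB _) (norm_nonneg _) hB0)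
    (fun z => by simp_rw [← mul_assoc, integral_mul_const, h1, zero_mul]) y
  obtain ⟨hi2, hz2⟩ := integral_mul_integral_ker_eq_zero hm
    (Φ := fun η z => conj (v (z - a η)) * v z) (B := B * B) (by fun_prop)
    (fun η z => by
      rw [norm_mul, RCLike.norm_conj]
      exact mul_le_mul (hB _) (hB _) (norm_nonneg _) hB0)
    (fun z => by simp_rw [← mul_assoc, integral_mul_const, h2, zero_mul]) y
  set I : ι → ℝ := fun i => ∫ z, ‖v z‖ ^ 2 * (cauchyLogDeriv ((y - z) i) * ker (y - z)) with hI
  have hIi : ∀ i, Integrable fun z => ‖v z‖ ^ 2 * (cauchyLogDeriv ((y - z) i) * ker (y - z)) := by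
    intro i
    have hc : Continuous fun z : ι → ℝ => cauchyLogDeriv ((y - z) i) :=
      continuous_cauchyLogDeriv.comp (by fun_prop)
    refine (hFi.bdd_mul (c := 1) hc.aestronglyMeasurable (Filter.Eventually.of_forall fun z =>
      abs_cauchyLogDeriv_le _)).congr (Filter.Eventually.of_forall fun z => ?_)
    simp only
    ring
  set D1 : Ω → ℂ := fun η => ∫ z, v (z + a η) * conj (v z) * (ker (y - z) : ℂ) with hD1
  set D2 : Ω → ℂ := fun η => ∫ z, conj (v (z - a η)) * v z * (ker (y - z) : ℂ) with hD2
  have hpt : ∀ η, ‖D1 η - D2 η - c η * ∑ i, (a η i : ℂ) * (I i : ℂ)‖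
      ≤ ((∑ i, |a η i|) * P η + 6 * (∑ i, |a η i|) ^ 2 * growth (a η) ^ 2) * Fr := by
    intro η
    set A := ∑ i, |a η i| with hA
    have hA0 : 0 ≤ A := Finset.sum_nonneg fun i _ => abs_nonneg _
    have hg0 : 0 ≤ growth (a η) := zero_le_one.trans (one_le_growth _)
    have hD2' : D2 η = ∫ z, v (z + a η) * conj (v z) * (ker (y - a η - z) : ℂ) := by
      rw [hD2]
      simp only
      rw [← integral_add_right_eq_self
        (fun z => conj (v (z - a η)) * v z * (ker (y - z) : ℂ)) (a η)]
      refine integral_congr_ae (Filter.Eventually.of_forall fun z => ?_)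
      simp only [add_sub_cancel_right]
      rw [show y - (z + a η) = y - a η - z by abel]
      ring
    have hb : ∀ z, ‖v (z + a η) * conj (v z)‖ ≤ B * B := fun z => by
      rw [norm_mul, RCLike.norm_conj]
      exact mul_le_mul (hB _) (hB _) (norm_nonneg _) hB0
    have hS : (∑ i, (a η i : ℂ) * (I i : ℂ)) = ∫ z, ((‖v z‖ ^ 2 *
        ((∑ i, a η i * cauchyLogDeriv ((y - z) i)) * ker (y - z)) : ℝ) : ℂ) := by
      rw [integral_complex_ofReal]
      simp_rw [hI, Finset.sum_mul, Finset.mul_sum]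
      rw [integral_finsetSum]
      · rw [Complex.ofReal_sum]
        refine Finset.sum_congr rfl fun i _ => ?_
        rw [← Complex.ofReal_mul, ← integral_const_mul]
        congr 2
        ext z; ring
      · intro i _
        refine ((hIi i).const_mul (a η i)).congr (Filter.Eventually.of_forall fun z => ?_)
        simp only
        ring
    have hSi : Integrable fun z => ((‖v z‖ ^ 2 *
        ((∑ i, a η i * cauchyLogDeriv ((y - z) i)) * ker (y - z)) : ℝ) : ℂ) := by
      have e : (fun z => ‖v z‖ ^ 2 * ((∑ i, a η i * cauchyLogDeriv ((y - z) i)) * ker (y - z)))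
          = fun z => ∑ i, ‖v z‖ ^ 2 * (a η i * cauchyLogDeriv ((y - z) i) * ker (y - z)) := by
        ext z; rw [Finset.sum_mul, Finset.mul_sum]
      have h0 : Integrable fun z => ‖v z‖ ^ 2 *
          ((∑ i, a η i * cauchyLogDeriv ((y - z) i)) * ker (y - z)) := by
        rw [e]
        refine integrable_finsetSum _ fun i _ =>
          ((hIi i).const_mul (a η i)).congr (Filter.Eventually.of_forall fun z => ?_)
        simp only
        ring
      exact h0.ofReal
    have hcv : Continuous fun z => v (z + a η) * conj (v z) := by fun_prop
    rw [hD2', hD1, hS, ← integral_const_mul,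
      ← integral_sub (integrable_mul_ker hcv hb y) (integrable_mul_ker hcv hb _),
      ← integral_sub ((integrable_mul_ker hcv hb y).sub' (integrable_mul_ker hcv hb _))
        (hSi.const_mul _)]
    have hfin : ∫⁻ z, ‖v (z + a η) * conj (v z) * (ker (y - z) : ℂ) -
        v (z + a η) * conj (v z) * (ker (y - a η - z) : ℂ) - c η * ((‖v z‖ ^ 2 *
        ((∑ i, a η i * cauchyLogDeriv ((y - z) i)) * ker (y - z)) : ℝ) : ℂ)‖ₑ
        ≤ ENNReal.ofReal ((A * P η + 6 * A ^ 2 * growth (a η) ^ 2) * Fr) := by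
      have hpz : ∀ z, ‖v (z + a η) * conj (v z) * (ker (y - z) : ℂ) -
        v (z + a η) * conj (v z) * (ker (y - a η - z) : ℂ) - c η * ((‖v z‖ ^ 2 *
        ((∑ i, a η i * cauchyLogDeriv ((y - z) i)) * ker (y - z)) : ℝ) : ℂ)‖ₑ
          ≤ ENNReal.ofReal A *
              (‖v (z + a η) - c η * v z‖ₑ * ‖v z‖ₑ * ENNReal.ofReal (ker (y - z))) +
            ENNReal.ofReal (3 * A ^ 2 * growth (a η)) *
              (‖v (z + a η)‖ₑ * ‖v z‖ₑ * ENNReal.ofReal (ker (y - z))) := by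
        intro z
        set L := ∑ i, a η i * cauchyLogDeriv ((y - z) i) with hL
        have hT := abs_ker_taylor_le (y - z) (-a η)
        simp only [Pi.neg_apply, neg_mul, Finset.sum_neg_distrib, abs_neg, growth_neg] at hT
        rw [← hL, ← hA, show y - z + -a η = y - a η - z by abel] at hT
        have hLA : |L| ≤ A := abs_sum_logDeriv_le (y - z) (a η)
        have hk := (ker_pos (y - z)).le
        have e : v (z + a η) * conj (v z) * (ker (y - z) : ℂ) -
            v (z + a η) * conj (v z) * (ker (y - a η - z) : ℂ) -
            c η * ((‖v z‖ ^ 2 * (L * ker (y - z)) : ℝ) : ℂ)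
            = (v (z + a η) - c η * v z) * conj (v z) * ((L * ker (y - z) : ℝ) : ℂ) -
              v (z + a η) * conj (v z) *
                ((ker (y - a η - z) - ker (y - z) - -L * ker (y - z) : ℝ) : ℂ) := by
          have := Complex.mul_conj' (v z)
          push_cast
          rw [← this]
          ring
        rw [e]
        have hn : ‖(v (z + a η) - c η * v z) * conj (v z) * ((L * ker (y - z) : ℝ) : ℂ) -
              v (z + a η) * conj (v z) *
                ((ker (y - a η - z) - ker (y - z) - -L * ker (y - z) : ℝ) : ℂ)‖
            ≤ A * (‖v (z + a η) - c η * v z‖ * ‖v z‖ * ker (y - z)) +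
              3 * A ^ 2 * growth (a η) * (‖v (z + a η)‖ * ‖v z‖ * ker (y - z)) := by
          refine (norm_sub_le _ _).trans (add_le_add ?_ ?_)
          · rw [norm_mul, norm_mul, RCLike.norm_conj, Complex.norm_real, Real.norm_eq_abs, abs_mul,
              abs_of_nonneg hk]
            calc _ ≤ ‖v (z + a η) - c η * v z‖ * ‖v z‖ * (A * ker (y - z)) := by gcongr
              _ = _ := by ring
          · rw [norm_mul, norm_mul, RCLike.norm_conj, Complex.norm_real, Real.norm_eq_abs]
            calc _ ≤ ‖v (z + a η)‖ * ‖v z‖ * (3 * A ^ 2 * growth (a η) * ker (y - z)) := by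
                  gcongr
                  simpa using hT
              _ = _ := by ring
        rw [← ofReal_norm]
        refine (ENNReal.ofReal_le_ofReal hn).trans_eq ?_
        rw [ENNReal.ofReal_add (by positivity) (by positivity), ENNReal.ofReal_mul hA0,
          ENNReal.ofReal_mul (p := 3 * A ^ 2 * growth (a η)) (by positivity),
          ENNReal.ofReal_mul (p := ‖v (z + a η) - c η * v z‖ * ‖v z‖) (by positivity),
          ENNReal.ofReal_mul (p := ‖v (z + a η)‖ * ‖v z‖) (by positivity),
          ENNReal.ofReal_mul (norm_nonneg _), ENNReal.ofReal_mul (norm_nonneg _)]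
        simp only [ofReal_norm]
      have hm2 : Measurable fun z =>
          ‖v (z + a η)‖ₑ * ‖v z‖ₑ * ENNReal.ofReal (ker (y - z)) :=
        ((hv.comp (by fun_prop)).measurable.enorm.mul hv.measurable.enorm).mul
          (measurable_ker_sub y)
      refine (lintegral_mono hpz).trans ?_
      rw [lintegral_add_right _ (hm2.const_mul _), lintegral_const_mul' _ _ ENNReal.ofReal_ne_top,
        lintegral_const_mul' _ _ ENNReal.ofReal_ne_top]
      refine (add_le_add (mul_le_mul' le_rfl (h3 η y))
        (mul_le_mul' le_rfl (wint_shift_mul_le hv (a η) y))).trans_eq ?_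
      rw [hFe, ← ENNReal.ofReal_mul (hP η), ← ENNReal.ofReal_mul hA0,
        ← ENNReal.ofReal_mul (by positivity), ← ENNReal.ofReal_mul (by positivity),
        ← ENNReal.ofReal_add (mul_nonneg hA0 (mul_nonneg (hP η) hFr0)) (by positivity)]
      congr 1
      ring
    have hPη := hP η
    have := (enorm_integral_le_lintegral_enorm _).trans hfin
    rw [← ofReal_norm, ENNReal.ofReal_le_ofReal_iff (by positivity)] at this
    exact this
  have hkey : ∑ i, (∫ η, m η * c η * (a η i : ℂ) ∂μ) * (I i : ℂ)
      = -∫ η, m η * (D1 η - D2 η - c η * ∑ i, (a η i : ℂ) * (I i : ℂ)) ∂μ := by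
    have hsi : Integrable (fun η => m η * (c η * ∑ i, (a η i : ℂ) * (I i : ℂ))) μ := by
      simp_rw [Finset.mul_sum]
      refine integrable_finsetSum _ fun i _ =>
        ((hmc i).mul_const (I i : ℂ)).congr (Filter.Eventually.of_forall fun η => ?_)
      simp only
      ring
    simp_rw [mul_sub]
    rw [integral_sub (hi1.sub' hi2) hsi, integral_sub hi1 hi2, hz1, hz2, sub_zero, zero_sub,
      neg_neg]
    simp_rw [← integral_mul_const, Finset.mul_sum]
    rw [integral_finsetSum]
    · refine Finset.sum_congr rfl fun i _ => integral_congr_ae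
        (Filter.Eventually.of_forall fun η => ?_)
      simp only
      ring
    · intro i _
      refine ((hmc i).mul_const (I i : ℂ)).congr (Filter.Eventually.of_forall fun η => ?_)
      simp only
      ring
  rw [hkey, norm_neg, ← integral_mul_const]
  refine norm_integral_le_of_norm_le (hW.mul_const Fr) (Filter.Eventually.of_forall fun η => ?_)
  rw [norm_mul, mul_assoc]
  exact mul_le_mul_of_nonneg_left (hpt η) (norm_nonneg _)

end FirstVariation

section DirectionalBound

variable {ι : Type*} [Fintype ι]

lemma le_exp_mul_of_abs_deriv_le {f f' : ℝ → ℝ} {D : ℝ} (hf : ∀ t, HasDerivAt f (f' t) t)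
    (hD : ∀ t, |f' t| ≤ D * f t) (t : ℝ) : f t ≤ Real.exp (D * |t|) * f 0 := by
  have key : ∀ (h h' : ℝ → ℝ), (∀ t, HasDerivAt h (h' t) t) → (∀ t, |h' t| ≤ D * h t) →
      ∀ t, 0 ≤ t → h t ≤ Real.exp (D * t) * h 0 := by
    intro h h' hh hD' t ht
    have hd : ∀ t, HasDerivAt (fun t => Real.exp (-D * t) * h t)
        (Real.exp (-D * t) * -D * h t + Real.exp (-D * t) * h' t) t := by
      intro t
      have h1 : HasDerivAt (fun t : ℝ => Real.exp (-D * t)) (Real.exp (-D * t) * -D) t := by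
        have := ((hasDerivAt_id t).const_mul (-D)).exp
        simpa using this
      exact h1.mul (hh t)
    have hanti : Antitone fun t => Real.exp (-D * t) * h t := by
      refine antitone_of_deriv_nonpos (fun t => (hd t).differentiableAt) fun t => ?_
      rw [(hd t).deriv]
      have h1 := (abs_le.mp (hD' t)).2
      have h2 := Real.exp_pos (-D * t)
      nlinarith
    have h1 := hanti ht
    simp only [mul_zero, Real.exp_zero, one_mul] at h1
    calc h t = Real.exp (D * t) * (Real.exp (-D * t) * h t) := by
          rw [← mul_assoc, ← Real.exp_add]; simp
      _ ≤ _ := mul_le_mul_of_nonneg_left h1 (Real.exp_pos _).le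
  rcases le_total 0 t with ht | ht
  · rw [abs_of_nonneg ht]
    exact key f f' hf hD t ht
  · have := key (fun s => f (-s)) (fun s => -f' (-s))
      (fun s => by
        have h1 := HasDerivAt.scomp s (hf (-s)) (hasDerivAt_neg s)
        simpa [Function.comp_def] using h1)
      (fun s => by simpa using hD (-s)) (-t) (by linarith)
    rw [abs_of_nonpos ht]
    simpa using this

variable [DecidableEq ι]

lemma integral_mul_ker_update_le {v : (ι → ℝ) → ℂ} (hv : Continuous v) {B : ℝ}
    (hB : ∀ z, ‖v z‖ ≤ B) {j : ι} {D : ℝ}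
    (hD : ∀ y : ι → ℝ, |∫ z, ‖v z‖ ^ 2 * (cauchyLogDeriv ((y - z) j) * ker (y - z))|
      ≤ D * ∫ z, ‖v z‖ ^ 2 * ker (y - z)) (y : ι → ℝ) (t : ℝ) :
    ∫ z, ‖v z‖ ^ 2 * ker (Function.update y j t - z)
      ≤ Real.exp (D * |t - y j|) * ∫ z, ‖v z‖ ^ 2 * ker (y - z) := by
  set e : ι → ℝ := Pi.single j 1 with he
  have hup : ∀ s : ℝ, Function.update y j (y j + s) = y + s • e := by
    intro s
    ext i
    by_cases h : i = j
    · subst h; simp [he]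
    · simp [he, h]
  have hkc : ∀ x : ι → ℝ, Continuous fun z => ker (x - z) := fun x =>
    continuous_ker.comp (by fun_prop)
  have hint : ∀ x : ι → ℝ, Integrable fun z => ‖v z‖ ^ 2 * ker (x - z) := fun x =>
    (integrable_ker.comp_sub_left x).bdd_mul (c := B ^ 2) (by fun_prop)
      (Filter.Eventually.of_forall fun z => by
        rw [Real.norm_of_nonneg (by positivity)]
        exact pow_le_pow_left₀ (norm_nonneg _) (hB z) 2)
  have hd : ∀ s : ℝ, HasDerivAt (fun s : ℝ => ∫ z, ‖v z‖ ^ 2 * ker (y + s • e - z))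
      (∫ z, ‖v z‖ ^ 2 * (cauchyLogDeriv ((y + s • e - z) j) * ker (y + s • e - z))) s := by
    intro s₀
    have hpt : ∀ z (s : ℝ), HasDerivAt (fun s : ℝ => ‖v z‖ ^ 2 * ker (y + s • e - z))
        (‖v z‖ ^ 2 * (cauchyLogDeriv ((y + s • e - z) j) * ker (y + s • e - z))) s := by
      intro z s
      have h1 := (hasDerivAt_ker_line (y - z) e s).const_mul (‖v z‖ ^ 2)
      have h2 : ∀ s : ℝ, y - z + s • e = y + s • e - z := fun s => by abel
      simp_rw [h2] at h1
      refine h1.congr_deriv ?_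
      rw [Finset.sum_eq_single j]
      · simp [he]
      · intro i _ hi; simp [he, hi]
      · simp
    refine (hasDerivAt_integral_of_dominated_loc_of_deriv_le (ball_mem_nhds s₀ one_pos)
      (F := fun s z => ‖v z‖ ^ 2 * ker (y + s • e - z))
      (F' := fun s z => ‖v z‖ ^ 2 * (cauchyLogDeriv ((y + s • e - z) j) * ker (y + s • e - z)))
      (bound := fun z => ‖v z‖ ^ 2 * (growth e * ker (y + s₀ • e - z)))
      (Filter.Eventually.of_forall fun s => (hint _).aestronglyMeasurable) (hint _) ?_ ?_ ?_ ?_).2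
    · have hc : Continuous fun z : ι → ℝ => cauchyLogDeriv ((y + s₀ • e - z) j) :=
        continuous_cauchyLogDeriv.comp (by fun_prop)
      have hk := hkc (y + s₀ • e)
      exact (Continuous.mul (by fun_prop) (hc.mul hk)).aestronglyMeasurable
    · refine Filter.Eventually.of_forall fun z s hs => ?_
      rw [Real.norm_eq_abs, abs_mul, abs_mul, abs_of_nonneg (by positivity : 0 ≤ ‖v z‖ ^ 2),
        abs_of_nonneg (ker_pos _).le]
      refine mul_le_mul_of_nonneg_left ?_ (by positivity)
      refine (mul_le_of_le_one_left (ker_pos _).le (abs_cauchyLogDeriv_le _)).trans ?_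
      have h1 := ker_add_le (y + s₀ • e - z) ((s - s₀) • e)
      rw [show y + s₀ • e - z + (s - s₀) • e = y + s • e - z by rw [sub_smul]; abel] at h1
      refine h1.trans (mul_le_mul_of_nonneg_right (growth_mono fun i => ?_) (ker_pos _).le)
      have hs' : |s - s₀| < 1 := by simpa [Real.dist_eq] using hs
      simp only [Pi.smul_apply, smul_eq_mul, abs_mul]
      exact mul_le_of_le_one_left (abs_nonneg _) hs'.le
    · exact (((hint (y + s₀ • e)).const_mul (growth e)).congr
        (Filter.Eventually.of_forall fun z => by simp only; ring))
    · exact Filter.Eventually.of_forall fun z s _ => hpt z s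
  have := le_exp_mul_of_abs_deriv_le hd (fun s => hD _) (t - y j)
  rw [← hup, ← hup] at this
  simpa using this

end DirectionalBound

section DirectionalVariation

open scoped FourierTransform SchwartzMap ComplexConjugate

variable {ι : Type*} [Fintype ι] {X : Type*} [MeasurableSpace X] {μ : Measure X}

lemma norm_tauExt_le (τ : X → ι → ℝ) (g : X → ℂ) (z : ι → ℝ) :
    ‖tauExt μ τ g z‖ ≤ ∫ x, ‖g x‖ ∂μ := norm_osc_le _ _

lemma tauExt_smul (T : ℝ) (τ : X → ι → ℝ) (g : X → ℂ) (z : ι → ℝ) :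
    tauExt μ τ g (T • z) = tauExt μ (fun x i => T * τ x i) g z := by
  unfold tauExt
  congr 1
  ext x
  exact Finset.sum_congr rfl fun i _ => by simp; ring

lemma tauExt_sub_const (τ : X → ι → ℝ) (p : ι → ℝ) (g : X → ℂ) (z : ι → ℝ) :
    tauExt μ τ g z = Complex.exp (Complex.I * ((∑ i, z i * p i : ℝ) : ℂ)) *
      tauExt μ (fun x i => τ x i - p i) g z := by
  unfold tauExt osc
  rw [← integral_const_mul]
  congr 1
  ext x
  rw [← mul_assoc, ← Complex.exp_add, ← mul_add, ← Complex.ofReal_add, ← Finset.sum_add_distrib]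
  congr 4
  exact Finset.sum_congr rfl fun i _ => by ring

lemma conj_osc (θ : X → ℝ) (g : X → ℂ) :
    conj (osc μ θ g) = osc μ (fun x => -θ x) (fun x => conj (g x)) := by
  unfold osc
  rw [← integral_conj]
  congr 1
  ext x
  rw [map_mul, ← Complex.exp_conj, map_mul, Complex.conj_I, Complex.conj_ofReal]
  simp

lemma avg_enorm_sq_eq {v : (ι → ℝ) → ℂ} (hv : Continuous v) {B : ℝ} (hB : ∀ z, ‖v z‖ ≤ B)
    {u : (ι → ℝ) → ℂ} {T : ℝ} (hT : 0 < T) (huv : ∀ z, u (T • z) = v z) (hu : Measurable u)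
    (y : ι → ℝ) :
    avg T (fun y => ‖u y‖ₑ ^ 2) y = ENNReal.ofReal (∫ z, ‖v z‖ ^ 2 * ker (T⁻¹ • y - z)) := by
  unfold avg
  have hmeas : Measurable fun b => ‖u (y - T • b)‖ₑ ^ 2 :=
    (hu.comp (g := u) (f := fun b => y - T • b) (by fun_prop)).enorm.pow_const 2
  rw [lintegral_kerMeas hmeas,
    ← lintegral_sub_left_eq_self _ (T⁻¹ • y)]
  have hc : Continuous fun z => ker (T⁻¹ • y - z) := continuous_ker.comp (by fun_prop)
  have hFi : Integrable fun z => ‖v z‖ ^ 2 * ker (T⁻¹ • y - z) :=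
    (integrable_ker.comp_sub_left _).bdd_mul (c := B ^ 2) (by fun_prop)
      (Filter.Eventually.of_forall fun z => by
        rw [Real.norm_of_nonneg (by positivity)]
        exact pow_le_pow_left₀ (norm_nonneg _) (hB z) 2)
  rw [ofReal_integral_eq_lintegral_ofReal hFi
      (Filter.Eventually.of_forall fun z => mul_nonneg (by positivity) (ker_pos _).le)]
  refine lintegral_congr fun z => ?_
  rw [ENNReal.ofReal_mul (by positivity), ENNReal.ofReal_pow (norm_nonneg _), ofReal_norm, ← huv]
  congr 4
  rw [smul_sub, smul_inv_smul₀ hT.ne', sub_sub_cancel]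

variable {E : Type*} [NormedAddCommGroup E] [InnerProductSpace ℝ E] [FiniteDimensional ℝ E]
  [MeasurableSpace E] [BorelSpace E]

lemma sum_inner_phase {b w : ι → E} (hbw : ∀ η, ∑ i, ⟪w i, η⟫_ℝ • b i = η) {σ T : ℝ}
    (hσT : σ * T = 1) (η p : E) (z : ι → ℝ) :
    ∑ i, (z + fun i => 2 * Real.pi * σ * ⟪w i, η⟫_ℝ) i * (T * ⟪b i, p⟫_ℝ)
      = ∑ i, z i * (T * ⟪b i, p⟫_ℝ) + 2 * Real.pi * ⟪η, p⟫_ℝ := by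
  conv_rhs => rw [← hbw η]
  rw [sum_inner, Finset.mul_sum, ← Finset.sum_add_distrib]
  refine Finset.sum_congr rfl fun i _ => ?_
  simp only [Pi.add_apply, real_inner_smul_left]
  linear_combination (2 * Real.pi * ⟪w i, η⟫_ℝ * ⟪b i, p⟫_ℝ) * hσT

variable [DecidableEq ι]

set_option maxHeartbeats 1000000 in
/-- If the frequencies `φ x` lie on the zero set of `ρ` and within `ε` of `p`, where the gradient
of `ρ` is along the `j`-th direction, then averages of the extension operator at scale `T ≥ 1 / ε`
vary slowly in the `j`-th coordinate. -/
lemma exists_avg_tauExt_update_le (ι : Type*) [Fintype ι] [DecidableEq ι] (X : Type*)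
    [MeasurableSpace X] (ρ : 𝓢(E, ℂ)) (K : ℝ) :
    ∃ C > 0, ∀ (μ : Measure X) [SFinite μ] (b w : ι → E) (j : ι) (p : E) (φ : X → E) (g : X → ℂ)
      (ε T : ℝ), (∀ i, ‖b i‖ ≤ 1) → (∀ i, ‖w i‖ ≤ K) → (∀ η, ∑ i, ⟪w i, η⟫_ℝ • b i = η) →
      (∀ i, i ≠ j → fderiv ℝ ρ p (w i) = 0) → 1 ≤ ‖fderiv ℝ ρ p (w j)‖ →
      AEMeasurable φ μ → Integrable g μ → (∀ᵐ x ∂μ, ρ (φ x) = 0) → (∀ᵐ x ∂μ, ‖φ x - p‖ ≤ ε) →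
      0 < ε → ε ≤ 1 → 1 / ε ≤ T → ∀ (y : ι → ℝ) (t : ℝ),
      avg T (fun y => ‖tauExt μ (fun x i => ⟪b i, φ x⟫_ℝ) g y‖ₑ ^ 2) (Function.update y j t)
        ≤ ENNReal.ofReal (Real.exp (C * ε / T * |t - y j|)) *
          avg T (fun y => ‖tauExt μ (fun x i => ⟪b i, φ x⟫_ℝ) g y‖ₑ ^ 2) y := by
  obtain ⟨Cβ, hCβ, hβ⟩ := exists_wint_tauExt_sub_le ι X
  set d := Fintype.card ι with hd
  set K₁ : ℝ := 2 * Real.pi * max K 1 with hK₁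
  have hπ := Real.pi_gt_three
  have hK₁1 : 1 ≤ K₁ := by
    have := le_max_right K 1
    nlinarith
  set G : ℝ := (2 * K₁ ^ 2) ^ d with hG
  have hG0 : 0 ≤ G := by positivity
  set C₁ : ℝ := d ^ 2 * K₁ ^ 2 * (Cβ * G + 6 * G ^ 2) with hC₁
  have hC₁0 : 0 ≤ C₁ := by positivity
  set M := ∫ η, ‖𝓕 ρ η‖ * (1 + ‖η‖) ^ (4 * d + 2) with hM
  have hM0 : 0 ≤ M := integral_nonneg fun η => by positivity
  refine ⟨C₁ * M + 1, by positivity, ?_⟩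
  intro μ _ b w j p φ g ε T hb hw hbw hρ0 hρ1 hφ hg hρφ hφp hε hε1 hT y t
  have hT1 : 1 ≤ T := ((one_le_div hε).mpr hε1).trans hT
  have hT0 : 0 < T := by linarith
  have hN1 : 1 ≤ T * ε := by rwa [div_le_iff₀ hε] at hT
  set σ := T⁻¹ with hσ
  have hσT : σ * T = 1 := inv_mul_cancel₀ hT0.ne'
  have hσ0 : 0 < σ := inv_pos.mpr hT0
  have hσε : σ ≤ ε := by
    rw [hσ, inv_le_comm₀ hT0 hε]; simpa using hT
  have hσ1 : σ ≤ 1 := hσε.trans hε1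
  set a : E → ι → ℝ := fun η i => 2 * Real.pi * σ * ⟪w i, η⟫_ℝ with ha
  have hac : Continuous a := by fun_prop
  set c : E → ℂ := fun η => Complex.exp (Complex.I * ((2 * Real.pi * ⟪η, p⟫_ℝ : ℝ) : ℂ)) with hc
  have hcc : Continuous c := by fun_prop
  have hc1 : ∀ η, ‖c η‖ = 1 := fun η => norm_exp_I_mul _
  have hm : Integrable (fun η => 𝓕 ρ η) := (𝓕 ρ).integrable
  have hmcont : Continuous (fun η => 𝓕 ρ η) := (𝓕 ρ).continuous
  set τ : X → ι → ℝ := fun x i => T * ⟪b i, φ x⟫_ℝ with hτ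
  have hτm : AEMeasurable τ μ := by
    refine aemeasurable_pi_lambda _ fun i => ?_
    exact ((continuous_const.inner continuous_id).measurable.comp_aemeasurable hφ).const_mul T
  set τ₀ : X → ι → ℝ := fun x i => τ x i - T * ⟪b i, p⟫_ℝ with hτ₀
  have hτ₀m : AEMeasurable τ₀ μ := hτm.sub_const (fun i => T * ⟪b i, p⟫_ℝ)
  set v := tauExt μ τ g with hv
  set v₀ := tauExt μ τ₀ g with hv₀
  have hvc : Continuous v := continuous_tauExt hτm hg
  have hvB : ∀ z, ‖v z‖ ≤ ∫ x, ‖g x‖ ∂μ := fun z => norm_tauExt_le _ _ _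
  have hvv₀ : ∀ z, v z = Complex.exp (Complex.I * ((∑ i, z i * (T * ⟪b i, p⟫_ℝ) : ℝ) : ℂ)) * v₀ z :=
    fun z => tauExt_sub_const _ _ _ _
  have hvn : ∀ z, ‖v z‖ₑ = ‖v₀ z‖ₑ := fun z => by
    rw [hvv₀, ← ofReal_norm, ← ofReal_norm, norm_mul, norm_exp_I_mul, one_mul]
  have hva : ∀ η z, v (z + a η) =
      osc μ (fun x => ∑ i, z i * τ x i + 2 * Real.pi * ⟪η, φ x⟫_ℝ) g := by
    intro η z
    rw [hv, tauExt]
    congr 1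
    ext x
    exact sum_inner_phase hbw hσT η (φ x) z
  have hvd : ∀ η z, ‖v (z + a η) - c η * v z‖ₑ = ‖v₀ (z + a η) - v₀ z‖ₑ := by
    intro η z
    rw [hvv₀, hvv₀ z, sum_inner_phase hbw hσT η p z, Complex.ofReal_add, mul_add, Complex.exp_add]
    rw [← ofReal_norm, ← ofReal_norm]
    congr 1
    rw [show ∀ e c' x y : ℂ, e * c' * x - c' * (e * y) = e * c' * (x - y) by intros; ring]
    rw [norm_mul, norm_mul, norm_exp_I_mul, norm_exp_I_mul, one_mul, one_mul]
  have hai : ∀ η i, |a η i| ≤ σ * (K₁ * ‖η‖) := by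
    intro η i
    rw [ha]
    simp only
    rw [abs_mul, abs_of_nonneg (by positivity : 0 ≤ 2 * Real.pi * σ)]
    have h1 : |⟪w i, η⟫_ℝ| ≤ max K 1 * ‖η‖ :=
      (abs_real_inner_le_norm _ _).trans
        (mul_le_mul_of_nonneg_right ((hw i).trans (le_max_left _ _)) (norm_nonneg _))
    calc _ ≤ 2 * Real.pi * σ * (max K 1 * ‖η‖) := by gcongr
      _ = _ := by rw [hK₁]; ring
  have hai' : ∀ η i, |a η i| ≤ K₁ * ‖η‖ := fun η i =>
    (hai η i).trans (mul_le_of_le_one_left (by positivity) hσ1)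
  have hgr : ∀ η, growth (a η) ≤ G * (1 + ‖η‖) ^ (2 * d) := fun η =>
    growth_le_pow (norm_nonneg _) hK₁1 (hai' η)
  have hA : ∀ η, ∑ i, |a η i| ≤ d * (σ * (K₁ * ‖η‖)) := by
    intro η
    refine (Finset.sum_le_sum fun i _ => hai η i).trans_eq ?_
    simp [hd]
  have hA0 : ∀ η, 0 ≤ ∑ i, |a η i| := fun η => Finset.sum_nonneg fun i _ => abs_nonneg _
  have hg0 : ∀ η, 0 ≤ growth (a η) := fun η => zero_le_one.trans (one_le_growth _)
  set P : E → ℝ := fun η => Cβ * (T * ε * (∑ i, |a η i|) * growth (a η)) with hP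
  have hP0 : ∀ η, 0 ≤ P η := fun η => by
    have := hA0 η; have := hg0 η; positivity
  have hWle : ∀ η, (∑ i, |a η i|) * P η + 6 * (∑ i, |a η i|) ^ 2 * growth (a η) ^ 2
      ≤ ε * σ * C₁ * (1 + ‖η‖) ^ (4 * d + 2) := by
    intro η
    have h1 := hA0 η
    have h2 := hg0 η
    have hη := norm_nonneg η
    have hx : ∀ k, 1 ≤ (1 + ‖η‖) ^ k := fun k => one_le_pow₀ (by linarith)
    have hη2 : ‖η‖ ^ 2 ≤ (1 + ‖η‖) ^ 2 := by gcongr; linarith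
    have hA2 : (∑ i, |a η i|) ^ 2 ≤ (d * (σ * (K₁ * ‖η‖))) ^ 2 := by
      gcongr; exact hA η
    calc _ = (∑ i, |a η i|) ^ 2 * (Cβ * (T * ε) * growth (a η) + 6 * growth (a η) ^ 2) := by
          rw [hP]; ring
      _ ≤ (d * (σ * (K₁ * ‖η‖))) ^ 2 * (Cβ * (T * ε) * (G * (1 + ‖η‖) ^ (2 * d)) +
            6 * (G * (1 + ‖η‖) ^ (2 * d)) ^ 2) := by
          gcongr <;> exact hgr η
      _ ≤ (d * (σ * (K₁ * ‖η‖))) ^ 2 * (Cβ * (T * ε) * (G * (1 + ‖η‖) ^ (4 * d)) +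
            6 * (T * ε) * (G ^ 2 * (1 + ‖η‖) ^ (4 * d))) := by
          have e1 : (1 + ‖η‖) ^ (2 * d) ≤ (1 + ‖η‖) ^ (4 * d) :=
            pow_le_pow_right₀ (by linarith) (by omega)
          have e2 : 6 * (G * (1 + ‖η‖) ^ (2 * d)) ^ 2
              ≤ 6 * (T * ε) * (G ^ 2 * (1 + ‖η‖) ^ (4 * d)) := by
            have : (G * (1 + ‖η‖) ^ (2 * d)) ^ 2 = G ^ 2 * (1 + ‖η‖) ^ (4 * d) := by
              rw [mul_pow, ← pow_mul (1 + ‖η‖), show 2 * d * 2 = 4 * d by ring]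
            rw [this]
            have h6 : 0 ≤ G ^ 2 * (1 + ‖η‖) ^ (4 * d) := by positivity
            nlinarith
          gcongr
      _ = σ * T * ε * σ * (d ^ 2 * K₁ ^ 2 * (Cβ * G + 6 * G ^ 2)) *
            (‖η‖ ^ 2 * (1 + ‖η‖) ^ (4 * d)) := by ring
      _ ≤ σ * T * ε * σ * (d ^ 2 * K₁ ^ 2 * (Cβ * G + 6 * G ^ 2)) *
            ((1 + ‖η‖) ^ 2 * (1 + ‖η‖) ^ (4 * d)) := by gcongr
      _ = _ := by rw [hσT, hC₁]; ring
  have hWint : Integrable fun η => ‖𝓕 ρ η‖ * (ε * σ * C₁ * (1 + ‖η‖) ^ (4 * d + 2)) := by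
    have := (integrable_norm_mul_one_add_pow (μ := volume) (𝓕 ρ) (4 * d + 2)).const_mul (ε * σ * C₁)
    refine this.congr (Filter.Eventually.of_forall fun η => ?_)
    simp only
    ring
  have hW0 : ∀ η, 0 ≤ (∑ i, |a η i|) * P η +
      6 * (∑ i, |a η i|) ^ 2 * growth (a η) ^ 2 := fun η => by
    have := hA0 η; have := hg0 η; have := hP0 η; positivity
  have hgc : Continuous fun η => growth (a η) := continuous_growth.comp hac
  have hW : Integrable (fun η => ‖𝓕 ρ η‖ * ((∑ i, |a η i|) * P η +
      6 * (∑ i, |a η i|) ^ 2 * growth (a η) ^ 2)) := by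
    refine hWint.mono' ?_ (Filter.Eventually.of_forall fun η => ?_)
    · have hPc : Continuous P := by fun_prop
      exact (Continuous.mul hmcont.norm (by fun_prop)).aestronglyMeasurable
    · rw [Real.norm_of_nonneg (mul_nonneg (norm_nonneg _) (hW0 η))]
      exact mul_le_mul_of_nonneg_left (hWle η) (norm_nonneg _)
  have hmc : ∀ i, Integrable (fun η => 𝓕 ρ η * c η * (a η i : ℂ)) := by
    intro i
    have h1 := (integrable_norm_mul_one_add_pow (μ := volume) (𝓕 ρ) 1).const_mul K₁
    refine h1.mono' ?_ (Filter.Eventually.of_forall fun η => ?_)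
    · exact (Continuous.mul (hmcont.mul hcc) (by fun_prop)).aestronglyMeasurable
    · rw [norm_mul, norm_mul, hc1, mul_one, Complex.norm_real, Real.norm_eq_abs]
      have := hai' η i
      have hn := norm_nonneg (𝓕 ρ η)
      have hη := norm_nonneg η
      calc _ ≤ ‖𝓕 ρ η‖ * (K₁ * ‖η‖) := by gcongr
        _ ≤ ‖𝓕 ρ η‖ * (K₁ * (1 + ‖η‖) ^ 1) := by gcongr; linarith
        _ = _ := by ring
  have hmain := fun y => norm_sum_integral_mul_le (μ := volume) (m := fun η => 𝓕 ρ η)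
    (c := c) (a := a) (P := P)
    hm hac hvc hvB
    (fun z => by
      simp_rw [hva]
      rw [integral_fourier_mul_osc ρ hφ (aemeasurable_phase hτm z) hg]
      refine integral_eq_zero_of_ae ?_
      filter_upwards [hρφ] with x hx
      simp [hx])
    (fun z => by
      have : ∀ η, conj (v (z - a η)) = osc μ (fun x => -(∑ i, z i * τ x i) +
          2 * Real.pi * ⟪η, φ x⟫_ℝ) (fun x => conj (g x)) := by
        intro η
        have e : z - a η = z + a (-η) := by
          ext i; simp [ha]; ring
        rw [e, hva, conj_osc]
        congr 1
        ext x
        rw [inner_neg_left]; ring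
      simp_rw [this]
      rw [integral_fourier_mul_osc ρ hφ
        (θ := fun x => -∑ i, z i * τ x i) (aemeasurable_phase hτm z).neg
        (g := fun x => conj (g x)) (Complex.conjCLE.toContinuousLinearMap.integrable_comp hg)]
      refine integral_eq_zero_of_ae ?_
      filter_upwards [hρφ] with x hx
      simp [hx])
    hP0
    (fun η y => by
      simp_rw [hvd, hvn]
      exact hβ μ τ₀ g (T * ε) hτ₀m hg hN1 (by
        filter_upwards [hφp] with x hx i
        rw [hτ₀]
        simp only [hτ]
        rw [← mul_sub, ← inner_sub_right, abs_mul, abs_of_pos hT0]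
        refine mul_le_mul_of_nonneg_left ((abs_real_inner_le_norm _ _).trans ?_) hT0.le
        calc _ ≤ 1 * ε := mul_le_mul (hb i) hx (norm_nonneg _) zero_le_one
          _ = ε := one_mul _) (a η) y)
    hmc hW y
  have hcoef : ∀ i, ∫ η, 𝓕 ρ η * c η * (a η i : ℂ) = σ * (-Complex.I * fderiv ℝ ρ p (w i)) := by
    intro i
    rw [← integral_fourier_mul_exp_mul_inner, ← integral_const_mul]
    refine integral_congr_ae (Filter.Eventually.of_forall fun η => ?_)
    simp only [hc, ha]
    push_cast
    ring
  have hder : ∀ y : ι → ℝ, |∫ z, ‖v z‖ ^ 2 * (cauchyLogDeriv ((y - z) j) * ker (y - z))|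
      ≤ (C₁ * M + 1) * ε * ∫ z, ‖v z‖ ^ 2 * ker (y - z) := by
    intro y
    have h1 := hmain y
    rw [Finset.sum_eq_single j (fun i _ hi => by rw [hcoef, hρ0 i hi]; simp) (by simp), hcoef,
      norm_mul, norm_mul, norm_mul, norm_neg, Complex.norm_I, one_mul, Complex.norm_real,
      Complex.norm_real, Real.norm_of_nonneg hσ0.le, Real.norm_eq_abs] at h1
    have hF0 : 0 ≤ ∫ z, ‖v z‖ ^ 2 * ker (y - z) :=
      integral_nonneg fun z => mul_nonneg (by positivity) (ker_pos _).le
    have h2 : ∫ η, ‖𝓕 ρ η‖ * ((∑ i, |a η i|) * P η + 6 * (∑ i, |a η i|) ^ 2 * growth (a η) ^ 2)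
        ≤ ε * σ * C₁ * M := by
      refine (integral_mono hW hWint fun η =>
        mul_le_mul_of_nonneg_left (hWle η) (norm_nonneg _)).trans_eq ?_
      rw [hM, ← integral_const_mul]
      congr 1
      ext η
      ring
    have h3 := h1.trans (mul_le_mul_of_nonneg_right h2 hF0)
    set Ij := |∫ z, ‖v z‖ ^ 2 * (cauchyLogDeriv ((y - z) j) * ker (y - z))|
    have hIj : 0 ≤ Ij := abs_nonneg _
    have h4 : σ * Ij ≤ σ * ((C₁ * M + 1) * ε * ∫ z, ‖v z‖ ^ 2 * ker (y - z)) := by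
      calc σ * Ij = σ * 1 * Ij := by ring
        _ ≤ σ * ‖fderiv ℝ ρ p (w j)‖ * Ij := by gcongr
        _ ≤ _ := h3
        _ = σ * (C₁ * M * ε * ∫ z, ‖v z‖ ^ 2 * ker (y - z)) := by ring
        _ ≤ _ := by gcongr; linarith
    exact le_of_mul_le_mul_left h4 hσ0
  have hum : Measurable (tauExt μ (fun x i => ⟪b i, φ x⟫_ℝ) g) := by
    refine (continuous_tauExt (aemeasurable_pi_lambda _ fun i => ?_) hg).measurable
    exact (continuous_const.inner continuous_id).measurable.comp_aemeasurable hφ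
  have hav := avg_enorm_sq_eq hvc hvB hT0 (fun z => tauExt_smul T _ g z) hum
  rw [hav, hav, ← ENNReal.ofReal_mul (Real.exp_pos _).le]
  refine ENNReal.ofReal_le_ofReal ?_
  have hfin := integral_mul_ker_update_le hvc hvB hder (T⁻¹ • y) (T⁻¹ * t)
  have e1 : Function.update (T⁻¹ • y) j (T⁻¹ * t) = T⁻¹ • Function.update y j t := by
    ext i
    by_cases h : i = j
    · subst h; simp
    · simp [h]
  rw [e1] at hfin
  refine hfin.trans_eq ?_
  congr 2
  rw [Pi.smul_apply, smul_eq_mul, ← mul_sub, abs_mul, abs_of_pos (inv_pos.mpr hT0)]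
  field_simp

end DirectionalVariation

section Energy

open scoped FourierTransform ComplexConjugate

lemma integrable_exp_neg_abs : Integrable fun v : ℝ => (Real.exp (-|v|) : ℂ) := by
  have h1 : IntegrableOn (fun v : ℝ => (Real.exp (-|v|) : ℂ)) (Set.Ioi 0) := by
    refine (integrableOn_exp_mul_complex_Ioi (a := -1) (by simp) 0).congr_fun (fun v hv => ?_)
      measurableSet_Ioi
    simp [abs_of_pos (show 0 < v from hv)]
  have h2 : IntegrableOn (fun v : ℝ => (Real.exp (-|v|) : ℂ)) (Set.Iic 0) := by
    refine (integrableOn_exp_mul_complex_Iic (a := 1) (by simp) 0).congr_fun (fun v hv => ?_)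
      measurableSet_Iic
    simp [abs_of_nonpos (show v ≤ 0 from hv)]
  rw [← integrableOn_univ, ← Set.Iic_union_Ioi (a := (0 : ℝ))]
  exact h2.union h1

lemma fourier_exp_neg_abs (w : ℝ) :
    𝓕 (fun v : ℝ => (Real.exp (-|v|) : ℂ)) w = (2 * Real.pi * cauchy (2 * Real.pi * w) : ℝ) := by
  rw [Real.fourier_real_eq_integral_exp_smul]
  have hF : Integrable fun v : ℝ => Complex.exp (↑(-2 * Real.pi * v * w) * Complex.I) •
      (Real.exp (-|v|) : ℂ) := by
    refine integrable_exp_neg_abs.bdd_mul (c := 1) (by fun_prop)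
      (Filter.Eventually.of_forall fun v => ?_)
    rw [Complex.norm_exp_ofReal_mul_I]
  rw [← intervalIntegral.integral_Iic_add_Ioi hF.integrableOn hF.integrableOn (b := 0)]
  set q : ℂ := 2 * Real.pi * w * Complex.I with hq
  have hqre : q.re = 0 := by simp [hq]
  have e1 : ∫ v in Set.Iic (0 : ℝ), Complex.exp (↑(-2 * Real.pi * v * w) * Complex.I) •
      (Real.exp (-|v|) : ℂ) = ∫ v in Set.Iic (0 : ℝ), Complex.exp ((1 - q) * v) := by
    refine setIntegral_congr_fun measurableSet_Iic fun v hv => ?_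
    simp only [smul_eq_mul, abs_of_nonpos (show v ≤ 0 from hv)]
    rw [Complex.ofReal_exp, ← Complex.exp_add]
    congr 1
    push_cast [hq]
    ring
  have e2 : ∫ v in Set.Ioi (0 : ℝ), Complex.exp (↑(-2 * Real.pi * v * w) * Complex.I) •
      (Real.exp (-|v|) : ℂ) = ∫ v in Set.Ioi (0 : ℝ), Complex.exp ((-1 - q) * v) := by
    refine setIntegral_congr_fun measurableSet_Ioi fun v hv => ?_
    simp only [smul_eq_mul, abs_of_pos (show 0 < v from hv)]
    rw [Complex.ofReal_exp, ← Complex.exp_add]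
    congr 1
    push_cast [hq]
    ring
  rw [e1, e2, integral_exp_mul_complex_Iic (by simp [hqre]),
    integral_exp_mul_complex_Ioi (by simp [hqre])]
  have hp : (1 - q) ≠ 0 := fun h => by
    have := congrArg Complex.re h
    simp [hqre] at this
  have hp2 : (-1 - q) ≠ 0 := fun h => by
    have := congrArg Complex.re h
    simp [hqre] at this
  have hp3 : (1 + (2 * Real.pi * w : ℂ) ^ 2) = (1 - q) * -(-1 - q) := by
    rw [hq]; ring_nf; rw [Complex.I_sq]; ring
  unfold cauchy
  push_cast
  rw [hp3]
  have hπ : (Real.pi : ℂ) ≠ 0 := by exact_mod_cast Real.pi_ne_zero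
  simp only [mul_zero, Complex.exp_zero]
  field_simp
  ring

lemma integral_exp_mul_cauchy (t : ℝ) :
    ∫ s : ℝ, Complex.exp (Complex.I * ((t * s : ℝ) : ℂ)) * (cauchy s : ℂ) = Real.exp (-|t|) := by
  have hc : Continuous fun v : ℝ => (Real.exp (-|v|) : ℂ) := by fun_prop
  have hF : 𝓕 (fun v : ℝ => (Real.exp (-|v|) : ℂ)) =
      fun w => ((2 * Real.pi * cauchy (2 * Real.pi * w) : ℝ) : ℂ) := funext fourier_exp_neg_abs
  have hi : Integrable fun w : ℝ => ((2 * Real.pi * cauchy (2 * Real.pi * w) : ℝ) : ℂ) :=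
    ((integrable_cauchy.comp_mul_left' (by positivity)).const_mul _).ofReal
  have h := congrFun (hc.fourierInv_fourier_eq integrable_exp_neg_abs (hF ▸ hi)) t
  rw [hF, Real.fourierInv_eq'] at h
  rw [← h]
  have h2 := Measure.integral_comp_mul_left
    (fun s : ℝ => Complex.exp (Complex.I * ((t * s : ℝ) : ℂ)) * (cauchy s : ℂ)) (2 * Real.pi)
  rw [abs_of_pos (by positivity)] at h2
  have hπ : (0 : ℝ) < 2 * Real.pi := by positivity
  have h3 : ∫ s : ℝ, Complex.exp (Complex.I * ((t * s : ℝ) : ℂ)) * (cauchy s : ℂ) =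
      (2 * Real.pi : ℝ) • ∫ x : ℝ, Complex.exp (Complex.I * ((t * (2 * Real.pi * x) : ℝ) : ℂ)) *
        (cauchy (2 * Real.pi * x) : ℂ) := by
    rw [h2, smul_smul, mul_inv_cancel₀ hπ.ne', one_smul]
  rw [h3, ← integral_smul]
  congr 1
  ext w
  simp only [RCLike.inner_apply, conj_trivial, Complex.real_smul, smul_eq_mul]
  push_cast
  rw [show Complex.I * (t * (2 * Real.pi * w)) = 2 * Real.pi * (t * w) * Complex.I by ring]
  ring

variable {ι : Type*} [Fintype ι]

lemma integral_exp_mul_ker (a : ι → ℝ) :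
    ∫ b : ι → ℝ, Complex.exp (Complex.I * ((∑ i, a i * b i : ℝ) : ℂ)) * (ker b : ℂ)
      = Real.exp (-∑ i, |a i|) := by
  have : ∀ b : ι → ℝ, Complex.exp (Complex.I * ((∑ i, a i * b i : ℝ) : ℂ)) * (ker b : ℂ)
      = ∏ i, (Complex.exp (Complex.I * ((a i * b i : ℝ) : ℂ)) * (cauchy (b i) : ℂ)) := by
    intro b
    rw [Finset.prod_mul_distrib, ← Complex.exp_sum, ker]
    push_cast
    rw [Finset.mul_sum]
  simp_rw [this]
  rw [integral_fintype_prod_volume_eq_prod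
    (f := fun i s => Complex.exp (Complex.I * ((a i * s : ℝ) : ℂ)) * (cauchy s : ℂ))]
  simp_rw [integral_exp_mul_cauchy]
  rw [← Complex.ofReal_prod, ← Real.exp_sum, Finset.sum_neg_distrib]

end Energy

section EnergySchur

open scoped ComplexConjugate

variable {ι : Type*} [Fintype ι]

lemma norm_integral_exp_mul_ker_sub (a y : ι → ℝ) :
    ‖∫ z : ι → ℝ, Complex.exp (Complex.I * ((∑ i, z i * a i : ℝ) : ℂ)) * (ker (y - z) : ℂ)‖
      = Real.exp (-∑ i, |a i|) := by
  rw [← integral_sub_left_eq_self _ volume y]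
  have : ∀ z : ι → ℝ, Complex.exp (Complex.I * ((∑ i, (y - z) i * a i : ℝ) : ℂ)) *
      (ker (y - (y - z)) : ℂ) = Complex.exp (Complex.I * ((∑ i, y i * a i : ℝ) : ℂ)) *
        (Complex.exp (Complex.I * ((∑ i, (-a) i * z i : ℝ) : ℂ)) * (ker z : ℂ)) := by
    intro z
    rw [sub_sub_cancel, ← mul_assoc, ← Complex.exp_add, ← mul_add, ← Complex.ofReal_add,
      ← Finset.sum_add_distrib]
    congr 5
    ext i
    simp only [Pi.sub_apply, Pi.neg_apply]
    ring
  simp_rw [this]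
  rw [integral_const_mul, norm_mul, norm_exp_I_mul, one_mul, integral_exp_mul_ker]
  simp only [Pi.neg_apply, abs_neg]
  rw [Complex.norm_real, Real.norm_of_nonneg (Real.exp_pos _).le]

variable {X : Type*} [MeasurableSpace X] {μ : Measure X}

lemma ofReal_integral_norm_tauExt_sq_le [SFinite μ] {τ : X → ι → ℝ} {g : X → ℂ} (hτ : Measurable τ)
    (hg : Integrable g μ) (y : ι → ℝ) :
    ENNReal.ofReal (∫ z, ‖tauExt μ τ g z‖ ^ 2 * ker (y - z))
      ≤ ∫⁻ x, ∫⁻ x', ‖g x‖ₑ * ‖g x'‖ₑ *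
          ENNReal.ofReal (Real.exp (-∑ i, |τ x i - τ x' i|)) ∂μ ∂μ := by
  set v := tauExt μ τ g with hv
  set Θ : (ι → ℝ) → X × X → ℝ := fun z p => ∑ i, z i * (τ p.1 i - τ p.2 i) with hΘ
  set G : X × X → ℂ := fun p => g p.1 * conj (g p.2) with hG
  have hGi : Integrable G (μ.prod μ) :=
    hg.mul_prod (Complex.conjCLE.toContinuousLinearMap.integrable_comp hg)
  have hv2 : ∀ z, ((‖v z‖ ^ 2 : ℝ) : ℂ) =
      ∫ p, Complex.exp (Complex.I * (Θ z p : ℂ)) * G p ∂(μ.prod μ) := by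
    intro z
    have h1 := Complex.mul_conj' (v z)
    rw [Complex.ofReal_pow, ← h1, hv, tauExt, conj_osc, osc, osc, ← integral_prod_mul]
    refine integral_congr_ae (Filter.Eventually.of_forall fun p => ?_)
    simp only [hG, hΘ]
    have e : ((∑ i, z i * (τ p.1 i - τ p.2 i) : ℝ) : ℂ) =
        ((∑ i, z i * τ p.1 i : ℝ) : ℂ) + ((-∑ i, z i * τ p.2 i : ℝ) : ℂ) := by
      rw [← Complex.ofReal_add, ← sub_eq_add_neg, ← Finset.sum_sub_distrib]
      simp_rw [mul_sub]
    rw [e, mul_add, Complex.exp_add]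
    ring
  have hΘm : Measurable fun q : (ι → ℝ) × (X × X) => Θ q.1 q.2 := by
    refine Finset.measurable_fun_sum _ fun i _ => ?_
    have h1 : Measurable fun q : (ι → ℝ) × (X × X) => τ q.2.1 i :=
      (measurable_pi_apply i).comp (hτ.comp (measurable_fst.comp measurable_snd))
    have h2 : Measurable fun q : (ι → ℝ) × (X × X) => τ q.2.2 i :=
      (measurable_pi_apply i).comp (hτ.comp (measurable_snd.comp measurable_snd))
    exact ((measurable_pi_apply i).comp measurable_fst).mul (h1.sub h2)
  have hint : Integrable (fun q : (ι → ℝ) × (X × X) =>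
      Complex.exp (Complex.I * (Θ q.1 q.2 : ℂ)) * ((ker (y - q.1) : ℂ) * G q.2))
      (volume.prod (μ.prod μ)) := by
    have h1 : Integrable (fun q : (ι → ℝ) × (X × X) => (ker (y - q.1) : ℂ) * G q.2)
        (volume.prod (μ.prod μ)) := (integrable_ker.comp_sub_left y).ofReal.mul_prod hGi
    exact h1.bdd_mul (c := 1) (aestronglyMeasurable_exp_I hΘm.aemeasurable)
      (Filter.Eventually.of_forall fun _ => (norm_exp_I_mul _).le)
  have hJ : ((∫ z, ‖v z‖ ^ 2 * ker (y - z) : ℝ) : ℂ) = ∫ p, (G p *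
      ∫ z, Complex.exp (Complex.I * (Θ z p : ℂ)) * (ker (y - z) : ℂ)) ∂(μ.prod μ) := by
    rw [← integral_complex_ofReal]
    simp_rw [Complex.ofReal_mul, hv2, ← integral_mul_const, ← integral_const_mul]
    have h := integral_integral_swap (f := fun z p =>
      Complex.exp (Complex.I * (Θ z p : ℂ)) * ((ker (y - z) : ℂ) * G p)) hint
    refine Eq.trans ?_ (h.trans ?_)
    · refine integral_congr_ae (Filter.Eventually.of_forall fun z => ?_)
      refine integral_congr_ae (Filter.Eventually.of_forall fun p => ?_)
      simp only
      ring
    · refine integral_congr_ae (Filter.Eventually.of_forall fun p => ?_)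
      refine integral_congr_ae (Filter.Eventually.of_forall fun z => ?_)
      simp only
      ring
  have hJ0 : 0 ≤ ∫ z, ‖v z‖ ^ 2 * ker (y - z) :=
    integral_nonneg fun z => mul_nonneg (by positivity) (ker_pos _).le
  have e : ENNReal.ofReal (∫ z, ‖v z‖ ^ 2 * ker (y - z)) =
      ‖((∫ z, ‖v z‖ ^ 2 * ker (y - z) : ℝ) : ℂ)‖ₑ := by
    rw [← ofReal_norm, Complex.norm_real, Real.norm_of_nonneg hJ0]
  rw [e, hJ]
  refine (enorm_integral_le_lintegral_enorm _).trans ?_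
  have hk : ∀ p, ‖G p * ∫ z, Complex.exp (Complex.I * (Θ z p : ℂ)) * (ker (y - z) : ℂ)‖ₑ =
      ‖g p.1‖ₑ * ‖g p.2‖ₑ * ENNReal.ofReal (Real.exp (-∑ i, |τ p.1 i - τ p.2 i|)) := by
    intro p
    rw [enorm_mul, hG, enorm_mul, RCLike.enorm_conj,
      ← norm_integral_exp_mul_ker_sub (fun i => τ p.1 i - τ p.2 i) y, ofReal_norm]
  simp_rw [hk]
  rw [lintegral_prod]
  have h1 : Measurable fun p : X × X => Real.exp (-∑ i, |τ p.1 i - τ p.2 i|) := by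
    have h1 : ∀ i, Measurable fun p : X × X => τ p.1 i := fun i =>
      (measurable_pi_apply i).comp (hτ.comp measurable_fst)
    have h2 : ∀ i, Measurable fun p : X × X => τ p.2 i := fun i =>
      (measurable_pi_apply i).comp (hτ.comp measurable_snd)
    refine (Finset.measurable_fun_sum _ fun i _ => ?_).neg.exp
    exact ((h1 i).sub (h2 i)).abs
  exact (hg.aemeasurable.enorm.comp_fst.mul hg.aemeasurable.enorm.comp_snd).mul
    h1.ennreal_ofReal.aemeasurable

variable {E : Type*} [NormedAddCommGroup E] [NormedSpace ℝ E] [FiniteDimensional ℝ E]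
  [MeasurableSpace E] [BorelSpace E] (ν : Measure E) [ν.IsAddHaarMeasure]

lemma lintegral_exp_neg_norm_lt_top : ∫⁻ x, ENNReal.ofReal (Real.exp (-‖x‖)) ∂ν < ⊤ := by
  set m := Module.finrank ℝ E + 1 with hm
  have h := finite_integral_one_add_norm (E := E) (μ := ν) (r := m) (by
    rw [hm]; push_cast; linarith)
  have hle : ∀ x : E, ENNReal.ofReal (Real.exp (-‖x‖)) ≤
      ENNReal.ofReal (m.factorial * Real.exp 1) * ENNReal.ofReal ((1 + ‖x‖) ^ (-(m : ℝ))) := by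
    intro x
    rw [← ENNReal.ofReal_mul (by positivity)]
    refine ENNReal.ofReal_le_ofReal ?_
    have hx : 0 < 1 + ‖x‖ := by positivity
    have h1 := Real.pow_div_factorial_le_exp (1 + ‖x‖) hx.le m
    rw [Real.rpow_neg hx.le, Real.rpow_natCast, ← div_eq_mul_inv, le_div_iff₀ (by positivity)]
    rw [div_le_iff₀ (by positivity), Real.exp_add] at h1
    calc Real.exp (-‖x‖) * (1 + ‖x‖) ^ m
        ≤ Real.exp (-‖x‖) * (Real.exp 1 * Real.exp ‖x‖ * m.factorial) := by gcongr
      _ = Real.exp (-‖x‖) * Real.exp ‖x‖ * (m.factorial * Real.exp 1) := by ring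
      _ = _ := by rw [← Real.exp_add]; simp
  refine (lintegral_mono hle).trans_lt ?_
  rw [lintegral_const_mul' _ _ ENNReal.ofReal_ne_top]
  exact ENNReal.mul_lt_top ENNReal.ofReal_lt_top h

lemma lintegral_exp_neg_mul_norm {s : ℝ} (hs : 0 < s) :
    ∫⁻ x, ENNReal.ofReal (Real.exp (-(s * ‖x‖))) ∂ν =
      ENNReal.ofReal ((s ^ Module.finrank ℝ E)⁻¹) *
        ∫⁻ x, ENNReal.ofReal (Real.exp (-‖x‖)) ∂ν := by
  have h := Measure.map_addHaar_smul ν hs.ne'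
  have h2 : ∫⁻ x, ENNReal.ofReal (Real.exp (-‖x‖)) ∂(Measure.map (s • ·) ν) =
      ∫⁻ x, ENNReal.ofReal (Real.exp (-(s * ‖x‖))) ∂ν := by
    rw [lintegral_map (by fun_prop) (by fun_prop)]
    simp_rw [norm_smul, Real.norm_of_nonneg hs.le]
  rw [← h2, h, lintegral_smul_measure, abs_of_pos (by positivity), smul_eq_mul]

lemma exists_avg_tauExt_le (ι : Type*) [Fintype ι] {c : ℝ} (hc : 0 < c) : ∃ C > 0, ∀ (V : Set E)
    (τ : E → ι → ℝ) (g : E → ℂ) (T : ℝ), MeasurableSet V → 0 < T → Measurable τ →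
    Integrable g (ν.restrict V) →
    (∀ x ∈ V, ∀ x' ∈ V, c * ‖x - x'‖ ≤ ∑ i, |τ x i - τ x' i|) → ∀ y,
    avg T (fun y => ‖tauExt (ν.restrict V) τ g y‖ₑ ^ 2) y
      ≤ ENNReal.ofReal (C * (T ^ Module.finrank ℝ E)⁻¹) * ∫⁻ x in V, ‖g x‖ₑ ^ 2 ∂ν := by
  set J := ∫⁻ x, ENNReal.ofReal (Real.exp (-‖x‖)) ∂ν with hJ
  have hJt : J ≠ ⊤ := (lintegral_exp_neg_norm_lt_top ν).ne
  set m := Module.finrank ℝ E with hm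
  refine ⟨2 * (c ^ m)⁻¹ * J.toReal + 1, by positivity, ?_⟩
  intro V τ g T hV hT hτ hg hcV y
  have hc' := (continuous_tauExt hτ.aemeasurable hg)
  rw [avg_enorm_sq_eq (v := tauExt (ν.restrict V) (fun x i => T * τ x i) g)
    (continuous_tauExt (by fun_prop) hg)
    (norm_tauExt_le _ _) hT (fun z => tauExt_smul T τ g z) hc'.measurable]
  refine (ofReal_integral_norm_tauExt_sq_le (by fun_prop) hg _).trans ?_
  set k : E → ℝ≥0∞ := fun x => ENNReal.ofReal (Real.exp (-(T * c * ‖x‖))) with hk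
  have hkm : Measurable k := by fun_prop
  have hkJ : ∫⁻ x, k x ∂ν = ENNReal.ofReal (((T * c) ^ m)⁻¹) * J :=
    lintegral_exp_neg_mul_norm ν (mul_pos hT hc)
  have hpt : ∀ x ∈ V, ∀ x' ∈ V,
      ‖g x‖ₑ * ‖g x'‖ₑ * ENNReal.ofReal (Real.exp (-∑ i, |T * τ x i - T * τ x' i|))
      ≤ ‖g x‖ₑ ^ 2 * k (x - x') + ‖g x'‖ₑ ^ 2 * k (x - x') := by
    intro x hx x' hx'
    rw [← add_mul]
    refine mul_le_mul' (ennreal_mul_le_sq_add_sq _ _) (ENNReal.ofReal_le_ofReal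
      (Real.exp_le_exp.mpr (neg_le_neg ?_)))
    simp_rw [← mul_sub, abs_mul, ← Finset.mul_sum, abs_of_pos hT]
    rw [mul_assoc]
    exact mul_le_mul_of_nonneg_left (hcV x hx x' hx') hT.le
  have hk1 : ∀ x, Measurable fun x' => k (x - x') := fun x =>
    hkm.comp (measurable_const.sub measurable_id)
  have hk2 : ∀ x', Measurable fun x => k (x - x') := fun x' =>
    hkm.comp (measurable_id.sub measurable_const)
  have hge : AEMeasurable (fun x => ‖g x‖ₑ ^ 2) (ν.restrict V) := hg.aemeasurable.enorm.pow_const 2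
  have hkx : ∀ x, ∫⁻ x' in V, k (x - x') ∂ν ≤ ∫⁻ x, k x ∂ν := fun x =>
    (setLIntegral_le_lintegral _ _).trans_eq (lintegral_sub_left_eq_self k x)
  have hkx' : ∀ x', ∫⁻ x in V, k (x - x') ∂ν ≤ ∫⁻ x, k x ∂ν := fun x' =>
    (setLIntegral_le_lintegral _ _).trans_eq (lintegral_sub_right_eq_self k x')
  have hkm2 : Measurable fun p : E × E => k (p.1 - p.2) :=
    hkm.comp (measurable_fst.sub measurable_snd)
  calc _ ≤ ∫⁻ x in V, ∫⁻ x' in V, (‖g x‖ₑ ^ 2 * k (x - x') + ‖g x'‖ₑ ^ 2 * k (x - x')) ∂ν ∂ν := by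
        refine setLIntegral_mono' hV fun x hx => setLIntegral_mono' hV fun x' hx' => hpt x hx x' hx'
    _ = (∫⁻ x in V, ∫⁻ x' in V, ‖g x‖ₑ ^ 2 * k (x - x') ∂ν ∂ν) +
          ∫⁻ x in V, ∫⁻ x' in V, ‖g x'‖ₑ ^ 2 * k (x - x') ∂ν ∂ν := by
        rw [← lintegral_add_left']
        · refine lintegral_congr fun x => ?_
          rw [lintegral_add_left]
          exact (hk1 x).const_mul _
        · have : Measurable fun x => ∫⁻ x' in V, k (x - x') ∂ν := hkm2.lintegral_prod_right'
          refine (hge.mul this.aemeasurable).congr (Filter.Eventually.of_forall fun x => ?_)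
          simp only
          rw [Pi.mul_apply, lintegral_const_mul]
          exact hk1 x
    _ ≤ (∫⁻ x in V, ‖g x‖ₑ ^ 2 * ∫⁻ x, k x ∂ν ∂ν) + ∫⁻ x in V, ‖g x‖ₑ ^ 2 * ∫⁻ x, k x ∂ν ∂ν := by
        refine add_le_add ?_ ?_
        · refine lintegral_mono fun x => ?_
          simp only
          rw [lintegral_const_mul _ (hk1 x)]
          exact mul_le_mul' le_rfl (hkx x)
        · rw [lintegral_lintegral_swap]
          · refine lintegral_mono fun x => ?_
            simp only
            rw [lintegral_const_mul _ (hk2 x)]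
            exact mul_le_mul' le_rfl (hkx' x)
          · exact hge.comp_snd.mul hkm2.aemeasurable
    _ = 2 * (ENNReal.ofReal (((T * c) ^ m)⁻¹) * J) * ∫⁻ x in V, ‖g x‖ₑ ^ 2 ∂ν := by
        rw [lintegral_mul_const'' _ hge, hkJ]; ring
    _ ≤ _ := by
        refine mul_le_mul' ?_ le_rfl
        rw [← ENNReal.ofReal_toReal hJt, ← ENNReal.ofReal_mul (by positivity),
          show (2 : ℝ≥0∞) = ENNReal.ofReal 2 by simp, ← ENNReal.ofReal_mul (by positivity),
          ENNReal.toReal_ofReal ENNReal.toReal_nonneg]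
        refine ENNReal.ofReal_le_ofReal ?_
        rw [mul_pow, mul_inv]
        have : 0 ≤ (T ^ m)⁻¹ := by positivity
        nlinarith

end EnergySchur

section Initial

open scoped FourierTransform SchwartzMap

lemma sq_lintegral_mul_le {X : Type*} [MeasurableSpace X] {μ : Measure X} {w f : X → ℝ≥0∞}
    (hw : Measurable w) (hf : Measurable f) :
    (∫⁻ x, w x * f x ∂μ) ^ 2 ≤ (∫⁻ x, w x ∂μ) * ∫⁻ x, w x * f x ^ 2 ∂μ := by
  have h := ENNReal.lintegral_mul_le_Lp_mul_Lq (μ.withDensity w) Real.HolderConjugate.two_two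
    (f := fun _ => 1) (g := f) aemeasurable_const hf.aemeasurable
  simp only [Pi.mul_apply, one_mul, ENNReal.rpow_two] at h
  rw [lintegral_withDensity_eq_lintegral_mul _ hw hf,
    lintegral_withDensity_eq_lintegral_mul _ hw (hf.pow_const 2),
    lintegral_withDensity_eq_lintegral_mul _ hw measurable_const] at h
  simp only [Pi.mul_apply, one_pow, mul_one] at h
  have h2 := pow_le_pow_left₀ zero_le h 2
  have e : ∀ a : ℝ≥0∞, (a ^ (1 / 2 : ℝ)) ^ 2 = a := fun a => by
    rw [← ENNReal.rpow_two, ← ENNReal.rpow_mul]; norm_num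
  rwa [mul_pow, e, e] at h2

variable {ι : Type*} [Fintype ι]

lemma exists_schwartz_eq_one (N : ℝ) : ∃ χ : 𝓢(EuclideanSpace ℝ ι, ℂ),
    ∀ v : EuclideanSpace ℝ ι, (∀ i, |v i| ≤ N) → χ v = 1 := by
  set r := √(Fintype.card ι * N ^ 2) + 1 with hr
  have hr0 : 0 < r := by positivity
  let b : ContDiffBump (0 : EuclideanSpace ℝ ι) := ⟨r, r + 1, hr0, by linarith⟩
  have hs : HasCompactSupport fun t : EuclideanSpace ℝ ι => ((b t : ℝ) : ℂ) :=
    b.hasCompactSupport.comp_left (g := Complex.ofReal) Complex.ofReal_zero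
  have hd : ContDiff ℝ (⊤ : ℕ∞) fun t : EuclideanSpace ℝ ι => ((b t : ℝ) : ℂ) :=
    Complex.ofRealCLM.contDiff.comp b.contDiff
  refine ⟨hs.toSchwartzMap hd, fun v hv => ?_⟩
  have : b v = 1 := by
    refine b.one_of_mem_closedBall ?_
    rw [mem_closedBall_zero_iff, EuclideanSpace.norm_eq]
    refine le_trans (Real.sqrt_le_sqrt ?_) (le_add_of_nonneg_right zero_le_one)
    calc ∑ i, ‖v i‖ ^ 2 ≤ ∑ _i : ι, N ^ 2 := Finset.sum_le_sum fun i _ =>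
          pow_le_pow_left₀ (norm_nonneg _) (hv i) 2
      _ = _ := by simp
  simp [this]

lemma ker_le_ker_div {T : ℝ} (hT : 1 ≤ T) (a : ι → ℝ) : ker a ≤ ker (T⁻¹ • a) := by
  unfold ker cauchy
  refine Finset.prod_le_prod (fun i _ => by positivity) fun i _ => ?_
  simp only [Pi.smul_apply, smul_eq_mul]
  have : (T⁻¹ * a i) ^ 2 ≤ a i ^ 2 := by
    rw [mul_pow]
    exact mul_le_of_le_one_left (sq_nonneg _)
      (pow_le_one₀ (by positivity) (inv_le_one_of_one_le₀ hT))
  gcongr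

lemma one_le_pi_pow_mul_ker (a : ι → ℝ) :
    1 ≤ Real.pi ^ Fintype.card ι * (growth a * ker a) := by
  have h := ker_add_le a (-a)
  rw [growth_neg, add_neg_cancel] at h
  have h0 : ker (0 : ι → ℝ) = (Real.pi ^ Fintype.card ι)⁻¹ := by
    simp [ker, cauchy]
  rw [h0] at h
  calc (1 : ℝ) = Real.pi ^ Fintype.card ι * (Real.pi ^ Fintype.card ι)⁻¹ :=
        (mul_inv_cancel₀ (by positivity)).symm
    _ ≤ _ := by gcongr

lemma exists_enorm_schwartz_le (f : 𝓢(EuclideanSpace ℝ ι, ℂ)) : ∃ C > 0, ∀ η,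
    ‖f η‖ₑ ≤ ENNReal.ofReal (C * ker ((2 * Real.pi) • WithLp.ofLp η)) := by
  set d := Fintype.card ι with hd
  have hdec := fun η => SchwartzMap.one_add_le_sup_seminorm_apply (𝕜 := ℂ) (m := (2 * d, 0))
    le_rfl le_rfl f η
  simp only [norm_iteratedFDeriv_zero] at hdec
  set A := 2 ^ (2 * d) * ((Finset.Iic (2 * d, 0)).sup fun m => SchwartzMap.seminorm ℂ m.1 m.2) f
    with hA
  have hA0 : 0 ≤ A := by positivity
  refine ⟨(A + 1) * (Real.pi ^ d * (2 * (2 * Real.pi) ^ 2) ^ d), by positivity, fun η => ?_⟩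
  rw [← ofReal_norm]
  refine ENNReal.ofReal_le_ofReal ?_
  set a : ι → ℝ := (2 * Real.pi) • WithLp.ofLp η
  have h1 : growth a ≤ _ := growth_le_pow (a := a) (r := ‖η‖)
      (K := 2 * Real.pi) (norm_nonneg _) (by linarith [Real.pi_gt_three]) (fun i => by
        change |2 * Real.pi * η i| ≤ _
        rw [abs_mul, abs_of_pos Real.two_pi_pos]
        gcongr
        exact PiLp.norm_apply_le η i)
  have hk := ker_pos a
  calc ‖f η‖ ≤ ‖f η‖ * (Real.pi ^ d * (growth a * ker a)) :=
        le_mul_of_one_le_right (norm_nonneg _) (one_le_pi_pow_mul_ker a)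
    _ ≤ ‖f η‖ * (Real.pi ^ d * (((2 * (2 * Real.pi) ^ 2) ^ d * (1 + ‖η‖) ^ (2 * d)) * ker a)) := by
        gcongr
    _ = ((1 + ‖η‖) ^ (2 * d) * ‖f η‖) * (Real.pi ^ d * (2 * (2 * Real.pi) ^ 2) ^ d) * ker a := by
        ring
    _ ≤ (A + 1) * (Real.pi ^ d * (2 * (2 * Real.pi) ^ 2) ^ d) * ker a := by
        gcongr
        linarith [hdec η]

lemma lintegral_mul_ker_eq {f : (ι → ℝ) → ℝ≥0∞} (hf : Measurable f) {T : ℝ} (hT : 0 < T)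
    (y : ι → ℝ) :
    ∫⁻ η, f (y + (2 * Real.pi) • η) * ENNReal.ofReal (ker (T⁻¹ • (2 * Real.pi) • η)) =
      ENNReal.ofReal ((T / (2 * Real.pi)) ^ Fintype.card ι) * avg T f y := by
  set s := -(2 * Real.pi / T) with hs
  have hs0 : s ≠ 0 := by rw [hs]; exact neg_ne_zero.mpr (by positivity)
  have h := Measure.map_addHaar_smul (volume : Measure (ι → ℝ)) hs0
  have hm : Measurable fun b : ι → ℝ => f (y - T • b) * ENNReal.ofReal (ker b) :=
    (hf.comp (by fun_prop)).mul (ENNReal.measurable_ofReal.comp continuous_ker.measurable)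
  have h2 : ∫⁻ b, f (y - T • b) * ENNReal.ofReal (ker b) ∂(Measure.map (s • ·) volume) =
      ∫⁻ η, f (y + (2 * Real.pi) • η) * ENNReal.ofReal (ker (T⁻¹ • (2 * Real.pi) • η)) := by
    rw [lintegral_map hm (by fun_prop)]
    refine lintegral_congr fun η => ?_
    have e1 : T * s = -(2 * Real.pi) := by rw [hs]; field_simp
    have e2 : s • η = -(T⁻¹ • (2 * Real.pi) • η) := by
      rw [smul_smul, ← neg_smul, hs]; congr 1; field_simp
    rw [smul_smul, e1, neg_smul, sub_neg_eq_add, e2, ker_neg]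
  have hf2 : Measurable fun b : ι → ℝ => f (y - T • b) := hf.comp (by fun_prop)
  rw [← h2, h, lintegral_smul_measure, avg, lintegral_kerMeas hf2, smul_eq_mul]
  congr 2
  rw [Module.finrank_fintype_fun_eq_card, ← inv_pow, abs_pow, hs, abs_inv, abs_neg,
    abs_of_pos (by positivity), inv_div]

lemma exists_enorm_tauExt_sq_le (ι : Type*) [Fintype ι] (X : Type*) [MeasurableSpace X] (N : ℝ) :
    ∃ C > 0, ∀ (μ : Measure X) [SFinite μ] (τ : X → ι → ℝ) (g : X → ℂ) (T : ℝ),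
      AEMeasurable τ μ → Integrable g μ → (∀ᵐ x ∂μ, ∀ i, |τ x i| ≤ N) → 1 ≤ T → ∀ y,
      ‖tauExt μ τ g y‖ₑ ^ 2 ≤ ENNReal.ofReal (C * T ^ Fintype.card ι) *
        avg T (fun y => ‖tauExt μ τ g y‖ₑ ^ 2) y := by
  obtain ⟨χ, hχ⟩ := exists_schwartz_eq_one (ι := ι) N
  obtain ⟨C, hC, hdec⟩ := exists_enorm_schwartz_le (𝓕 χ)
  set B := ∫ η, ‖𝓕 χ η‖ with hB
  have hBi : ∫⁻ η, ‖𝓕 χ η‖ₑ = ENNReal.ofReal B := by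
    rw [hB, ofReal_integral_norm_eq_lintegral_enorm (𝓕 χ).integrable]
  have hB0 : 0 ≤ B := integral_nonneg fun _ => norm_nonneg _
  refine ⟨(B + 1) * (C * ((2 * Real.pi)⁻¹) ^ Fintype.card ι), by positivity,
    fun μ _ τ g T hτ hg hN hT y => ?_⟩
  have hT0 : 0 < T := by linarith
  set u := tauExt μ τ g with hu
  have huc : Continuous u := continuous_tauExt hτ hg
  have hmu : Measurable fun y => ‖u y‖ₑ ^ 2 := huc.measurable.enorm.pow_const 2
  have hφ : AEMeasurable (fun x => WithLp.toLp 2 (τ x)) μ :=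
    (PiLp.continuous_toLp 2 _).measurable.comp_aemeasurable hτ
  have hrep : u y = ∫ η, 𝓕 χ η * u (y + (2 * Real.pi) • WithLp.ofLp η) := by
    have h := integral_fourier_mul_osc χ hφ (aemeasurable_phase hτ y) hg
    have e1 : u y = osc μ (fun x => ∑ k, y k * τ x k)
        (fun x => χ (WithLp.toLp 2 (τ x)) * g x) := by
      rw [hu]
      unfold tauExt osc
      refine integral_congr_ae ?_
      filter_upwards [hN] with x hx
      rw [hχ _ hx, one_mul]
    rw [e1, ← h]
    refine integral_congr_ae (Filter.Eventually.of_forall fun η => ?_)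
    simp only [hu, tauExt]
    congr 2
    ext x
    simp only [Pi.add_apply, Pi.smul_apply, smul_eq_mul, add_mul, Finset.sum_add_distrib,
      PiLp.inner_apply, Real.inner_apply, Finset.mul_sum]
    congr 1
    refine Finset.sum_congr rfl fun i _ => ?_
    ring
  have hm1 : Measurable fun η : EuclideanSpace ℝ ι => ‖𝓕 χ η‖ₑ :=
    (𝓕 χ).continuous.measurable.enorm
  have hc2 : Continuous fun η : EuclideanSpace ℝ ι => u (y + (2 * Real.pi) • WithLp.ofLp η) :=
    huc.comp (by fun_prop)
  calc ‖u y‖ₑ ^ 2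
      ≤ (∫⁻ η, ‖𝓕 χ η‖ₑ * ‖u (y + (2 * Real.pi) • WithLp.ofLp η)‖ₑ) ^ 2 := by
        gcongr
        rw [hrep]
        refine (enorm_integral_le_lintegral_enorm _).trans_eq ?_
        simp only [enorm_mul]
    _ ≤ ENNReal.ofReal B *
        ∫⁻ η, ‖𝓕 χ η‖ₑ * ‖u (y + (2 * Real.pi) • WithLp.ofLp η)‖ₑ ^ 2 := by
        rw [← hBi]
        exact sq_lintegral_mul_le hm1 hc2.measurable.enorm
    _ ≤ ENNReal.ofReal (B + 1) * ∫⁻ η : EuclideanSpace ℝ ι, ENNReal.ofReal C *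
          (‖u (y + (2 * Real.pi) • WithLp.ofLp η)‖ₑ ^ 2 *
            ENNReal.ofReal (ker (T⁻¹ • (2 * Real.pi) • WithLp.ofLp η))) := by
        refine mul_le_mul' (ENNReal.ofReal_le_ofReal (by linarith)) (lintegral_mono fun η => ?_)
        rw [mul_left_comm, ← ENNReal.ofReal_mul hC.le, mul_comm]
        refine mul_le_mul' le_rfl ((hdec η).trans (ENNReal.ofReal_le_ofReal ?_))
        exact mul_le_mul_of_nonneg_left (ker_le_ker_div hT _) hC.le
    _ = ENNReal.ofReal (B + 1) * (ENNReal.ofReal C *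
          ∫⁻ η : ι → ℝ, ‖u (y + (2 * Real.pi) • η)‖ₑ ^ 2 *
            ENNReal.ofReal (ker (T⁻¹ • (2 * Real.pi) • η))) := by
        have hm3 : Measurable fun η : ι → ℝ => ‖u (y + (2 * Real.pi) • η)‖ₑ ^ 2 *
            ENNReal.ofReal (ker (T⁻¹ • (2 * Real.pi) • η)) :=
          (hmu.comp (g := fun y => ‖u y‖ₑ ^ 2) (f := fun η : ι → ℝ => y + (2 * Real.pi) • η)
            (by fun_prop)).mul (ENNReal.measurable_ofReal.comp
            (continuous_ker.measurable.comp (by fun_prop)))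
        have hm4 : Measurable fun η : EuclideanSpace ℝ ι =>
            ‖u (y + (2 * Real.pi) • WithLp.ofLp η)‖ₑ ^ 2 *
              ENNReal.ofReal (ker (T⁻¹ • (2 * Real.pi) • WithLp.ofLp η)) :=
          hm3.comp (PiLp.volume_preserving_ofLp ι).measurable
        rw [← (PiLp.volume_preserving_ofLp ι).lintegral_comp hm3, lintegral_const_mul _ hm4]
    _ = _ := by
        rw [lintegral_mul_ker_eq (f := fun y => ‖u y‖ₑ ^ 2) hmu hT0, ← mul_assoc, ← mul_assoc,
          ← ENNReal.ofReal_mul (by positivity), ← ENNReal.ofReal_mul (by positivity)]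
        congr 2
        rw [div_eq_mul_inv, mul_pow]
        ring

end Initial

section Multiscale

variable {ι : Type*} [Fintype ι] [DecidableEq ι]

lemma avg_update_le_of_update_le {S θ : ℝ} {i : ι} {f : (ι → ℝ) → ℝ≥0∞}
    (h : ∀ y t, f (Function.update y i t) ≤ ENNReal.ofReal (Real.exp (θ * |t - y i|)) * f y)
    (y : ι → ℝ) (t : ℝ) :
    avg S f (Function.update y i t) ≤ ENNReal.ofReal (Real.exp (θ * |t - y i|)) * avg S f y := by
  unfold avg
  rw [← lintegral_const_mul' _ _ ENNReal.ofReal_ne_top]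
  refine lintegral_mono fun b => ?_
  have e : Function.update y i t - S • b = Function.update (y - S • b) i (t - S * b i) := by
    ext k
    by_cases hk : k = i
    · subst hk; simp
    · simp [hk]
  have h2 := h (y - S • b) (t - S * b i)
  rw [e]
  simpa using h2

/-- Iterating the averaging inequality over the dyadic scales `S, 2 S, …, 2 ^ m * S`. -/
lemma setLIntegral_prod_avg_rpow_le {n : ℕ} (hn : 1 ≤ n) (hι : Fintype.card ι = n + 1)
    {δ S₀ L : ℝ} (hδ : 0 ≤ δ) (hL : 1 < L) (hS₀ : 0 < S₀) (e : ι → ℝ → ℝ≥0∞) (m : ℕ) :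
    ∀ (S ρ : ℝ) (f : ι → (ι → ℝ) → ℝ≥0∞), S₀ ≤ S → (∀ i, Measurable (f i)) →
    (∀ i T, S₀ ≤ T → ∀ y t, avg T (f i) (Function.update y i t) ≤
      ENNReal.ofReal (Real.exp (δ / T * |t - y i|)) * avg T (f i) y) →
    (∀ i T, 0 < T → ∀ y, avg T (f i) y ≤ e i T) →
    ∫⁻ y in closedBall 0 ρ, ∏ i, avg S (f i) y ^ (1 / n : ℝ) ≤
      (ENNReal.ofReal ((1 - 1 / L)⁻¹ * Real.exp (4 * δ * L)) ^ (2 * (n + 1))) ^ m *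
      ∫⁻ _y in closedBall (0 : ι → ℝ) (ρ + (2 ^ (m + 1) - 2) * S * L),
        ∏ i, e i (2 ^ m * S) ^ (1 / n : ℝ) := by
  induction m with
  | zero =>
    intro S ρ f hS hf hdir hen
    simp only [pow_zero, one_mul, zero_add, pow_one, sub_self, zero_mul, add_zero]
    refine lintegral_mono fun y => Finset.prod_le_prod' fun i _ => ?_
    exact ENNReal.rpow_le_rpow (hen i S (hS₀.trans_le hS) y) (by positivity)
  | succ m ih =>
    intro S ρ f hS hf hdir hen
    have hS0 : 0 < S := hS₀.trans_le hS
    have hm : ∀ i, Measurable (avg S (f i)) := fun i => measurable_avg S (hf i)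
    have step := setLIntegral_prod_rpow_le_avg hn hι (S := 2 * S) (L := L) (θ := δ / S)
      (ρ := ρ) (by positivity) hL (by positivity) (fun i => avg S (f i)) hm
      (fun i y t => hdir i S hS y t)
    have e1 : 2 * (δ / S * (2 * S * L)) = 4 * δ * L := by field_simp; ring
    rw [e1] at step
    refine step.trans ?_
    rw [pow_succ', mul_assoc (_ ^ (2 * (n + 1)))]
    refine mul_le_mul' le_rfl ?_
    have h := ih (2 * S) (ρ + 2 * S * L) (fun i => avg S (f i)) (by linarith) hm
      (fun i T hT y t => by
        rw [avg_comm T S (hf i)]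
        exact avg_update_le_of_update_le (hdir i T hT) y t)
      (fun i T hT y => by
        rw [avg_comm T S (hf i)]
        exact avg_le_of_le (hen i T hT) y)
    have e2 : ρ + 2 * S * L + (2 ^ (m + 1) - 2) * (2 * S) * L
        = ρ + (2 ^ (m + 1 + 1) - 2) * S * L := by ring
    have e3 : (2 : ℝ) ^ m * (2 * S) = 2 ^ (m + 1) * S := by ring
    rw [e2, e3] at h
    exact h

lemma inv_one_sub_le_exp {x : ℝ} (h0 : 0 ≤ x) (h : x ≤ 1 / 2) : (1 - x)⁻¹ ≤ Real.exp (2 * x) := by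
  rw [inv_le_comm₀ (by linarith) (Real.exp_pos _), ← Real.exp_neg]
  have h1 := Real.add_one_le_exp (2 * x)
  rw [Real.exp_neg, inv_le_comm₀ (Real.exp_pos _) (by linarith)]
  refine le_trans ?_ h1
  rw [inv_le_iff_one_le_mul₀ (by linarith)]
  nlinarith

lemma pow_step_factor_le {k m : ℕ} {Λ δ C : ℝ} (hΛ : 1 ≤ Λ) (hδ : 0 ≤ δ)
    (hδC : δ * Λ ^ 2 ≤ C) (hm : m ≤ 2 * Λ) :
    (ENNReal.ofReal ((1 - 1 / (2 * Λ))⁻¹ * Real.exp (4 * δ * (2 * Λ))) ^ k) ^ m ≤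
      ENNReal.ofReal (Real.exp ((2 + 16 * C) * k)) := by
  have hΛ0 : 0 < Λ := by linarith
  have h1 : (1 - 1 / (2 * Λ))⁻¹ * Real.exp (4 * δ * (2 * Λ)) ≤
      Real.exp (1 / Λ + 8 * δ * Λ) := by
    rw [Real.exp_add]
    have h2 := inv_one_sub_le_exp (x := 1 / (2 * Λ)) (by positivity) (by
      rw [div_le_div_iff₀ (by positivity) (by positivity)]; linarith)
    have e : 2 * (1 / (2 * Λ)) = 1 / Λ := by field_simp
    rw [e] at h2
    have e2 : 4 * δ * (2 * Λ) = 8 * δ * Λ := by ring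
    rw [e2]
    gcongr
  calc (ENNReal.ofReal ((1 - 1 / (2 * Λ))⁻¹ * Real.exp (4 * δ * (2 * Λ))) ^ k) ^ m
      ≤ (ENNReal.ofReal (Real.exp (1 / Λ + 8 * δ * Λ)) ^ k) ^ m := by gcongr
    _ = ENNReal.ofReal (Real.exp ((m * (1 / Λ + 8 * δ * Λ)) * k)) := by
        rw [← pow_mul, ← ENNReal.ofReal_pow (Real.exp_pos _).le, ← Real.exp_nat_mul]
        push_cast
        congr 2
        ring
    _ ≤ _ := by
        gcongr
        have h0 : 0 ≤ 1 / Λ + 8 * δ * Λ := by positivity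
        calc (m : ℝ) * (1 / Λ + 8 * δ * Λ) ≤ 2 * Λ * (1 / Λ + 8 * δ * Λ) := by gcongr
          _ = 2 + 16 * (δ * Λ ^ 2) := by field_simp; ring
          _ ≤ _ := by linarith

lemma exists_two_pow_ge {R : ℝ} (hR : 1 ≤ R) :
    ∃ m : ℕ, R ≤ 2 ^ m ∧ (m : ℝ) ≤ 2 * (1 + Real.log R) := by
  have h0 : 0 ≤ Real.log R := Real.log_nonneg hR
  have h2 : 1 / 2 ≤ Real.log 2 := by linarith [Real.log_two_gt_d9]
  have hq : 0 ≤ Real.logb 2 R := Real.logb_nonneg one_lt_two hR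
  refine ⟨⌈Real.logb 2 R⌉₊, ?_, ?_⟩
  · calc R = (2 : ℝ) ^ Real.logb 2 R :=
          (Real.rpow_logb two_pos (by norm_num) (by linarith)).symm
      _ ≤ (2 : ℝ) ^ ((⌈Real.logb 2 R⌉₊ : ℕ) : ℝ) :=
          Real.rpow_le_rpow_of_exponent_le one_le_two (Nat.le_ceil _)
      _ = _ := Real.rpow_natCast _ _
  · have h3 : Real.logb 2 R ≤ 2 * Real.log R := by
      rw [Real.logb, div_le_iff₀ (by linarith)]
      nlinarith
    linarith [Nat.ceil_lt_add_one hq]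

lemma prod_mul_rpow_le {n : ℕ} (hn : 1 ≤ n) (hι : Fintype.card ι = n + 1) {a : ℝ}
    (ha : 1 ≤ a) (G : ι → ℝ≥0∞) :
    ∏ i, (ENNReal.ofReal a * G i) ^ (1 / n : ℝ) ≤
      ENNReal.ofReal (a ^ (n + 1)) * ∏ i, G i ^ (1 / n : ℝ) := by
  have hn1 : (1 : ℝ) ≤ n := by exact_mod_cast hn
  have h1 : ENNReal.ofReal a ^ (1 / n : ℝ) ≤ ENNReal.ofReal a := by
    conv_rhs => rw [← ENNReal.rpow_one (ENNReal.ofReal a)]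
    refine ENNReal.rpow_le_rpow_of_exponent_le (by simpa using ha) ?_
    rw [div_le_one (by linarith)]
    exact hn1
  calc _ = ∏ i, ENNReal.ofReal a ^ (1 / n : ℝ) * G i ^ (1 / n : ℝ) :=
        Finset.prod_congr rfl fun i _ => ENNReal.mul_rpow_of_nonneg _ _ (by positivity)
    _ ≤ ∏ i, ENNReal.ofReal a * G i ^ (1 / n : ℝ) := Finset.prod_le_prod' fun i _ => by gcongr
    _ = _ := by
      rw [Finset.prod_mul_distrib, Finset.prod_const, Finset.card_univ, hι,
        ENNReal.ofReal_pow (by linarith)]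

lemma setLIntegral_prod_rpow_le_of_scales {n : ℕ} (hn : 1 ≤ n) (hι : Fintype.card ι = n + 1)
    {δ S₀ A B C D R : ℝ} (hR : 1 ≤ R) (hδ : 0 ≤ δ) (hS₀ : 1 ≤ S₀) (hA : 1 ≤ A) (hB : 0 ≤ B)
    (hD : 1 ≤ D) (hδC : δ * (1 + Real.log R) ^ 2 ≤ C)
    (f : ι → (ι → ℝ) → ℝ≥0∞) (G : ι → ℝ≥0∞) (hf : ∀ i, Measurable (f i))
    (hdir : ∀ i T, S₀ ≤ T → ∀ y t, avg T (f i) (Function.update y i t) ≤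
      ENNReal.ofReal (Real.exp (δ / T * |t - y i|)) * avg T (f i) y)
    (hinit : ∀ i y, f i y ≤ ENNReal.ofReal (A * S₀ ^ (n + 1)) * avg S₀ (f i) y)
    (hen : ∀ i T, 0 < T → ∀ y, avg T (f i) y ≤ ENNReal.ofReal (D * (T ^ n)⁻¹) * G i) :
    ∫⁻ y in closedBall 0 (B * R), ∏ i, f i y ^ (1 / n : ℝ) ≤
      ENNReal.ofReal ((A * S₀ ^ (n + 1)) ^ (n + 1) * (Real.exp ((2 + 16 * C) * (2 * (n + 1))) *
        (D * (2 * ((B + 4) * (1 + Real.log R)))) ^ (n + 1))) * ∏ i, G i ^ (1 / n : ℝ) := by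
  set Λ := 1 + Real.log R with hΛd
  have hΛ : 1 ≤ Λ := by linarith [Real.log_nonneg hR]
  have hΛ0 : 0 < Λ := by linarith
  have hn0 : n ≠ 0 := by omega
  obtain ⟨m, hm1, hm2⟩ := exists_two_pow_ge hR
  set Q := 2 ^ m * S₀ with hQ
  have hQ0 : 0 < Q := by positivity
  have ha : 1 ≤ A * S₀ ^ (n + 1) := one_le_mul_of_one_le_of_one_le hA (one_le_pow₀ hS₀)
  have h1 := setLIntegral_prod_avg_rpow_le hn hι (L := 2 * Λ) hδ (by linarith)
    (by linarith : 0 < S₀) (fun i T => ENNReal.ofReal (D * (T ^ n)⁻¹) * G i) m S₀ (B * R) f le_rfl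
    hf hdir hen
  have hΓ := pow_step_factor_le (k := 2 * (n + 1)) hΛ hδ hδC hm2
  push_cast at hΓ
  have hprodQ : ∏ i, (ENNReal.ofReal (D * (Q ^ n)⁻¹) * G i) ^ (1 / n : ℝ) ≤
      ENNReal.ofReal ((D * Q⁻¹) ^ (n + 1)) * ∏ i, G i ^ (1 / n : ℝ) := by
    have e : ∀ i, (ENNReal.ofReal (D * (Q ^ n)⁻¹) * G i) ^ (1 / n : ℝ) =
        ENNReal.ofReal Q⁻¹ * (ENNReal.ofReal D * G i) ^ (1 / n : ℝ) := fun i => by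
      rw [mul_comm D, ENNReal.ofReal_mul (by positivity), mul_assoc,
        ENNReal.mul_rpow_of_nonneg _ _ (by positivity), ← inv_pow,
        ENNReal.ofReal_pow (by positivity), ← ENNReal.rpow_natCast, ← ENNReal.rpow_mul,
        mul_one_div_cancel (by exact_mod_cast hn0), ENNReal.rpow_one]
    simp_rw [e]
    rw [Finset.prod_mul_distrib, Finset.prod_const, Finset.card_univ, hι, mul_comm D, mul_pow,
      ENNReal.ofReal_mul (by positivity), ← ENNReal.ofReal_pow (by positivity), mul_assoc]
    exact mul_le_mul' le_rfl (prod_mul_rpow_le hn hι hD G)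
  have hvol : volume (closedBall (0 : ι → ℝ) (B * R + (2 ^ (m + 1) - 2) * S₀ * (2 * Λ))) ≤
      ENNReal.ofReal ((2 * ((B + 4) * Λ) * Q) ^ (n + 1)) := by
    have hp : (2 : ℝ) ≤ 2 ^ (m + 1) := by
      rw [pow_succ]; linarith [one_le_pow₀ (M₀ := ℝ) one_le_two (n := m)]
    have hle : B * R + (2 ^ (m + 1) - 2) * S₀ * (2 * Λ) ≤ (B + 4) * Λ * Q := by
      have h1 : R ≤ Λ * Q := by
        calc R ≤ 2 ^ m := hm1
          _ ≤ Q := le_mul_of_one_le_right (by positivity) hS₀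
          _ ≤ Λ * Q := le_mul_of_one_le_left hQ0.le hΛ
      calc B * R + (2 ^ (m + 1) - 2) * S₀ * (2 * Λ)
          ≤ B * (Λ * Q) + (2 ^ (m + 1)) * S₀ * (2 * Λ) := by gcongr; linarith
        _ = _ := by rw [hQ]; ring
    have h0 : 0 ≤ B * R + (2 ^ (m + 1) - 2) * S₀ * (2 * Λ) := by
      have := sub_nonneg.mpr hp
      positivity
    rw [Real.volume_pi_closedBall _ h0, hι]
    refine ENNReal.ofReal_le_ofReal (pow_le_pow_left₀ (by positivity) ?_ _)
    linarith
  calc ∫⁻ y in closedBall 0 (B * R), ∏ i, f i y ^ (1 / n : ℝ)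
      ≤ ∫⁻ y in closedBall 0 (B * R), ENNReal.ofReal ((A * S₀ ^ (n + 1)) ^ (n + 1)) *
          ∏ i, avg S₀ (f i) y ^ (1 / n : ℝ) := by
        refine lintegral_mono fun y => le_trans ?_ (prod_mul_rpow_le hn hι ha _)
        exact Finset.prod_le_prod' fun i _ =>
          ENNReal.rpow_le_rpow (hinit i y) (by positivity)
    _ = ENNReal.ofReal ((A * S₀ ^ (n + 1)) ^ (n + 1)) *
          ∫⁻ y in closedBall 0 (B * R), ∏ i, avg S₀ (f i) y ^ (1 / n : ℝ) :=
        lintegral_const_mul' _ _ ENNReal.ofReal_ne_top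
    _ ≤ ENNReal.ofReal ((A * S₀ ^ (n + 1)) ^ (n + 1)) *
          (ENNReal.ofReal (Real.exp ((2 + 16 * C) * (2 * (n + 1)))) *
          ((ENNReal.ofReal ((D * Q⁻¹) ^ (n + 1)) * ∏ i, G i ^ (1 / n : ℝ)) *
            ENNReal.ofReal ((2 * ((B + 4) * Λ) * Q) ^ (n + 1)))) := by
        refine mul_le_mul' le_rfl (h1.trans (mul_le_mul' hΓ ?_))
        rw [setLIntegral_const]
        exact mul_le_mul' hprodQ hvol
    _ = _ := by
        rw [mul_right_comm, ← ENNReal.ofReal_mul (by positivity), ← mul_pow, ← mul_assoc,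
          ← mul_assoc, ← ENNReal.ofReal_mul (by positivity), ← ENNReal.ofReal_mul (by positivity)]
        congr 2
        rw [mul_assoc]
        congr 3
        field_simp

end Multiscale

section Geometry

open scoped SchwartzMap Topology ContDiff

variable {V E : Type*} [NormedAddCommGroup V] [InnerProductSpace ℝ V]
  [NormedAddCommGroup E] [InnerProductSpace ℝ E]

/-- The parametrisation `S`, thickened in the direction `e`. -/
noncomputable def thicken (S : V → E) (e : E) (p : V × ℝ) : E := S p.1 + p.2 • e

/-- The derivative of `thicken S e` when `S` has derivative `A`. -/
noncomputable def thickenDeriv (A : V →L[ℝ] E) (e : E) : V × ℝ →L[ℝ] E :=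
  A.comp (ContinuousLinearMap.fst ℝ V ℝ) + (ContinuousLinearMap.snd ℝ V ℝ).smulRight e

lemma contDiff_thicken {S : V → E} (hS : ContDiff ℝ ∞ S) (e : E) :
    ContDiff ℝ ∞ (thicken S e) := by
  unfold thicken
  fun_prop

lemma hasFDerivAt_thicken {S : V → E} (hS : ContDiff ℝ ∞ S) (e : E) (p : V × ℝ) :
    HasFDerivAt (thicken S e) (thickenDeriv (fderiv ℝ S p.1) e) p := by
  have h1 : HasFDerivAt S (fderiv ℝ S p.1) p.1 :=
    (hS.differentiable (by simp) p.1).hasFDerivAt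
  exact (h1.comp p hasFDerivAt_fst).add (hasFDerivAt_snd.smul_const e)

lemma continuous_thickenDeriv {S : V → E} (hS : ContDiff ℝ ∞ S) (e : E) :
    Continuous fun p : V × ℝ => thickenDeriv (fderiv ℝ S p.1) e := by
  have h : Continuous (fderiv ℝ S) := hS.continuous_fderiv (by simp)
  unfold thickenDeriv
  fun_prop

lemma contDiff_of_forall_mem_tsupport {f : E → ℂ} (h : ∀ x ∈ tsupport f, ContDiffAt ℝ ∞ f x) :
    ContDiff ℝ ∞ f := by
  rw [contDiff_iff_contDiffAt]
  intro x
  by_cases hx : x ∈ tsupport f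
  · exact h x hx
  · have : f =ᶠ[𝓝 x] fun _ => 0 := by
      filter_upwards [(isClosed_tsupport f).isOpen_compl.mem_nhds hx] with y hy
      exact image_eq_zero_of_notMem_tsupport hy
    exact contDiffAt_const.congr_of_eventuallyEq this

variable [FiniteDimensional ℝ V] [FiniteDimensional ℝ E]

lemma exists_equiv_eq_thickenDeriv (hdim : Module.finrank ℝ E = Module.finrank ℝ V + 1)
    {A : V →L[ℝ] E} (hA : Function.Injective A) {e : E} (he : ‖e‖ = 1)
    (hperp : ∀ v, ⟪e, A v⟫_ℝ = 0) :
    ∃ Ψ : (V × ℝ) ≃L[ℝ] E, (Ψ : V × ℝ →L[ℝ] E) = thickenDeriv A e := by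
  have hinj : Function.Injective (thickenDeriv A e : V × ℝ →ₗ[ℝ] E) := by
    rw [← LinearMap.ker_eq_bot, LinearMap.ker_eq_bot']
    rintro ⟨v, s⟩ h
    have h' : A v + s • e = 0 := h
    have hs : s = 0 := by
      have := congrArg (fun w => ⟪e, w⟫_ℝ) h'
      simpa [inner_add_right, hperp, inner_smul_right, he] using this
    subst hs
    rw [zero_smul, add_zero] at h'
    rw [hA (h'.trans (map_zero A).symm)]
    rfl
  have hd : Module.finrank ℝ (V × ℝ) = Module.finrank ℝ E := by
    rw [hdim, Module.finrank_prod, Module.finrank_self]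
  refine ⟨(LinearMap.linearEquivOfInjective _ hinj hd).toContinuousLinearEquiv, ?_⟩
  ext x <;> rfl

/-- Near a point where `S` is immersive, the image of `S` is the zero set of the last coordinate
of a smooth chart; this coordinate is extended to a Schwartz function. -/
lemma exists_defining_function (hdim : Module.finrank ℝ E = Module.finrank ℝ V + 1)
    {S : V → E} (hS : ContDiff ℝ ∞ S) {z : V} (hA : Function.Injective (fderiv ℝ S z)) {e : E}
    (he : ‖e‖ = 1) (hperp : ∀ v, ⟪e, fderiv ℝ S z v⟫_ℝ = 0) :
    ∃ ρ : 𝓢(E, ℂ), (∀ᶠ x in 𝓝 z, ρ (S x) = 0 ∧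
      (fderiv ℝ ρ (S x)).comp (thickenDeriv (fderiv ℝ S x) e) =
        Complex.ofRealCLM.comp (ContinuousLinearMap.snd ℝ V ℝ)) ∧
      ∃ K : NNReal, ∀ᶠ p in 𝓝 (z, z), ‖p.1 - p.2‖ ≤ K * ‖S p.1 - S p.2‖ := by
  obtain ⟨Ψ, hΨ⟩ := exists_equiv_eq_thickenDeriv hdim hA he hperp
  set F := thicken S e with hF
  have hFc : ContDiff ℝ ∞ F := contDiff_thicken hS e
  have hD := hasFDerivAt_thicken hS e
  have hDz : HasFDerivAt F (Ψ : V × ℝ →L[ℝ] E) (z, 0) := hΨ ▸ hD (z, 0)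
  have hF0 : ∀ x, F (x, 0) = S x := fun x => by simp [hF, thicken]
  let Φ := hFc.contDiffAt.toOpenPartialHomeomorph F hDz (by simp)
  have hΦ : ∀ p, Φ p = F p := fun p => rfl
  have hsrc : (z, (0 : ℝ)) ∈ Φ.source :=
    hFc.contDiffAt.mem_toOpenPartialHomeomorph_source hDz (by simp)
  have hSz : S z ∈ Φ.target := by rw [← hF0]; exact Φ.map_source hsrc
  have hsymm : Φ.symm (S z) = (z, 0) := by rw [← hF0]; exact Φ.left_inv hsrc
  -- the inverse chart is smooth near `S z`
  have hsm : ∀ᶠ ξ in 𝓝 (S z), ξ ∈ Φ.target ∧ ContDiffAt ℝ ∞ Φ.symm ξ := by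
    have h1 : ∀ᶠ p in 𝓝 (z, (0 : ℝ)), thickenDeriv (fderiv ℝ S p.1) e ∈
        Set.range ((↑) : ((V × ℝ) ≃L[ℝ] E) → (V × ℝ →L[ℝ] E)) := by
      refine (continuous_thickenDeriv hS e).continuousAt.eventually ?_
      have := ContinuousLinearEquiv.nhds Ψ
      rw [hΨ] at this
      exact this
    have h2 : Filter.Tendsto Φ.symm (𝓝 (S z)) (𝓝 (z, 0)) := by
      have := Φ.continuousAt_symm hSz
      rwa [ContinuousAt, hsymm] at this
    filter_upwards [h2.eventually h1, Φ.open_target.mem_nhds hSz] with ξ ⟨B, hB⟩ hξ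
    refine ⟨hξ, Φ.contDiffAt_symm hξ (f₀' := B) ?_ hFc.contDiffAt⟩
    rw [hB]
    exact hD _
  obtain ⟨r, hr0, hr⟩ := Metric.eventually_nhds_iff_ball.mp hsm
  let b : ContDiffBump (S z) := ⟨r / 4, r / 2, by linarith, by linarith⟩
  let h : E → ℂ := fun ξ => ((b ξ * (Φ.symm ξ).2 : ℝ) : ℂ)
  have hts : tsupport h ⊆ tsupport b := by
    refine closure_mono fun ξ hξ => ?_
    rw [Function.mem_support] at hξ ⊢
    exact fun h0 => hξ (by simp [h, h0])
  have hcs : HasCompactSupport h := b.hasCompactSupport.of_isClosed_subset (isClosed_tsupport _) hts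
  have hcd : ContDiff ℝ ∞ h := contDiff_of_forall_mem_tsupport fun ξ hξ => by
    have hξ2 := hts hξ
    rw [b.tsupport_eq] at hξ2
    have h3 := (hr ξ (closedBall_subset_ball (by show r / 2 < r; linarith) hξ2)).2
    exact Complex.ofRealCLM.contDiff.contDiffAt.comp ξ
      (b.contDiff.contDiffAt.mul (contDiff_snd.contDiffAt.comp ξ h3))
  have hSc : Continuous S := hS.continuous
  refine ⟨hcs.toSchwartzMap hcd, ?_, ?_⟩
  · have hev : ∀ᶠ p in 𝓝 (z, (0 : ℝ)), h (F p) = (p.2 : ℂ) := by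
      have h4 : ∀ᶠ p in 𝓝 (z, (0 : ℝ)), F p ∈ ball (S z) (r / 4) := by
        refine hFc.continuous.continuousAt.eventually (isOpen_ball.mem_nhds ?_)
        rw [hF0]
        exact mem_ball_self (by linarith)
      filter_upwards [h4, Φ.open_source.mem_nhds hsrc] with p hp hps
      have h5 : b (F p) = 1 := b.one_of_mem_closedBall (ball_subset_closedBall hp)
      have h6 : Φ.symm (F p) = p := Φ.left_inv hps
      simp [h, h5, h6]
    have hpr : Filter.Tendsto (fun x : V => (x, (0 : ℝ))) (𝓝 z) (𝓝 (z, 0)) :=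
      (Continuous.prodMk_left (0 : ℝ)).continuousAt
    filter_upwards [hpr.eventually hev.eventually_nhds] with x hx
    refine ⟨by simpa [hF0] using hx.self_of_nhds, ?_⟩
    have h7 : HasFDerivAt (fun p => h (F p))
        ((fderiv ℝ h (S x)).comp (thickenDeriv (fderiv ℝ S x) e)) (x, (0 : ℝ)) := by
      have := (hcd.differentiable (by simp) (S x)).hasFDerivAt
      rw [← hF0] at this
      exact (hF0 x ▸ this.comp (x, (0 : ℝ)) (hD (x, 0)) :)
    have h8 : HasFDerivAt (fun p : V × ℝ => (p.2 : ℂ))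
        (Complex.ofRealCLM.comp (ContinuousLinearMap.snd ℝ V ℝ)) (x, (0 : ℝ)) :=
      Complex.ofRealCLM.hasFDerivAt.comp (x, (0 : ℝ)) hasFDerivAt_snd
    exact h7.unique (h8.congr_of_eventuallyEq hx)
  · obtain ⟨K, t, ht, hK⟩ := ((hsm.self_of_nhds.2).of_le (m := 1) (by simp)).exists_lipschitzOnWith
    refine ⟨K, ?_⟩
    have h9 : ∀ᶠ x in 𝓝 z, S x ∈ t ∧ Φ.symm (S x) = (x, 0) := by
      have hpr : Filter.Tendsto (fun x : V => (x, (0 : ℝ))) (𝓝 z) (𝓝 (z, 0)) :=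
        (Continuous.prodMk_left (0 : ℝ)).continuousAt
      filter_upwards [hSc.continuousAt.eventually ht,
        hpr.eventually (Φ.open_source.mem_nhds hsrc)] with x hx1 hx2
      refine ⟨hx1, ?_⟩
      rw [← hF0]
      exact Φ.left_inv hx2
    rw [nhds_prod_eq]
    filter_upwards [h9.prod_mk h9] with p hp
    have := hK.norm_sub_le hp.1.1 hp.2.1
    rw [hp.1.2, hp.2.2] at this
    refine le_trans ?_ this
    rw [Prod.mk_sub_mk, Prod.norm_def]
    exact le_max_left _ _

end Geometry

section Pieces

open scoped SchwartzMap Topology ContDiff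

/-- The three estimates on `f` which drive the induction on scales: averages at scale at least
`1 / ε` vary slowly in the `j`-th direction, `f` is bounded by its averages, and the averages are
bounded by the energy `G`. -/
structure ScaleBounds {ι : Type*} [Fintype ι] [DecidableEq ι] (n : ℕ) (j : ι) (C ε : ℝ)
    (f : (ι → ℝ) → ℝ≥0∞) (G : ℝ≥0∞) : Prop where
  update_le : ∀ T, 1 / ε ≤ T → ∀ y t, avg T f (Function.update y j t) ≤
    ENNReal.ofReal (Real.exp (C * ε / T * |t - y j|)) * avg T f y
  le_avg : ∀ T, 1 ≤ T → ∀ y, f y ≤ ENNReal.ofReal (C * T ^ (n + 1)) * avg T f y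
  avg_le : ∀ T, 0 < T → ∀ y, avg T f y ≤ ENNReal.ofReal (C * (T ^ n)⁻¹) * G

lemma ScaleBounds.mono {ι : Type*} [Fintype ι] [DecidableEq ι] {n : ℕ} {j : ι} {C C' ε : ℝ}
    {f : (ι → ℝ) → ℝ≥0∞} {G : ℝ≥0∞} (h : ScaleBounds n j C ε f G) (hC : C ≤ C') (hε : 0 < ε) :
    ScaleBounds n j C' ε f G where
  update_le T hT y t := (h.update_le T hT y t).trans <| by
    have : 0 < T := (one_div_pos.mpr hε).trans_le hT
    gcongr
  le_avg T hT y := (h.le_avg T hT y).trans <| by gcongr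
  avg_le T hT y := (h.avg_le T hT y).trans <| by gcongr

variable {ι : Type*} [Fintype ι] {V E : Type*} [NormedAddCommGroup V] [InnerProductSpace ℝ V]
  [NormedAddCommGroup E] [InnerProductSpace ℝ E]

/-- `b` consists of vectors of norm at most one and `w` is its dual basis, bounded by `K`. -/
structure IsFrame [DecidableEq ι] (b w : ι → E) (K : ℝ) : Prop where
  norm_le_one : ∀ i, ‖b i‖ ≤ 1
  norm_dual_le : ∀ i, ‖w i‖ ≤ K
  sum_eq : ∀ η, ∑ i, ⟪w i, η⟫_ℝ • b i = η
  inner_eq : ∀ i k, ⟪b k, w i⟫_ℝ = if i = k then 1 else 0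

lemma IsFrame.norm_le [DecidableEq ι] {b w : ι → E} {K : ℝ} (h : IsFrame b w K) (v : E) :
    ‖v‖ ≤ K * ∑ i, |⟪b i, v⟫_ℝ| := by
  have e : ∑ i, ⟪b i, v⟫_ℝ • w i = v := by
    refine ext_inner_right ℝ fun η => ?_
    conv_rhs => rw [← h.sum_eq η]
    rw [sum_inner, inner_sum]
    refine Finset.sum_congr rfl fun i _ => ?_
    rw [real_inner_smul_left, real_inner_smul_right, real_inner_comm v (b i)]
    ring
  calc ‖v‖ = ‖∑ i, ⟪b i, v⟫_ℝ • w i‖ := by rw [e]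
    _ ≤ ∑ i, ‖⟪b i, v⟫_ℝ • w i‖ := norm_sum_le _ _
    _ ≤ ∑ i, |⟪b i, v⟫_ℝ| * K := Finset.sum_le_sum fun i _ => by
        rw [norm_smul, Real.norm_eq_abs]
        exact mul_le_mul_of_nonneg_left (h.norm_dual_le i) (abs_nonneg _)
    _ = _ := by rw [← Finset.sum_mul, mul_comm]

variable [FiniteDimensional ℝ V] [FiniteDimensional ℝ E]

lemma map_eq_of_comp_thickenDeriv (hdim : Module.finrank ℝ E = Module.finrank ℝ V + 1)
    {A : V →L[ℝ] E} (hA : Function.Injective A) {e e' : E} (he : ‖e‖ = 1) (he' : ‖e'‖ = 1)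
    (hperp : ∀ v, ⟪e', A v⟫_ℝ = 0) {l : E →L[ℝ] ℂ}
    (hl : l.comp (thickenDeriv A e) = Complex.ofRealCLM.comp (ContinuousLinearMap.snd ℝ V ℝ)) :
    (∀ w, ⟪e', w⟫_ℝ = 0 → l w = 0) ∧ ∀ w, ⟪e', w⟫_ℝ = 1 → 1 ≤ ‖l w‖ := by
  obtain ⟨Ψ, hΨ⟩ := exists_equiv_eq_thickenDeriv hdim hA he' hperp
  have hlp : ∀ p : V × ℝ, l (A p.1 + p.2 • e) = p.2 := fun p => congrArg (fun L => L p) hl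
  have hlA : ∀ v, l (A v) = 0 := fun v => by simpa using hlp (v, 0)
  have hle : l e = 1 := by simpa using hlp (0, 1)
  have hw : ∀ w, l w = ⟪e', w⟫_ℝ * l e' := by
    intro w
    obtain ⟨p, rfl⟩ := Ψ.surjective w
    have h1 : Ψ p = A p.1 + p.2 • e' := congrArg (fun L => L p) hΨ
    rw [h1, map_add, hlA, zero_add, map_smul, inner_add_right, hperp, zero_add,
      real_inner_smul_right, real_inner_self_eq_norm_sq, he']
    simp
  refine ⟨fun w h => by rw [hw, h]; simp, fun w h => ?_⟩
  rw [hw, h, Complex.ofReal_one, one_mul]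
  have h1 : |⟪e', e⟫_ℝ| ≤ 1 := by simpa [he, he'] using abs_real_inner_le_norm e' e
  have h2 : |⟪e', e⟫_ℝ| * ‖l e'‖ = 1 := by
    have := congrArg norm (hw e)
    rw [hle, norm_mul, Complex.norm_real, norm_one, Real.norm_eq_abs] at this
    exact this.symm
  nlinarith [norm_nonneg (l e')]

variable [MeasurableSpace V] [BorelSpace V] [MeasurableSpace E] [BorelSpace E] [DecidableEq ι]

lemma exists_scaleBounds_local (ν : Measure V) [ν.IsAddHaarMeasure] {n : ℕ}
    (hι : Fintype.card ι = n + 1) (hV : Module.finrank ℝ V = n) (hE : Module.finrank ℝ E = n + 1)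
    (K : ℝ) {S : V → E} (hS : ContDiff ℝ ∞ S) {z : V} (hA : Function.Injective (fderiv ℝ S z))
    {e : E} (he : ‖e‖ = 1) (hperp : ∀ v, ⟪e, fderiv ℝ S z v⟫_ℝ = 0) :
    ∃ r > 0, ∃ C > 0, ∀ x₀ ∈ ball z r, Function.Injective (fderiv ℝ S x₀) →
      ∀ (W : Set V) (b w : ι → E) (j : ι) (ε : ℝ) (g : V → ℂ), IsFrame b w K →
      ‖b j‖ = 1 → (∀ v, ⟪b j, fderiv ℝ S x₀ v⟫_ℝ = 0) → 0 < ε → ε ≤ 1 → MeasurableSet W →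
      W ⊆ ball x₀ (r * ε) → Integrable g (ν.restrict W) →
      ScaleBounds n j C ε
        (fun y => ‖tauExt (ν.restrict W) (fun x i => ⟪b i, S x⟫_ℝ) g y‖ₑ ^ 2)
        (∫⁻ x in W, ‖g x‖ₑ ^ 2 ∂ν) := by
  have hdim : Module.finrank ℝ E = Module.finrank ℝ V + 1 := by rw [hE, hV]
  obtain ⟨ρ, hρ, K₁, hK₁⟩ := exists_defining_function hdim hS hA he hperp
  obtain ⟨K₂, t, ht, hK₂⟩ := (hS.contDiffAt (x := z)).of_le (m := 1) (by simp)
    |>.exists_lipschitzOnWith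
  have hSc : Continuous S := hS.continuous
  have hN : ∀ᶠ x in 𝓝 z, ‖S x‖ < ‖S z‖ + 1 :=
    hSc.norm.continuousAt.eventually (gt_mem_nhds (lt_add_one _))
  obtain ⟨r₁, hr₁, hball⟩ := Metric.eventually_nhds_iff_ball.mp (hρ.and (hN.and ht))
  obtain ⟨r₂, hr₂, hball2⟩ := Metric.eventually_nhds_iff_ball.mp hK₁
  obtain ⟨C₁, hC₁, hup⟩ := exists_avg_tauExt_update_le ι V ρ K
  obtain ⟨C₂, hC₂, hin⟩ := exists_enorm_tauExt_sq_le ι V (‖S z‖ + 1)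
  have hK0 : 0 < ((K₁ + 1) * (max K 0 + 1) : ℝ)⁻¹ := by positivity
  obtain ⟨C₃, hC₃, hen⟩ := exists_avg_tauExt_le ν ι hK0
  set r := min (min r₁ r₂ / 2) (1 / (K₂ + 1)) with hr
  have hr0 : 0 < r := by positivity
  have hr1 : r + r ≤ r₁ := by
    linarith [min_le_left (min r₁ r₂ / 2) (1 / (K₂ + 1 : ℝ)), min_le_left r₁ r₂]
  have hr2 : r + r ≤ r₂ := by
    linarith [min_le_left (min r₁ r₂ / 2) (1 / (K₂ + 1 : ℝ)), min_le_right r₁ r₂]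
  have hr3 : K₂ * r ≤ 1 := by
    have h1 : r ≤ 1 / (K₂ + 1) := min_le_right _ _
    rw [le_div_iff₀ (by positivity)] at h1
    linarith
  refine ⟨r, hr0, max C₁ (max C₂ C₃), by positivity,
    fun x₀ hx₀ hinj W b w j ε g hbw hbj hbperp hε hε1 hW hWx hg => ?_⟩
  have hWz : W ⊆ ball z (r + r) := by
    refine hWx.trans fun x hx => ?_
    rw [mem_ball] at hx hx₀ ⊢
    have := dist_triangle x x₀ z
    nlinarith
  have hx₀1 : x₀ ∈ ball z r₁ := ball_subset_ball (by linarith) hx₀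
  have hτm : Measurable fun (x : V) (i : ι) => ⟪b i, S x⟫_ℝ := by
    refine Continuous.measurable (continuous_pi fun i => ?_)
    fun_prop
  have hae : ∀ {p : V → Prop}, (∀ x ∈ W, p x) → ∀ᵐ x ∂ν.restrict W, p x := fun h =>
    (ae_restrict_iff' hW).mpr (Filter.Eventually.of_forall h)
  obtain ⟨hl0, hl1⟩ := map_eq_of_comp_thickenDeriv hdim hinj he hbj hbperp (hball x₀ hx₀1).1.2
  refine ⟨fun T hT y t => ?_, fun T hT y => ?_, fun T hT y => ?_⟩
  · refine (hup (ν.restrict W) b w j (S x₀) S g ε T hbw.norm_le_one hbw.norm_dual_le hbw.sum_eq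
      (fun i hi => hl0 _ (by rw [hbw.inner_eq, if_neg hi]))
      (hl1 _ (by rw [hbw.inner_eq, if_pos rfl])) hSc.measurable.aemeasurable hg
      (hae fun x hx => (hball x (ball_subset_ball hr1 (hWz hx))).1.1)
      (hae fun x hx => ?_) hε hε1 hT y t).trans ?_
    · refine (hK₂.norm_sub_le (hball x (ball_subset_ball hr1 (hWz hx))).2.2
        (hball x₀ hx₀1).2.2).trans ?_
      have h1 : ‖x - x₀‖ ≤ r * ε := by
        rw [← dist_eq_norm]; exact (mem_ball.mp (hWx hx)).le
      calc (K₂ : ℝ) * ‖x - x₀‖ ≤ K₂ * (r * ε) := by gcongr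
        _ = K₂ * r * ε := by ring
        _ ≤ 1 * ε := by gcongr
        _ = ε := one_mul _
    · have : 0 < T := (one_div_pos.mpr hε).trans_le hT
      gcongr
      exact le_max_left _ _
  · refine (hin (ν.restrict W) _ g T hτm.aemeasurable hg (hae fun x hx i => ?_) hT y).trans ?_
    · refine (abs_real_inner_le_norm _ _).trans ?_
      calc ‖b i‖ * ‖S x‖ ≤ 1 * ‖S x‖ := by gcongr; exact hbw.norm_le_one i
        _ ≤ ‖S z‖ + 1 := by
          rw [one_mul]; exact (hball x (ball_subset_ball hr1 (hWz hx))).2.1.le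
    · rw [hι]
      gcongr
      exact (le_max_left _ _).trans (le_max_right _ _)
  · refine (hen W _ g T hW hT hτm hg (fun x hx x' hx' => ?_) y).trans ?_
    · have h1 := hball2 (x, x') (by
        rw [← ball_prod_same]
        exact ⟨ball_subset_ball hr2 (hWz hx), ball_subset_ball hr2 (hWz hx')⟩)
      have h2 := hbw.norm_le (S x - S x')
      simp only [inner_sub_right] at h2
      rw [inv_mul_le_iff₀ (by positivity)]
      have h3 : 0 ≤ ∑ i, |⟪b i, S x⟫_ℝ - ⟪b i, S x'⟫_ℝ| :=
        Finset.sum_nonneg fun _ _ => abs_nonneg _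
      calc ‖x - x'‖ ≤ K₁ * ‖S x - S x'‖ := h1
        _ ≤ (K₁ + 1) * (K * ∑ i, |⟪b i, S x⟫_ℝ - ⟪b i, S x'⟫_ℝ|) := by
          gcongr; linarith
        _ ≤ (K₁ + 1) * ((max K 0 + 1) * ∑ i, |⟪b i, S x⟫_ℝ - ⟪b i, S x'⟫_ℝ|) := by
          gcongr; linarith [le_max_left K 0]
        _ = _ := by ring
    · rw [hV]
      gcongr
      exact (le_max_right _ _).trans (le_max_right _ _)

/-- The scale bounds hold uniformly for small pieces of a compact immersed hypersurface. -/
lemma exists_scaleBounds (ν : Measure V) [ν.IsAddHaarMeasure] {n : ℕ}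
    (hι : Fintype.card ι = n + 1) (hV : Module.finrank ℝ V = n) (hE : Module.finrank ℝ E = n + 1)
    (K : ℝ) {S : V → E} (hS : ContDiff ℝ ∞ S) {U : Set V} (hU : IsCompact U)
    (hA : ∀ x ∈ U, Function.Injective (fderiv ℝ S x)) {e : V → E} (he : ∀ x ∈ U, ‖e x‖ = 1)
    (hperp : ∀ x ∈ U, ∀ v, ⟪e x, fderiv ℝ S x v⟫_ℝ = 0) :
    ∃ r > 0, ∃ C > 0, ∀ x₀ ∈ U,
      ∀ (W : Set V) (b w : ι → E) (j : ι) (ε : ℝ) (g : V → ℂ), IsFrame b w K →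
      b j = e x₀ → 0 < ε → ε ≤ 1 → MeasurableSet W →
      W ⊆ ball x₀ (r * ε) → Integrable g (ν.restrict W) →
      ScaleBounds n j C ε
        (fun y => ‖tauExt (ν.restrict W) (fun x i => ⟪b i, S x⟫_ℝ) g y‖ₑ ^ 2)
        (∫⁻ x in W, ‖g x‖ₑ ^ 2 ∂ν) := by
  suffices h : ∃ r > 0, ∃ C > 0, ∀ x₀ ∈ U, x₀ ∈ U →
      ∀ (W : Set V) (b w : ι → E) (j : ι) (ε : ℝ) (g : V → ℂ), IsFrame b w K →
      b j = e x₀ → 0 < ε → ε ≤ 1 → MeasurableSet W →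
      W ⊆ ball x₀ (r * ε) → Integrable g (ν.restrict W) →
      ScaleBounds n j C ε
        (fun y => ‖tauExt (ν.restrict W) (fun x i => ⟪b i, S x⟫_ℝ) g y‖ₑ ^ 2)
        (∫⁻ x in W, ‖g x‖ₑ ^ 2 ∂ν) by
    obtain ⟨r, hr, C, hC, h⟩ := h
    exact ⟨r, hr, C, hC, fun x₀ hx₀ => h x₀ hx₀ hx₀⟩
  refine hU.induction_on (p := fun s => ∃ r > 0, ∃ C > 0, ∀ x₀ ∈ s, x₀ ∈ U →
      ∀ (W : Set V) (b w : ι → E) (j : ι) (ε : ℝ) (g : V → ℂ), IsFrame b w K →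
      b j = e x₀ → 0 < ε → ε ≤ 1 → MeasurableSet W →
      W ⊆ ball x₀ (r * ε) → Integrable g (ν.restrict W) →
      ScaleBounds n j C ε
        (fun y => ‖tauExt (ν.restrict W) (fun x i => ⟪b i, S x⟫_ℝ) g y‖ₑ ^ 2)
        (∫⁻ x in W, ‖g x‖ₑ ^ 2 ∂ν)) ?_ ?_ ?_ ?_
  · exact ⟨1, one_pos, 1, one_pos, fun x₀ h => h.elim⟩
  · rintro s t hst ⟨r, hr, C, hC, h⟩
    exact ⟨r, hr, C, hC, fun x₀ hx₀ => h x₀ (hst hx₀)⟩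
  · rintro s t ⟨r, hr, C, hC, h⟩ ⟨r', hr', C', hC', h'⟩
    refine ⟨min r r', lt_min hr hr', max C C', by positivity, ?_⟩
    intro x₀ hx₀ hx₀U W b w j ε g hbw hbj hε hε1 hW hWx hg
    rcases hx₀ with hx₀ | hx₀
    · exact (h x₀ hx₀ hx₀U W b w j ε g hbw hbj hε hε1 hW (hWx.trans (ball_subset_ball
        (by gcongr; exact min_le_left _ _))) hg).mono (le_max_left _ _) hε
    · exact (h' x₀ hx₀ hx₀U W b w j ε g hbw hbj hε hε1 hW (hWx.trans (ball_subset_ball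
        (by gcongr; exact min_le_right _ _))) hg).mono (le_max_right _ _) hε
  · intro z hz
    obtain ⟨r, hr, C, hC, h⟩ := exists_scaleBounds_local ν hι hV hE K hS (hA z hz) (he z hz)
      (hperp z hz)
    refine ⟨ball z r, mem_nhdsWithin_of_mem_nhds (ball_mem_nhds z hr), r, hr, C, hC, ?_⟩
    intro x₀ hx₀ hx₀U W b w j ε g hbw hbj
    exact h x₀ hx₀ (hA x₀ hx₀U) W b w j ε g hbw (hbj ▸ he x₀ hx₀U) (hbj ▸ hperp x₀ hx₀U)

end Pieces

section Frames

open scoped Matrix Nat ContDiff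

variable {n : ℕ}

lemma abs_apply_le_one_of_norm_eq {v : EuclideanSpace ℝ (Fin (n + 1))} (h : ‖v‖ = 1)
    (i : Fin (n + 1)) : |v i| ≤ 1 :=
  h ▸ PiLp.norm_apply_le v i

lemma abs_det_le {M : Matrix (Fin (n + 1)) (Fin (n + 1)) ℝ} (h : ∀ i j, |M i j| ≤ 1) :
    |M.det| ≤ (n + 1)! := by
  have := Matrix.det_le (A := M) (abv := AbsoluteValue.abs) (x := 1) h
  simpa using this

lemma exists_isFrame {ν₀ : ℝ} (hν₀ : 0 < ν₀) {b : Fin (n + 1) → EuclideanSpace ℝ (Fin (n + 1))}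
    (hb : ∀ j, ‖b j‖ = 1) (hdet : ν₀ ≤ |(Matrix.of fun i j => b j i).det|) :
    ∃ w : Fin (n + 1) → EuclideanSpace ℝ (Fin (n + 1)), IsFrame b w ((n + 1) * ((n + 1)! / ν₀)) := by
  set M : Matrix (Fin (n + 1)) (Fin (n + 1)) ℝ := Matrix.of fun i j => b j i with hM
  have hM1 : ∀ i j, |M i j| ≤ 1 := fun i j => abs_apply_le_one_of_norm_eq (hb j) i
  have hd0 : M.det ≠ 0 := fun h => by rw [h, abs_zero] at hdet; linarith
  have hu : IsUnit M.det := hd0.isUnit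
  have hadj : ∀ i j, |M.adjugate i j| ≤ (n + 1)! := fun i j => by
    rw [Matrix.adjugate_apply]
    refine abs_det_le fun k l => ?_
    rw [Matrix.updateRow_apply]
    split_ifs
    · rw [Pi.single_apply]; split_ifs <;> simp
    · exact hM1 k l
  have hinv : ∀ i j, |M⁻¹ i j| ≤ (n + 1)! / ν₀ := fun i j => by
    rw [Matrix.inv_def, Matrix.smul_apply, smul_eq_mul, Ring.inverse_eq_inv', abs_mul, abs_inv,
      inv_mul_eq_div]
    exact div_le_div₀ (by positivity) (hadj i j) hν₀ hdet
  have hinner : ∀ i j, ⟪b j, WithLp.toLp 2 (M⁻¹ i)⟫_ℝ = if i = j then 1 else 0 := fun i j => by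
    have h := congrFun (congrFun (Matrix.nonsing_inv_mul M hu) i) j
    rw [Matrix.mul_apply, Matrix.one_apply] at h
    rw [← h, PiLp.inner_apply]
    refine Finset.sum_congr rfl fun k _ => ?_
    simp [hM]
  refine ⟨fun i => WithLp.toLp 2 (M⁻¹ i), fun i => (hb i).le, fun i => ?_, fun η => ?_, hinner⟩
  · have h0 : (0 : ℝ) ≤ (n + 1)! / ν₀ := by positivity
    rw [EuclideanSpace.norm_eq]
    refine (Real.sqrt_le_left (by positivity)).mpr ?_
    calc ∑ k, ‖M⁻¹ i k‖ ^ 2 ≤ ∑ _k : Fin (n + 1), ((n + 1)! / ν₀ : ℝ) ^ 2 :=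
          Finset.sum_le_sum fun k _ => pow_le_pow_left₀ (norm_nonneg _) (hinv i k) 2
      _ = (n + 1) * ((n + 1)! / ν₀ : ℝ) ^ 2 := by simp
      _ ≤ ((n + 1) * ((n + 1)! / ν₀) : ℝ) ^ 2 := by
        rw [mul_pow]
        gcongr
        nlinarith [(Nat.cast_nonneg n : (0 : ℝ) ≤ n)]
  · have h1 : M *ᵥ (M⁻¹ *ᵥ WithLp.ofLp η) = WithLp.ofLp η := by
      rw [Matrix.mulVec_mulVec, Matrix.mul_nonsing_inv M hu, Matrix.one_mulVec]
    ext k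
    have h2 := congrFun h1 k
    rw [← h2]
    simp only [Matrix.mulVec, dotProduct, PiLp.inner_apply, WithLp.ofLp_sum,
      Finset.sum_apply, WithLp.ofLp_smul, Pi.smul_apply, smul_eq_mul, hM, Matrix.of_apply]
    refine Finset.sum_congr rfl fun i _ => ?_
    rw [mul_comm]
    congr 1
    refine Finset.sum_congr rfl fun l _ => ?_
    simp [mul_comm]

/-- Change to the coordinates of a frame. -/
lemma setLIntegral_ball_le_of_isFrame {b w : Fin (n + 1) → EuclideanSpace ℝ (Fin (n + 1))}
    {K R : ℝ} (hbw : IsFrame b w K)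
    (hb : ∀ j, ‖b j‖ = 1) (hdet : (Matrix.of fun i j => b j i).det ≠ 0) (hR : 0 ≤ R)
    {F : EuclideanSpace ℝ (Fin (n + 1)) → ℝ≥0∞} (hF : Measurable F) :
    ∫⁻ ξ in ball 0 R, F ξ ≤ ENNReal.ofReal (n + 1)! *
      ∫⁻ y in closedBall (0 : Fin (n + 1) → ℝ) (K * R), F (∑ i, y i • b i) := by
  set M : Matrix (Fin (n + 1)) (Fin (n + 1)) ℝ := Matrix.of fun i j => b j i with hM
  have hM1 : ∀ i j, |M i j| ≤ 1 := fun i j => abs_apply_le_one_of_norm_eq (hb j) i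
  have hL : ∀ y : Fin (n + 1) → ℝ, WithLp.toLp 2 (Matrix.toLin' M y) = ∑ i, y i • b i := by
    intro y
    ext k
    simp [Matrix.mulVec, dotProduct, hM, mul_comm]
  have hK : 0 ≤ K := (norm_nonneg _).trans (hbw.norm_dual_le 0)
  have hmem : ∀ y : Fin (n + 1) → ℝ, ∑ i, y i • b i ∈ ball (0 : EuclideanSpace ℝ (Fin (n + 1))) R →
      y ∈ closedBall (0 : Fin (n + 1) → ℝ) (K * R) := by
    intro y hy
    rw [mem_ball_zero_iff] at hy
    rw [mem_closedBall_zero_iff, pi_norm_le_iff_of_nonneg (by positivity)]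
    intro i
    have e : ⟪∑ k, y k • b k, w i⟫_ℝ = y i := by
      rw [sum_inner]
      simp_rw [real_inner_smul_left, hbw.inner_eq]
      simp
    rw [← e]
    calc ‖⟪∑ k, y k • b k, w i⟫_ℝ‖ ≤ ‖∑ k, y k • b k‖ * ‖w i‖ := norm_inner_le_norm _ _
      _ ≤ R * K := mul_le_mul hy.le (hbw.norm_dual_le i) (norm_nonneg _) hR
      _ = K * R := mul_comm _ _
  set H : EuclideanSpace ℝ (Fin (n + 1)) → ℝ≥0∞ := (ball 0 R).indicator F with hH
  have hHm : Measurable H := hF.indicator measurableSet_ball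
  have hG : Measurable fun v : Fin (n + 1) → ℝ => H (WithLp.toLp 2 v) :=
    hHm.comp (PiLp.volume_preserving_toLp _).measurable
  have h1 : ∫⁻ v : Fin (n + 1) → ℝ, H (WithLp.toLp 2 v) = ∫⁻ ξ in ball 0 R, F ξ := by
    rw [← lintegral_indicator measurableSet_ball]
    exact (PiLp.volume_preserving_toLp (Fin (n + 1))).lintegral_comp hHm
  have h2 := Real.map_matrix_volume_pi_eq_smul_volume_pi hdet
  have hLm : Measurable (Matrix.toLin' M) :=
    (LinearMap.continuous_of_finiteDimensional _).measurable
  have h3 : ∫⁻ v : Fin (n + 1) → ℝ, H (WithLp.toLp 2 v) =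
      ENNReal.ofReal |M.det| * ∫⁻ y : Fin (n + 1) → ℝ, H (∑ i, y i • b i) := by
    have h4 : ∫⁻ v, H (WithLp.toLp 2 v) ∂(Measure.map (Matrix.toLin' M) volume) =
        ∫⁻ y : Fin (n + 1) → ℝ, H (∑ i, y i • b i) := by
      rw [lintegral_map hG hLm]
      simp_rw [hL]
    rw [← h4, h2, lintegral_smul_measure, smul_eq_mul, ← mul_assoc,
      ← ENNReal.ofReal_mul (abs_nonneg _), ← abs_mul, mul_inv_cancel₀ hdet]
    simp
  rw [← h1, h3]
  refine mul_le_mul' (ENNReal.ofReal_le_ofReal (abs_det_le hM1)) ?_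
  rw [← lintegral_indicator measurableSet_closedBall]
  refine lintegral_mono fun y => ?_
  by_cases h : ∑ i, y i • b i ∈ ball (0 : EuclideanSpace ℝ (Fin (n + 1))) R
  · rw [hH, Set.indicator_of_mem h, Set.indicator_of_mem (hmem y h)]
  · rw [hH, Set.indicator_of_notMem h]
    exact zero_le

end Frames

section Pieces

open scoped Matrix Nat ContDiff

variable {n : ℕ}

lemma continuous_extOp {W : Set (EuclideanSpace ℝ (Fin n))}
    {S : EuclideanSpace ℝ (Fin n) → EuclideanSpace ℝ (Fin (n + 1))} (hS : Continuous S)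
    {g : EuclideanSpace ℝ (Fin n) → ℂ} (hg : IntegrableOn g W) : Continuous (extOp W S g) :=
  continuous_osc (θ := fun ξ x => ⟪ξ, S x⟫_ℝ) (fun ξ => Continuous.aemeasurable (by fun_prop))
    (fun x => by fun_prop) hg

lemma extOp_sum_smul (W : Set (EuclideanSpace ℝ (Fin n)))
    (S : EuclideanSpace ℝ (Fin n) → EuclideanSpace ℝ (Fin (n + 1)))
    (g : EuclideanSpace ℝ (Fin n) → ℂ) (b : Fin (n + 1) → EuclideanSpace ℝ (Fin (n + 1)))
    (y : Fin (n + 1) → ℝ) :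
    extOp W S g (∑ i, y i • b i) =
      tauExt (volume.restrict W) (fun x i => ⟪b i, S x⟫_ℝ) g y := by
  have h : ∀ x, ⟪∑ i, y i • b i, S x⟫_ℝ = ∑ i, y i * ⟪b i, S x⟫_ℝ := fun x => by
    rw [sum_inner]
    simp_rw [real_inner_smul_left]
  unfold extOp tauExt osc
  simp_rw [h]

/-- The multilinear estimate for functions supported in small pieces, at the scale `R`. -/
lemma exists_setLIntegral_prod_extOp_le (hn : 1 ≤ n) {ν₀ : ℝ} (hν₀ : 0 < ν₀)
    {U : Fin (n + 1) → Set (EuclideanSpace ℝ (Fin n))} (hU : ∀ j, IsCompact (U j))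
    {S : Fin (n + 1) → EuclideanSpace ℝ (Fin n) → EuclideanSpace ℝ (Fin (n + 1))}
    (hS : ∀ j, ContDiff ℝ ∞ (S j))
    (hSimm : ∀ j, ∀ x ∈ U j, Function.Injective (fderiv ℝ (S j) x))
    {ν : Fin (n + 1) → EuclideanSpace ℝ (Fin n) → EuclideanSpace ℝ (Fin (n + 1))}
    (hνunit : ∀ j, ∀ x ∈ U j, ‖ν j x‖ = 1)
    (hνperp : ∀ j, ∀ x ∈ U j, ∀ v, ⟪ν j x, fderiv ℝ (S j) x v⟫_ℝ = 0)
    (htrans : ∀ x : (j : Fin (n + 1)) → EuclideanSpace ℝ (Fin n),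
      (∀ j, x j ∈ U j) →
      ν₀ ≤ |Matrix.det (Matrix.of fun i j => ν j (x j) i)|) :
    ∃ r > 0, ∃ c > 0, ∃ κ : ℕ, ∀ R : ℝ, 1 ≤ R → ∀ x : Fin (n + 1) → EuclideanSpace ℝ (Fin n),
      (∀ j, x j ∈ U j) → ∀ W : Fin (n + 1) → Set (EuclideanSpace ℝ (Fin n)),
      (∀ j, MeasurableSet (W j)) → (∀ j, W j ⊆ ball (x j) (r * ((1 + Real.log R) ^ 2)⁻¹)) →
      ∀ g : Fin (n + 1) → EuclideanSpace ℝ (Fin n) → ℂ, (∀ j, IntegrableOn (g j) (W j)) →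
      ∫⁻ ξ in ball 0 R, ∏ j, ‖extOp (W j) (S j) (g j) ξ‖ₑ ^ (2 / n : ℝ) ≤
        ENNReal.ofReal (c * (1 + Real.log R) ^ κ) *
          ∏ j, (∫⁻ x in W j, ‖g j x‖ₑ ^ 2) ^ (1 / n : ℝ) := by
  set K : ℝ := (n + 1) * ((n + 1)! / ν₀) with hK
  choose r hr C hC hsb using fun j => exists_scaleBounds
    (volume : Measure (EuclideanSpace ℝ (Fin n))) (ι := Fin (n + 1)) (Fintype.card_fin _)
    finrank_euclideanSpace_fin finrank_euclideanSpace_fin K (hS j) (hU j) (hSimm j)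
    (hνunit j) (hνperp j)
  set r₀ : ℝ := Finset.univ.inf' Finset.univ_nonempty r with hr₀
  have hr₀pos : 0 < r₀ := (Finset.lt_inf'_iff _).mpr fun j _ => hr j
  set D : ℝ := 1 + ∑ j, C j with hD
  have hCD : ∀ j, C j ≤ D := fun j => by
    have := Finset.single_le_sum (fun i _ => (hC i).le) (Finset.mem_univ j)
    linarith
  have hD1 : 1 ≤ D := by
    have := Finset.sum_nonneg fun i (_ : i ∈ Finset.univ) => (hC i).le
    linarith
  have hK0 : 0 ≤ K := by positivity
  refine ⟨r₀, hr₀pos, (n + 1)! * (D ^ (n + 1) * (Real.exp ((2 + 16 * D) * (2 * (n + 1))) *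
    (D * (2 * (K + 4))) ^ (n + 1))), by positivity, 2 * (n + 1) * (n + 1) + (n + 1),
    fun R hR x hx W hWm hW g hg => ?_⟩
  set L : ℝ := 1 + Real.log R with hL
  have hL1 : 1 ≤ L := by have := Real.log_nonneg hR; linarith
  set ε : ℝ := (L ^ 2)⁻¹ with hε
  have hε0 : 0 < ε := by positivity
  have hε1 : ε ≤ 1 := inv_le_one_of_one_le₀ (one_le_pow₀ hL1)
  have hb : ∀ j, ‖ν j (x j)‖ = 1 := fun j => hνunit j _ (hx j)
  have hdet := htrans x hx
  obtain ⟨w, hbw⟩ := exists_isFrame hν₀ hb hdet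
  have hdet0 : (Matrix.of fun i j => ν j (x j) i).det ≠ 0 := fun h => by
    rw [h, abs_zero] at hdet; linarith
  set f : Fin (n + 1) → (Fin (n + 1) → ℝ) → ℝ≥0∞ := fun j y =>
    ‖tauExt (volume.restrict (W j)) (fun p i => ⟪ν i (x i), S j p⟫_ℝ) (g j) y‖ₑ ^ 2 with hf
  set G : Fin (n + 1) → ℝ≥0∞ := fun j => ∫⁻ p in W j, ‖g j p‖ₑ ^ 2 with hG
  have hscale : ∀ j, ScaleBounds n j D ε (f j) (G j) := fun j =>
    (hsb j (x j) (hx j) (W j) _ w j ε (g j) hbw rfl hε0 hε1 (hWm j)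
      ((hW j).trans (ball_subset_ball (mul_le_mul_of_nonneg_right
        (Finset.inf'_le _ (Finset.mem_univ j)) hε0.le))) (hg j)).mono (hCD j) hε0
  have hfm : ∀ j, Measurable (f j) := fun j => by
    have : Continuous (tauExt (volume.restrict (W j)) (fun p i => ⟪ν i (x i), S j p⟫_ℝ) (g j)) :=
      continuous_tauExt (aemeasurable_pi_iff.mpr fun i => Continuous.aemeasurable
        (continuous_const.inner (hS j).continuous)) (hg j)
    exact this.measurable.enorm.pow_const 2
  have hmain := setLIntegral_prod_rpow_le_of_scales hn (Fintype.card_fin (n + 1))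
    (δ := D * ε) (S₀ := L ^ 2) (A := D) (B := K) (C := D) (D := D) hR (by positivity)
    (one_le_pow₀ hL1) hD1 hK0 (by linarith)
    (by rw [mul_assoc, hε, inv_mul_cancel₀ (by positivity), mul_one]) f G hfm
    (fun i T hT y t => (hscale i).update_le T (by simpa [hε] using hT) y t)
    (fun i y => (hscale i).le_avg _ (one_le_pow₀ hL1) y)
    (fun i T hT y => (hscale i).avg_le T hT y)
  have hFm : Measurable fun ξ => ∏ j, ‖extOp (W j) (S j) (g j) ξ‖ₑ ^ (2 / n : ℝ) :=
    Finset.measurable_fun_prod _ fun j _ =>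
      (continuous_extOp (hS j).continuous (hg j)).measurable.enorm.pow_const _
  have hcoord : ∀ y : Fin (n + 1) → ℝ,
      ∏ j, ‖extOp (W j) (S j) (g j) (∑ i, y i • ν i (x i))‖ₑ ^ (2 / n : ℝ) =
        ∏ j, f j y ^ (1 / n : ℝ) := fun y => Finset.prod_congr rfl fun j _ => by
    simp only [hf, extOp_sum_smul]
    rw [← ENNReal.rpow_natCast, ← ENNReal.rpow_mul]
    congr 1
    push_cast
    ring
  refine (setLIntegral_ball_le_of_isFrame hbw hb hdet0 (by linarith) hFm).trans ?_
  simp_rw [hcoord]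
  refine (mul_le_mul' le_rfl hmain).trans_eq ?_
  rw [← mul_assoc, ← ENNReal.ofReal_mul (by positivity)]
  congr 2
  rw [show D * (2 * ((K + 4) * L)) = D * (2 * (K + 4)) * L by ring, mul_pow (D * (2 * (K + 4))) L,
    mul_pow D, pow_add, ← pow_mul, ← pow_mul]
  ring

end Pieces

section Partition

variable {n : ℕ}

lemma norm_sub_lt_of_floor_eq {m : ℕ} {s : ℝ} (hs : 0 < s) (hm : n / s < m)
    {x y : EuclideanSpace ℝ (Fin n)} (h : ∀ i, ⌊m * x i⌋ = ⌊m * y i⌋) : ‖x - y‖ < s := by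
  have hm0 : (0 : ℝ) < m := lt_of_le_of_lt (by positivity) hm
  have h1 : ∀ i, ‖(x - y) i‖ ^ 2 ≤ (1 / m : ℝ) ^ 2 := fun i => by
    refine pow_le_pow_left₀ (norm_nonneg _) ?_ 2
    have := (Int.abs_sub_lt_one_of_floor_eq_floor (h i)).le
    rw [← mul_sub, abs_mul, abs_of_pos hm0] at this
    rw [le_div_iff₀ hm0, mul_comm]
    exact this
  have h2 : ‖x - y‖ ^ 2 ≤ (n / m : ℝ) ^ 2 := by
    rw [EuclideanSpace.norm_sq_eq]
    calc ∑ i, ‖(x - y) i‖ ^ 2 ≤ ∑ _i : Fin n, (1 / m : ℝ) ^ 2 :=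
          Finset.sum_le_sum fun i _ => h1 i
      _ = n * (1 / m : ℝ) ^ 2 := by simp
      _ ≤ (n : ℝ) ^ 2 * (1 / m : ℝ) ^ 2 := by
        gcongr
        exact_mod_cast Nat.le_self_pow two_ne_zero n
      _ = (n / m : ℝ) ^ 2 := by ring
  calc ‖x - y‖ ≤ n / m := le_of_sq_le_sq h2 (by positivity)
    _ < s := by rwa [div_lt_comm₀ hm0 hs]

/-- A compact set splits into at most `c / s ^ n` disjoint pieces of diameter less than `s`. -/
lemma exists_finset_partition {U : Set (EuclideanSpace ℝ (Fin n))} (hU : IsCompact U) :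
    ∃ c > 0, ∀ s : ℝ, 0 < s → s ≤ 1 →
      ∃ (P : Finset (Fin n → ℤ)) (W : (Fin n → ℤ) → Set (EuclideanSpace ℝ (Fin n))),
        (P.card : ℝ) ≤ c * (s ^ n)⁻¹ ∧ (∀ k, MeasurableSet (W k)) ∧
        Pairwise (Function.onFun Disjoint W) ∧ ⋃ k ∈ P, W k = U ∧
        ∀ k ∈ P, ∃ x ∈ U, W k ⊆ ball x s := by
  classical
  obtain ⟨M, hM0, hM⟩ := hU.isBounded.exists_pos_norm_le
  refine ⟨((2 * M + 3) * (n + 1)) ^ n, by positivity, fun s hs hs1 => ?_⟩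
  set m : ℕ := ⌊n / s⌋₊ + 1 with hm
  have hmlt : n / s < m := by rw [hm]; exact_mod_cast Nat.lt_floor_add_one _
  have hm1 : (1 : ℝ) ≤ m := by rw [hm]; push_cast; linarith [Nat.cast_nonneg (α := ℝ) ⌊n / s⌋₊]
  have hmle : (m : ℝ) ≤ (n + 1) / s := by
    rw [hm, Nat.cast_add, Nat.cast_one, add_div]
    exact add_le_add (Nat.floor_le (by positivity)) ((one_le_div hs).mpr hs1)
  set A : ℕ := ⌈M * m⌉₊ with hA
  set q : EuclideanSpace ℝ (Fin n) → Fin n → ℤ := fun x i => ⌊m * x i⌋ with hq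
  have hqm : Measurable q := measurable_pi_iff.mpr fun i =>
    Int.measurable_floor.comp (by fun_prop)
  have hqA : ∀ x ∈ U, q x ∈ Fintype.piFinset fun _ : Fin n => Finset.Icc (-(A : ℤ)) A := by
    intro x hx
    rw [Fintype.mem_piFinset]
    intro i
    have h1 : |m * x i| ≤ A := by
      rw [abs_mul, Nat.abs_cast, mul_comm]
      refine le_trans ?_ (Nat.le_ceil _)
      gcongr
      exact (PiLp.norm_apply_le x i).trans (hM x hx)
    rw [Finset.mem_Icc]
    have h2 := abs_le.mp h1
    refine ⟨Int.le_floor.mpr (by push_cast; exact h2.1), ?_⟩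
    have h3 : ((q x i : ℤ) : ℝ) ≤ A := (Int.floor_le _).trans h2.2
    exact_mod_cast h3
  refine ⟨(Fintype.piFinset fun _ : Fin n => Finset.Icc (-(A : ℤ)) A).filter
    fun k => (U ∩ q ⁻¹' {k}).Nonempty, fun k => U ∩ q ⁻¹' {k}, ?_, fun k =>
    hU.measurableSet.inter (hqm (measurableSet_singleton k)), ?_, ?_, ?_⟩
  · have h1 : ((2 * A + 1 : ℕ) : ℝ) ≤ (2 * M + 3) * (n + 1) * s⁻¹ := by
      have h3 : (A : ℝ) < M * m + 1 := Nat.ceil_lt_add_one (by positivity)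
      calc ((2 * A + 1 : ℕ) : ℝ) ≤ 2 * (M * m + 1) + 1 := by push_cast; linarith
        _ ≤ (2 * M + 3) * m := by linarith
        _ ≤ (2 * M + 3) * ((n + 1) / s) := by gcongr
        _ = _ := by ring
    calc _ ≤ ((Fintype.piFinset fun _ : Fin n => Finset.Icc (-(A : ℤ)) A).card : ℝ) := by
          exact_mod_cast Finset.card_filter_le _ _
      _ = ((2 * A + 1 : ℕ) : ℝ) ^ n := by
        rw [Fintype.card_piFinset_const, Int.card_Icc,
          show (A : ℤ) + 1 - -(A : ℤ) = ((2 * A + 1 : ℕ) : ℤ) by push_cast; ring,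
          Int.toNat_natCast, Nat.cast_pow]
      _ ≤ ((2 * M + 3) * (n + 1) * s⁻¹) ^ n := pow_le_pow_left₀ (by positivity) h1 n
      _ = _ := by rw [mul_pow, inv_pow]
  · intro k l hkl
    refine Set.disjoint_left.mpr fun x hx hy => hkl ?_
    exact hx.2.symm.trans hy.2
  · ext x
    simp only [Finset.mem_filter, Set.mem_iUnion, Set.mem_inter_iff, Set.mem_preimage,
      Set.mem_singleton_iff]
    constructor
    · rintro ⟨k, -, hx, -⟩
      exact hx
    · exact fun hx => ⟨q x, ⟨hqA x hx, x, hx, rfl⟩, hx, rfl⟩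
  · intro k hk
    obtain ⟨x, hx, hxk⟩ := (Finset.mem_filter.mp hk).2
    refine ⟨x, hx, fun y hy => ?_⟩
    rw [mem_ball_iff_norm]
    refine norm_sub_lt_of_floor_eq hs hmlt fun i => ?_
    exact congrFun (hy.2.trans hxk.symm) i

end Partition

section Assembly

open scoped ContDiff

lemma enorm_sum_rpow_le {κ : Type*} (P : Finset κ) (u : κ → ℂ) {q N : ℝ} (hq : 0 < q)
    (hq2 : q ≤ 2) (hN : 1 ≤ N) (hP : (P.card : ℝ) ≤ N) :
    ‖∑ k ∈ P, u k‖ₑ ^ q ≤ ENNReal.ofReal (N ^ 2) * ∑ k ∈ P, ‖u k‖ₑ ^ q := by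
  have hle : ∀ k ∈ P, ‖u k‖ₑ ≤ (∑ k ∈ P, ‖u k‖ₑ ^ q) ^ q⁻¹ := fun k hk =>
    (ENNReal.le_rpow_inv_iff hq).mpr
      (Finset.single_le_sum (f := fun k => ‖u k‖ₑ ^ q) (fun _ _ => zero_le) hk)
  have h1 : ‖∑ k ∈ P, u k‖ₑ ≤ ENNReal.ofReal N * (∑ k ∈ P, ‖u k‖ₑ ^ q) ^ q⁻¹ := by
    refine (enorm_sum_le _ _).trans ((Finset.sum_le_card_nsmul _ _ _ hle).trans ?_)
    rw [nsmul_eq_mul]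
    gcongr
    rw [← ENNReal.ofReal_natCast]
    exact ENNReal.ofReal_le_ofReal hP
  refine (ENNReal.rpow_le_rpow h1 hq.le).trans ?_
  rw [ENNReal.mul_rpow_of_nonneg _ _ hq.le, ← ENNReal.rpow_mul, inv_mul_cancel₀ hq.ne',
    ENNReal.rpow_one, ENNReal.ofReal_pow (by linarith), ← ENNReal.rpow_natCast]
  gcongr
  · simpa using hN
  · exact_mod_cast hq2

variable {n : ℕ}

lemma extOp_biUnion {κ : Type*} (P : Finset κ) {W : κ → Set (EuclideanSpace ℝ (Fin n))}
    (hW : ∀ k, MeasurableSet (W k)) (hd : Pairwise (Function.onFun Disjoint W))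
    {S : EuclideanSpace ℝ (Fin n) → EuclideanSpace ℝ (Fin (n + 1))} (hS : Continuous S)
    {g : EuclideanSpace ℝ (Fin n) → ℂ} (hg : IntegrableOn g (⋃ k ∈ P, W k))
    (ξ : EuclideanSpace ℝ (Fin (n + 1))) :
    extOp (⋃ k ∈ P, W k) S g ξ = ∑ k ∈ P, extOp (W k) S g ξ := by
  refine integral_biUnion_finset P (fun k _ => hW k) (fun k _ l _ h => hd h) fun k hk => ?_
  exact integrable_osc (θ := fun x => ⟪ξ, S x⟫_ℝ)
    (Continuous.aemeasurable (by fun_prop)) (hg.mono_set (Set.subset_biUnion_of_mem hk))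

/-- The multilinear estimate at the scale `R` for integrable functions. -/
lemma exists_setLIntegral_prod_extOp_le_of_integrable (hn : 1 ≤ n) {ν₀ : ℝ} (hν₀ : 0 < ν₀)
    {U : Fin (n + 1) → Set (EuclideanSpace ℝ (Fin n))} (hU : ∀ j, IsCompact (U j))
    {S : Fin (n + 1) → EuclideanSpace ℝ (Fin n) → EuclideanSpace ℝ (Fin (n + 1))}
    (hS : ∀ j, ContDiff ℝ ∞ (S j))
    (hSimm : ∀ j, ∀ x ∈ U j, Function.Injective (fderiv ℝ (S j) x))
    {ν : Fin (n + 1) → EuclideanSpace ℝ (Fin n) → EuclideanSpace ℝ (Fin (n + 1))}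
    (hνunit : ∀ j, ∀ x ∈ U j, ‖ν j x‖ = 1)
    (hνperp : ∀ j, ∀ x ∈ U j, ∀ v, ⟪ν j x, fderiv ℝ (S j) x v⟫_ℝ = 0)
    (htrans : ∀ x : (j : Fin (n + 1)) → EuclideanSpace ℝ (Fin n),
      (∀ j, x j ∈ U j) →
      ν₀ ≤ |Matrix.det (Matrix.of fun i j => ν j (x j) i)|) :
    ∃ c > 0, ∃ κ : ℕ, ∀ R : ℝ, 1 ≤ R →
      ∀ g : Fin (n + 1) → EuclideanSpace ℝ (Fin n) → ℂ, (∀ j, IntegrableOn (g j) (U j)) →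
      ∫⁻ ξ in ball 0 R, ∏ j, ‖extOp (U j) (S j) (g j) ξ‖ₑ ^ (2 / n : ℝ) ≤
        ENNReal.ofReal (c * (1 + Real.log R) ^ κ) *
          ∏ j, (∫⁻ x in U j, ‖g j x‖ₑ ^ 2) ^ (1 / n : ℝ) := by
  classical
  obtain ⟨r, hr, c₁, hc₁, κ, hmain⟩ :=
    exists_setLIntegral_prod_extOp_le hn hν₀ hU hS hSimm hνunit hνperp htrans
  choose c hc hpart using fun j => exists_finset_partition (hU j)
  set r' : ℝ := min r 1 with hr'
  have hr'0 : 0 < r' := lt_min hr one_pos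
  set D : ℝ := (1 + ∑ j, c j) * (r' ^ n)⁻¹ with hD
  have hD1 : 1 ≤ D := by
    have h1 := Finset.sum_nonneg fun i (_ : i ∈ Finset.univ) => (hc i).le
    have h2 : 1 ≤ (r' ^ n)⁻¹ :=
      (one_le_inv₀ (by positivity)).mpr (pow_le_one₀ hr'0.le (min_le_right _ _))
    nlinarith
  refine ⟨(D ^ 3) ^ (n + 1) * c₁, by positivity, 2 * n * 3 * (n + 1) + κ, fun R hR g hg => ?_⟩
  set L : ℝ := 1 + Real.log R with hL
  have hL1 : 1 ≤ L := by have := Real.log_nonneg hR; linarith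
  have hs1 : r' * (L ^ 2)⁻¹ ≤ 1 :=
    mul_le_one₀ (min_le_right _ _) (by positivity) (inv_le_one_of_one_le₀ (one_le_pow₀ hL1))
  choose P W hcard hWm hWd hWU hWx using fun j => hpart j (r' * (L ^ 2)⁻¹) (by positivity) hs1
  set N : ℝ := D * L ^ (2 * n) with hN
  have hN1 : 1 ≤ N := one_le_mul_of_one_le_of_one_le hD1 (one_le_pow₀ hL1)
  have hPN : ∀ j, ((P j).card : ℝ) ≤ N := fun j => by
    refine (hcard j).trans ?_
    rw [mul_pow, mul_inv, inv_pow, inv_inv, ← pow_mul, ← mul_assoc, hN, hD]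
    gcongr
    have := Finset.single_le_sum (fun i _ => (hc i).le) (Finset.mem_univ j)
    linarith
  have hq : (0 : ℝ) < 2 / n := by positivity
  have hq2 : (2 / n : ℝ) ≤ 2 := div_le_self two_pos.le (by exact_mod_cast hn)
  have hsub : ∀ j, ∀ k ∈ P j, W j k ⊆ U j := fun j k hk => by
    rw [← hWU j]; exact Set.subset_biUnion_of_mem hk
  set G : ℝ≥0∞ := ∏ j, (∫⁻ x in U j, ‖g j x‖ₑ ^ 2) ^ (1 / n : ℝ) with hG
  set F : (Fin (n + 1) → Fin n → ℤ) → EuclideanSpace ℝ (Fin (n + 1)) → ℝ≥0∞ :=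
    fun α ξ => ∏ j, ‖extOp (W j (α j)) (S j) (g j) ξ‖ₑ ^ (2 / n : ℝ) with hF
  have hpt : ∀ ξ, ∏ j, ‖extOp (U j) (S j) (g j) ξ‖ₑ ^ (2 / n : ℝ) ≤
      ENNReal.ofReal ((N ^ 2) ^ (n + 1)) * ∑ α ∈ Fintype.piFinset P, F α ξ := fun ξ => by
    calc _ ≤ ∏ j, (ENNReal.ofReal (N ^ 2) *
          ∑ k ∈ P j, ‖extOp (W j k) (S j) (g j) ξ‖ₑ ^ (2 / n : ℝ)) := by
          refine Finset.prod_le_prod' fun j _ => ?_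
          have h := extOp_biUnion (P j) (hWm j) (hWd j) (hS j).continuous
            (g := g j) (by rw [hWU j]; exact hg j) ξ
          rw [hWU j] at h
          rw [h]
          exact enorm_sum_rpow_le _ _ hq hq2 hN1 (hPN j)
      _ = _ := by
        rw [Finset.prod_mul_distrib, Finset.prod_univ_sum, Finset.prod_const, Finset.card_univ,
          Fintype.card_fin, ← ENNReal.ofReal_pow (by positivity)]
  have hFm : ∀ α ∈ Fintype.piFinset P, Measurable (F α) := fun α hα =>
    Finset.measurable_fun_prod _ fun j _ => (continuous_extOp (hS j).continuous
      ((hg j).mono_set (hsub j _ (Fintype.mem_piFinset.mp hα j)))).measurable.enorm.pow_const _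
  have hFle : ∀ α ∈ Fintype.piFinset P,
      ∫⁻ ξ in ball 0 R, F α ξ ≤ ENNReal.ofReal (c₁ * L ^ κ) * G := fun α hα => by
    have hα' := Fintype.mem_piFinset.mp hα
    choose x hxU hx using fun j => hWx j (α j) (hα' j)
    refine (hmain R hR x hxU (fun j => W j (α j)) (fun j => hWm j _) (fun j => (hx j).trans
      (ball_subset_ball (mul_le_mul_of_nonneg_right (min_le_left _ _) (by positivity)))) g
      fun j => (hg j).mono_set (hsub j _ (hα' j))).trans ?_
    refine mul_le_mul' le_rfl (Finset.prod_le_prod' fun j _ => ?_)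
    gcongr
    exact hsub j _ (hα' j)
  have hcardN : ((Fintype.piFinset P).card : ℝ) ≤ N ^ (n + 1) := by
    rw [Fintype.card_piFinset, Nat.cast_prod]
    refine (Finset.prod_le_prod (fun _ _ => Nat.cast_nonneg _) fun j _ => hPN j).trans_eq ?_
    simp
  calc _ ≤ ∫⁻ ξ in ball 0 R,
        ENNReal.ofReal ((N ^ 2) ^ (n + 1)) * ∑ α ∈ Fintype.piFinset P, F α ξ :=
        lintegral_mono hpt
    _ = ENNReal.ofReal ((N ^ 2) ^ (n + 1)) *
        ∑ α ∈ Fintype.piFinset P, ∫⁻ ξ in ball 0 R, F α ξ := by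
      rw [lintegral_const_mul' _ _ ENNReal.ofReal_ne_top, lintegral_finsetSum _ hFm]
    _ ≤ ENNReal.ofReal ((N ^ 2) ^ (n + 1)) *
        (ENNReal.ofReal (N ^ (n + 1)) * (ENNReal.ofReal (c₁ * L ^ κ) * G)) := by
      refine mul_le_mul' le_rfl ((Finset.sum_le_card_nsmul _ _ _ hFle).trans ?_)
      rw [nsmul_eq_mul, ← ENNReal.ofReal_natCast]
      gcongr
    _ = _ := by
      rw [← mul_assoc, ← mul_assoc, ← ENNReal.ofReal_mul (by positivity),
        ← ENNReal.ofReal_mul (by positivity)]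
      congr 2
      rw [hN]
      ring_nf

lemma extOp_eq_zero_of_not_aestronglyMeasurable {U : Set (EuclideanSpace ℝ (Fin n))}
    {S : EuclideanSpace ℝ (Fin n) → EuclideanSpace ℝ (Fin (n + 1))} (hS : Continuous S)
    {g : EuclideanSpace ℝ (Fin n) → ℂ}
    (hg : ¬ AEStronglyMeasurable g (volume.restrict U)) (ξ : EuclideanSpace ℝ (Fin (n + 1))) :
    extOp U S g ξ = 0 := by
  refine integral_undef fun h => hg ?_
  have hc : Continuous fun x => Complex.exp (-(Complex.I * (⟪ξ, S x⟫_ℝ : ℂ))) := by fun_prop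
  refine (hc.aestronglyMeasurable.mul h.aestronglyMeasurable).congr
    (Filter.Eventually.of_forall fun x => ?_)
  simp only [Pi.mul_apply, ← mul_assoc, ← Complex.exp_add, neg_add_cancel, Complex.exp_zero,
    one_mul]

lemma extOp_eq_zero_of_ae_eq_zero {U : Set (EuclideanSpace ℝ (Fin n))}
    (S : EuclideanSpace ℝ (Fin n) → EuclideanSpace ℝ (Fin (n + 1)))
    {g : EuclideanSpace ℝ (Fin n) → ℂ} (hg : g =ᵐ[volume.restrict U] 0)
    (ξ : EuclideanSpace ℝ (Fin (n + 1))) : extOp U S g ξ = 0 := by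
  refine integral_eq_zero_of_ae ?_
  filter_upwards [hg] with x hx
  simp [hx]

end Assembly
end MultilinearRestriction

/-- The logarithmic improvement of the Bennett–Carbery–Tao `d`-linear restriction
theorem (`d = n+1 ≥ 2`), obtained from Guth's endpoint multilinear Kakeya theorem by
induction on scales: for `d` transversal smooth compact parametrised hypersurfaces
there exist constants `C, κ` with
`(∫_{B(0,R)} ∏_j |E_j g_j|^{2/(d-1)})^{(d-1)/2} ≤ C (1+log R)^κ ∏_j ‖g_j‖_{L²(U_j)}`
for all `R ≥ 1`. -/
theorem multilinear_restriction_log (n : ℕ) (hn : 1 ≤ n) (ν₀ : ℝ) (hν₀ : 0 < ν₀)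
    (U : Fin (n + 1) → Set (EuclideanSpace ℝ (Fin n))) (hU : ∀ j, IsCompact (U j))
    (S : Fin (n + 1) → EuclideanSpace ℝ (Fin n) → EuclideanSpace ℝ (Fin (n + 1)))
    (hS : ∀ j, ContDiff ℝ (⊤ : ℕ∞) (S j))
    (hSimm : ∀ j, ∀ x ∈ U j, Function.Injective (fderiv ℝ (S j) x))
    (ν : Fin (n + 1) → EuclideanSpace ℝ (Fin n) → EuclideanSpace ℝ (Fin (n + 1)))
    (hνunit : ∀ j, ∀ x ∈ U j, ‖ν j x‖ = 1)
    (hνperp : ∀ j, ∀ x ∈ U j, ∀ v, ⟪ν j x, fderiv ℝ (S j) x v⟫_ℝ = 0)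
    (htrans : ∀ x : (j : Fin (n + 1)) → EuclideanSpace ℝ (Fin n),
      (∀ j, x j ∈ U j) →
      ν₀ ≤ |Matrix.det (Matrix.of fun i j => ν j (x j) i)|) :
    ∃ C > 0, ∃ κ : ℝ, ∀ R : ℝ, 1 ≤ R →
      ∀ g : (j : Fin (n + 1)) → EuclideanSpace ℝ (Fin n) → ℂ,
      (∫⁻ ξ in Metric.ball (0 : EuclideanSpace ℝ (Fin (n + 1))) R,
          ∏ j, (‖extOp (U j) (S j) (g j) ξ‖₊ : ℝ≥0∞) ^ ((2 : ℝ) / n)) ^ ((n : ℝ) / 2)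
        ≤ ENNReal.ofReal (C * (1 + Real.log R) ^ κ) *
          ∏ j, eLpNorm (g j) 2 (volume.restrict (U j)) := by
  obtain ⟨c, hc, κ, hmain⟩ :=
    MultilinearRestriction.exists_setLIntegral_prod_extOp_le_of_integrable hn hν₀ hU hS hSimm
      hνunit hνperp htrans
  have hn0 : (n : ℝ) ≠ 0 := by positivity
  refine ⟨c ^ ((n : ℝ) / 2), by positivity, κ * ((n : ℝ) / 2), fun R hR g => ?_⟩
  have hL : 0 < 1 + Real.log R := by have := Real.log_nonneg hR; linarith
  have hzero : ∀ j, (∀ ξ, extOp (U j) (S j) (g j) ξ = 0) →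
      (∫⁻ ξ in Metric.ball (0 : EuclideanSpace ℝ (Fin (n + 1))) R,
        ∏ j, (‖extOp (U j) (S j) (g j) ξ‖₊ : ℝ≥0∞) ^ ((2 : ℝ) / n)) ^ ((n : ℝ) / 2) = 0 := by
    intro j hj
    have h : ∀ ξ, ∏ j, (‖extOp (U j) (S j) (g j) ξ‖₊ : ℝ≥0∞) ^ ((2 : ℝ) / n) = 0 := fun ξ =>
      Finset.prod_eq_zero (Finset.mem_univ j) <| by
        rw [hj ξ, nnnorm_zero, ENNReal.coe_zero, ENNReal.zero_rpow_of_pos (by positivity)]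
    simp_rw [h]
    rw [lintegral_zero, ENNReal.zero_rpow_of_pos (by positivity)]
  by_cases hm : ∀ j, AEStronglyMeasurable (g j) (volume.restrict (U j))
  swap
  · push Not at hm
    obtain ⟨j, hj⟩ := hm
    rw [hzero j (MultilinearRestriction.extOp_eq_zero_of_not_aestronglyMeasurable
      (hS j).continuous hj)]
    exact zero_le
  by_cases h0 : ∃ j, eLpNorm (g j) 2 (volume.restrict (U j)) = 0
  · obtain ⟨j, hj⟩ := h0
    rw [hzero j (MultilinearRestriction.extOp_eq_zero_of_ae_eq_zero (S j)
      ((eLpNorm_eq_zero_iff (hm j) two_ne_zero).mp hj))]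
    exact zero_le
  by_cases htop : ∃ j, eLpNorm (g j) 2 (volume.restrict (U j)) = ⊤
  · obtain ⟨j, hj⟩ := htop
    push Not at h0
    have h1 : ∏ j, eLpNorm (g j) 2 (volume.restrict (U j)) = ⊤ := by
      rw [← Finset.mul_prod_erase _ _ (Finset.mem_univ j), hj]
      exact ENNReal.top_mul (Finset.prod_ne_zero_iff.mpr fun i _ => h0 i)
    rw [h1, ENNReal.mul_top (ENNReal.ofReal_pos.mpr (by positivity)).ne']
    exact le_top
  push Not at htop
  have hint : ∀ j, IntegrableOn (g j) (U j) := fun j => by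
    have : IsFiniteMeasure (volume.restrict (U j)) := ⟨by
      rw [Measure.restrict_apply_univ]; exact (hU j).measure_lt_top⟩
    exact MemLp.integrable one_le_two ⟨hm j, (htop j).lt_top⟩
  refine (ENNReal.rpow_le_rpow (hmain R hR g hint) (by positivity)).trans_eq ?_
  rw [ENNReal.mul_rpow_of_nonneg _ _ (by positivity),
    ENNReal.ofReal_rpow_of_nonneg (by positivity) (by positivity),
    ← ENNReal.prod_rpow_of_nonneg (by positivity),
    Real.mul_rpow hc.le (by positivity), ← Real.rpow_natCast, ← Real.rpow_mul hL.le]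
  congr 1
  refine Finset.prod_congr rfl fun j _ => ?_
  rw [eLpNorm_eq_lintegral_rpow_enorm_toReal two_ne_zero ENNReal.ofNat_ne_top, ← ENNReal.rpow_mul]
  congr 1
  · simp
  · field_simp
    simp
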